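/- Let n ≥ 2, p ≥ 1 and λ ∈ (1, ∞), and set λ' = λ/(λ−1). For each nonzero nonnegative continuous function f : ℝⁿ → ℝ with compact support there exists a point c ∈ ℝⁿ such that for every ε ∈ [0, 1/2), ‖f‖₁^{n+λ'p} ≤ b_{n,p,λ} ‖f‖_λ^{λ'p} ( ∫_{S^{n−1}} ( ∫_{ℝⁿ} f(x − c) ⟨x,ξ⟩_ε^p dx )^{−n/p} dξ )^{−p}. -/

import Mathlib

open MeasureTheory Real
open scoped RealInnerProductSpace

/-- The constant `R_{n,p}` from the Haberl–Schuster asymmetric `L_p` Blaschke–Santaló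
inequality: the value of the sharp bound, attained for the Euclidean ball. -/
noncomputable def Rnp (n : ℕ) (p : ℝ) : ℝ :=
  Real.pi ^ ((n : ℝ) / (2 * p) + n) / (Real.Gamma (((n : ℝ) + 2) / 2)) ^ (2 : ℕ) *
    (2 * Real.Gamma (((n : ℝ) + p + 2) / 2) /
      (Real.Gamma (((n : ℝ) + 2) / 2) * Real.Gamma ((p + 1) / 2))) ^ ((n : ℝ) / p)

/-- The constant `a_{n,p,λ}` for `λ > 1`, with `λ' = λ/(λ-1)`; here
`B(m,l) = Γ(m)Γ(l)/Γ(m+l)` is the Beta function. -/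
noncomputable def anpl (n : ℕ) (p lam : ℝ) : ℝ :=
  (((n : ℝ) / p) * ((n : ℝ) / ((lam / (lam - 1)) * p) + 1) ^ (lam / (lam - 1) - 1) *
      ((lam / (lam - 1)) * p / (n : ℝ) + 1) ^ ((n : ℝ) / p) *
      (Real.Gamma ((n : ℝ) / p) * Real.Gamma (lam / (lam - 1)) /
        Real.Gamma ((n : ℝ) / p + lam / (lam - 1)))) ^ p

/-- The constant `b_{n,p,λ} = (n/(n+p))^n a_{n,p,λ} R_{n,p}^p n^p` for `λ > 1`. -/
noncomputable def bnpl (n : ℕ) (p lam : ℝ) : ℝ :=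
  ((n : ℝ) / ((n : ℝ) + p)) ^ (n : ℝ) * anpl n p lam * Rnp n p ^ p * (n : ℝ) ^ p

/-- The asymmetric bracket `⟨x,y⟩_ε^p` applied to a real number `s = ⟨x,y⟩`:
`(1-ε) (max{s,0})^p + ε (max{-s,0})^p`. -/
noncomputable def epsPow (eps p s : ℝ) : ℝ :=
  (1 - eps) * (max s 0) ^ p + eps * (max (-s) 0) ^ p

namespace AsymmetricBS
open Set Filter Topology ENNReal

/-- Joint convexity of the perspective `(t, s) ↦ t ^ (k + 1) / s ^ k` at the midpoint. -/
theorem midpoint_perspective_le (k : ℕ) {a b u v : ℝ} (ha : 0 < a) (hb : 0 < b) (hu : 0 < u)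
    (hv : 0 < v) :
    ((u + v) / 2) ^ (k + 1) / ((a + b) / 2) ^ k ≤ (u ^ (k + 1) / a ^ k + v ^ (k + 1) / b ^ k) / 2 := by
  have hab : 0 < a + b := by positivity
  have h := (convexOn_pow (𝕜 := ℝ) (k + 1)).2 (show u / a ∈ Ici 0 from (div_pos hu ha).le)
    (show v / b ∈ Ici 0 from (div_pos hv hb).le) (show 0 ≤ a / (a + b) by positivity)
    (show 0 ≤ b / (a + b) by positivity) (by field_simp)
  simp only [smul_eq_mul] at h
  have e1 : a / (a + b) * (u / a) + b / (a + b) * (v / b) = (u + v) / (a + b) := by field_simp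
  rw [e1] at h
  have h2 := mul_le_mul_of_nonneg_left h (show 0 ≤ (a + b) / 2 by positivity)
  calc _ = (a + b) / 2 * ((u + v) / (a + b)) ^ (k + 1) := by
          simp only [div_pow, pow_succ]; field_simp
    _ ≤ _ := h2
    _ = _ := by simp only [div_pow, pow_succ]; field_simp

theorem exists_quantile {g : ℝ → ℝ} (hc : Continuous g) (hpos : ∀ x, 0 < g x)
    (hi : Integrable g) :
    ∃ X : ℝ → ℝ, ∀ θ ∈ Ioo (0 : ℝ) 1, HasDerivAt X ((∫ x, g x) / g (X θ)) θ := by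
  have hI : 0 < ∫ x, g x := by
    rw [integral_pos_iff_support_of_nonneg (fun x => (hpos x).le) hi]
    have : Function.support g = univ := by
      ext x; simp [(hpos x).ne']
    simp [this]
  set I := ∫ x, g x with hIdef
  set Φ : ℝ → ℝ := fun x => (∫ t in Iic x, g t) / I with hΦ
  have hder : ∀ x, HasDerivAt Φ (g x / I) x := by
    intro x
    have h1 : ∀ y, ∫ t in Iic y, g t = (∫ t in Iic 0, g t) + ∫ t in (0 : ℝ)..y, g t := by
      intro y
      rw [intervalIntegral.integral_Iic_sub_Iic hi.integrableOn hi.integrableOn |>.symm]; ring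
    have h2 : HasDerivAt (fun y => ∫ t in (0 : ℝ)..y, g t) (g x) x :=
      hc.integral_hasStrictDerivAt 0 x |>.hasDerivAt
    have h3 := (h2.const_add (∫ t in Iic 0, g t)).div_const I
    refine h3.congr_of_eventuallyEq (Eventually.of_forall fun y => ?_)
    simp only [hΦ, h1 y]
  have hmono : StrictMono Φ := strictMono_of_deriv_pos fun x => by
    rw [(hder x).deriv]; exact div_pos (hpos x) hI
  have hcont : Continuous Φ := continuous_iff_continuousAt.2 fun x => (hder x).continuousAt
  have hbot : Tendsto Φ atBot (𝓝 0) := by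
    have := tendsto_setIntegral_of_antitone (μ := volume) (f := g) (s := fun n : ℝ => Iic (-n))
      (fun _ => measurableSet_Iic) (fun a b hab => Iic_subset_Iic.2 (by linarith))
      ⟨0, hi.integrableOn⟩
    have h0 : ⋂ n : ℝ, Iic (-n) = ∅ := by
      ext x; simp only [mem_iInter, mem_Iic, mem_empty_iff_false, iff_false, not_forall, not_le]
      exact ⟨-x + 1, by linarith⟩
    rw [h0, Measure.restrict_empty, integral_zero_measure] at this
    have h4 := (this.comp tendsto_neg_atBot_atTop).div_const I
    simpa [Function.comp_def] using h4
  have htop : Tendsto Φ atTop (𝓝 1) := by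
    have := tendsto_setIntegral_of_monotone (μ := volume) (f := g) (s := fun n : ℝ => Iic n)
      (fun _ => measurableSet_Iic) (fun a b hab => Iic_subset_Iic.2 hab)
      hi.integrableOn
    have h0 : ⋃ n : ℝ, Iic n = univ := by
      ext x; simp only [mem_iUnion, mem_Iic, mem_univ, iff_true]
      exact ⟨x, le_rfl⟩
    rw [h0, setIntegral_univ] at this
    have h4 := this.div_const I
    rwa [div_self hI.ne'] at h4
  have hrange : ∀ x, Φ x ∈ Ioo (0 : ℝ) 1 := by
    intro x
    have h1 := hmono.monotone.le_of_tendsto hbot (x - 1)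
    have h2 := hmono.monotone.ge_of_tendsto htop (x + 1)
    exact ⟨h1.trans_lt (hmono (by linarith)), (hmono (by linarith)).trans_le h2⟩
  have hsurj : ∀ θ ∈ Ioo (0 : ℝ) 1, ∃ x, Φ x = θ := by
    intro θ hθ
    obtain ⟨a, ha⟩ := (hbot.eventually (gt_mem_nhds hθ.1)).exists
    obtain ⟨b, hb⟩ := (htop.eventually (lt_mem_nhds hθ.2)).exists
    exact mem_range_of_exists_le_of_exists_ge hcont ⟨a, ha.le⟩ ⟨b, hb.le⟩
  have hinv : ∀ x, Function.invFun Φ (Φ x) = x := Function.leftInverse_invFun hmono.injective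
  have hinv' : ∀ θ ∈ Ioo (0 : ℝ) 1, Φ (Function.invFun Φ θ) = θ := fun θ hθ =>
    Function.invFun_eq (hsurj θ hθ)
  refine ⟨Function.invFun Φ, fun θ hθ => ?_⟩
  have hnhds : Ioo (0 : ℝ) 1 ∈ 𝓝 θ := isOpen_Ioo.mem_nhds hθ
  have hca : ContinuousAt (Function.invFun Φ) θ := by
    refine continuousAt_of_monotoneOn_of_image_mem_nhds (s := Ioo 0 1) ?_ hnhds ?_
    · intro a ha b hb hab
      rw [← hmono.le_iff_le, hinv' a ha, hinv' b hb]; exact hab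
    · have : Function.invFun Φ '' Ioo 0 1 = univ := by
        refine eq_univ_of_forall fun x => ⟨Φ x, hrange x, hinv x⟩
      rw [this]; exact univ_mem
  have := HasDerivAt.of_local_left_inverse hca (hder _) (div_pos (hpos _) hI).ne'
    (eventually_of_mem hnhds hinv')
  rwa [inv_div] at this

theorem le_integral_of_midpoint_le (k : ℕ) {G₁ G₂ H : ℝ → ℝ}
    (hG₁ : Continuous G₁) (hG₂ : Continuous G₂)
    (hG₁' : ∀ x, 0 < G₁ x) (hG₂' : ∀ x, 0 < G₂ x) (hH' : ∀ x, 0 < H x)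
    (hi₁ : Integrable fun x => (G₁ x ^ (k + 1))⁻¹) (hi₂ : Integrable fun x => (G₂ x ^ (k + 1))⁻¹)
    (hi : Integrable fun x => (H x ^ (k + 1))⁻¹)
    (h : ∀ x y, H ((x + y) / 2) ≤ (G₁ x + G₂ y) / 2) {a b : ℝ} (ha : 0 < a) (hb : 0 < b)
    (hIa : ∫ x, (G₁ x ^ (k + 1))⁻¹ = (a ^ k)⁻¹) (hIb : ∫ x, (G₂ x ^ (k + 1))⁻¹ = (b ^ k)⁻¹) :
    (((a + b) / 2) ^ k)⁻¹ ≤ ∫ x, (H x ^ (k + 1))⁻¹ := by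
  obtain ⟨X, hX⟩ := exists_quantile (g := fun x => (G₁ x ^ (k + 1))⁻¹)
    ((hG₁.pow _).inv₀ fun x => (pow_pos (hG₁' x) _).ne') (fun x => inv_pos.2 (pow_pos (hG₁' x) _)) hi₁
  obtain ⟨Y, hY⟩ := exists_quantile (g := fun x => (G₂ x ^ (k + 1))⁻¹)
    ((hG₂.pow _).inv₀ fun x => (pow_pos (hG₂' x) _).ne') (fun x => inv_pos.2 (pow_pos (hG₂' x) _)) hi₂
  rw [hIa] at hX
  rw [hIb] at hY
  simp only [div_inv_eq_mul] at hX hY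
  set Z : ℝ → ℝ := fun θ => (X θ + Y θ) / 2 with hZ
  set Z' : ℝ → ℝ := fun θ => ((a ^ k)⁻¹ * G₁ (X θ) ^ (k + 1) + (b ^ k)⁻¹ * G₂ (Y θ) ^ (k + 1)) / 2
    with hZ'
  have hZd : ∀ θ ∈ Ioo (0 : ℝ) 1, HasDerivAt Z (Z' θ) θ := fun θ hθ =>
    ((hX θ hθ).add (hY θ hθ)).div_const 2
  have hZpos : ∀ θ, 0 < Z' θ := fun θ => by
    have := hG₁' (X θ); have := hG₂' (Y θ); positivity
  have hinj : InjOn Z (Ioo 0 1) := by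
    refine (strictMonoOn_of_deriv_pos (convex_Ioo 0 1)
      (fun θ hθ => (hZd θ hθ).continuousAt.continuousWithinAt) ?_).injOn
    intro θ hθ
    rw [interior_Ioo] at hθ
    rw [(hZd θ hθ).deriv]
    exact hZpos θ
  have hcv := lintegral_image_eq_lintegral_abs_deriv_mul measurableSet_Ioo
    (fun θ hθ => (hZd θ hθ).hasDerivWithinAt) hinj (fun x => ENNReal.ofReal ((H x ^ (k + 1))⁻¹))
  have hnn : ∀ x, 0 ≤ (H x ^ (k + 1))⁻¹ := fun x => by have := hH' x; positivity
  have hkey : ENNReal.ofReal ((((a + b) / 2) ^ k)⁻¹) ≤ ENNReal.ofReal (∫ x, (H x ^ (k + 1))⁻¹) := by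
    rw [ofReal_integral_eq_lintegral_ofReal hi (Eventually.of_forall hnn)]
    refine le_trans ?_ (setLIntegral_le_lintegral (Z '' Ioo 0 1) _)
    rw [hcv]
    calc ENNReal.ofReal ((((a + b) / 2) ^ k)⁻¹)
        = ∫⁻ _ in Ioo (0 : ℝ) 1, ENNReal.ofReal ((((a + b) / 2) ^ k)⁻¹) := by simp
      _ ≤ _ := by
        refine setLIntegral_mono' measurableSet_Ioo fun θ hθ => ?_
        rw [← ENNReal.ofReal_mul (abs_nonneg _)]
        refine ENNReal.ofReal_le_ofReal ?_
        rw [abs_of_pos (hZpos θ)]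
        have h1 := midpoint_perspective_le k ha hb (hG₁' (X θ)) (hG₂' (Y θ))
        have h2 : H (Z θ) ^ (k + 1) ≤ ((G₁ (X θ) + G₂ (Y θ)) / 2) ^ (k + 1) :=
          pow_le_pow_left₀ (hH' _).le (h _ _) _
        have h3 : 0 < H (Z θ) ^ (k + 1) := pow_pos (hH' _) _
        have h4 : 0 < ((a + b) / 2) ^ k := by positivity
        have h5 : Z' θ = (G₁ (X θ) ^ (k + 1) / a ^ k + G₂ (Y θ) ^ (k + 1) / b ^ k) / 2 := by
          simp only [hZ']; ring
        rw [h5, ← div_eq_mul_inv, le_div_iff₀ h3]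
        refine le_trans ?_ h1
        rw [inv_mul_eq_div]
        gcongr
  exact (ENNReal.ofReal_le_ofReal_iff (integral_nonneg hnn)).1 hkey

/-- Continuous functions bounded below by a positive multiple of `1 + ‖y‖`. -/
def LinearGrowth {d : ℕ} (G : (Fin d → ℝ) → ℝ) : Prop :=
  Continuous G ∧ ∃ c > 0, ∀ y, c * (1 + ‖y‖) ≤ G y

theorem LinearGrowth.pos {d : ℕ} {G : (Fin d → ℝ) → ℝ} (hG : LinearGrowth G) (y : Fin d → ℝ) :
    0 < G y := by
  obtain ⟨-, c, hc, h⟩ := hG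
  exact lt_of_lt_of_le (by positivity) (h y)

theorem integrable_inv_pow_of_growth {E : Type*} [NormedAddCommGroup E] [NormedSpace ℝ E]
    [FiniteDimensional ℝ E] [MeasurableSpace E] [BorelSpace E] (μ : Measure E)
    [μ.IsAddHaarMeasure] {G : E → ℝ} (hG : Continuous G) {c : ℝ} (hc : 0 < c)
    (h : ∀ y, c * (1 + ‖y‖) ≤ G y) {k : ℕ} (hk : Module.finrank ℝ E < k) :
    Integrable (fun y => (G y ^ k)⁻¹) μ := by
  have hpos : ∀ y, 0 < G y := fun y => lt_of_lt_of_le (by positivity) (h y)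
  have h1 : Integrable (fun y : E => (1 + ‖y‖) ^ (-(k : ℝ))) μ :=
    integrable_one_add_norm (by exact_mod_cast hk)
  refine (h1.const_mul ((c ^ k)⁻¹)).mono'
    (((hG.pow k).inv₀ fun y => (pow_pos (hpos y) _).ne').aestronglyMeasurable)
    (Eventually.of_forall fun y => ?_)
  have := hpos y
  rw [Real.norm_of_nonneg (by positivity), Real.rpow_neg (by positivity), Real.rpow_natCast,
    ← mul_inv, ← mul_pow]
  gcongr
  exact h y

theorem LinearGrowth.integrable {d k : ℕ} {G : (Fin d → ℝ) → ℝ} (hG : LinearGrowth G)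
    (hk : d < k) : Integrable fun y => (G y ^ k)⁻¹ := by
  obtain ⟨h, c, hc, h'⟩ := hG
  exact integrable_inv_pow_of_growth _ h hc h' (by simpa using hk)

theorem norm_le_norm_insertNth {d : ℕ} (i : Fin (d + 1)) (s : ℝ) (y : Fin d → ℝ) :
    (|s| + ‖y‖) / 2 ≤ ‖(i.insertNth s y : Fin (d + 1) → ℝ)‖ := by
  have h1 : |s| ≤ ‖(i.insertNth s y : Fin (d + 1) → ℝ)‖ := by
    simpa using norm_le_pi_norm (i.insertNth s y : Fin (d + 1) → ℝ) i
  have h2 : ‖y‖ ≤ ‖(i.insertNth s y : Fin (d + 1) → ℝ)‖ := by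
    refine (pi_norm_le_iff_of_nonneg (norm_nonneg _)).2 fun j => ?_
    simpa using norm_le_pi_norm (i.insertNth s y : Fin (d + 1) → ℝ) (i.succAbove j)
  linarith

theorem LinearGrowth.insertNth_bound {d : ℕ} {G : (Fin (d + 1) → ℝ) → ℝ} (hG : LinearGrowth G) :
    ∃ c > 0, ∀ s y, c * (1 + ‖y‖ + |s|) ≤ G (Fin.insertNth 0 s y) := by
  obtain ⟨-, c, hc, h⟩ := hG
  refine ⟨c / 2, by positivity, fun s y => le_trans ?_ (h _)⟩
  have := norm_le_norm_insertNth 0 s y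
  nlinarith

/-- The marginal of `G ^ (-(k + 1))`, rescaled so that it has the homogeneity of `G`. -/
noncomputable def marginal {d : ℕ} (k : ℕ) (G : (Fin (d + 1) → ℝ) → ℝ) (y : Fin d → ℝ) : ℝ :=
  ((∫ s, (G (Fin.insertNth 0 s y) ^ (k + 1))⁻¹)⁻¹) ^ ((k : ℝ)⁻¹)

section marginal
variable {d k : ℕ} {G : (Fin (d + 1) → ℝ) → ℝ}

theorem LinearGrowth.fiber_continuous (hG : LinearGrowth G) (y : Fin d → ℝ) :
    Continuous fun s => G (Fin.insertNth 0 s y) :=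
  hG.1.comp (Continuous.finInsertNth (A := fun _ : Fin (d + 1) => ℝ) 0 continuous_id
    (continuous_const (y := y)))

theorem LinearGrowth.fiber_integrable (hG : LinearGrowth G) (hk : 0 < k) (y : Fin d → ℝ) :
    Integrable fun s => (G (Fin.insertNth 0 s y) ^ (k + 1))⁻¹ := by
  obtain ⟨c, hc, h⟩ := hG.insertNth_bound
  refine integrable_inv_pow_of_growth volume (hG.fiber_continuous y) hc (fun s => ?_) (by simpa)
  refine le_trans ?_ (h s y)
  have := norm_nonneg y
  rw [Real.norm_eq_abs]
  gcongr
  linarith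

theorem LinearGrowth.fiber_integral_pos (hG : LinearGrowth G) (hk : 0 < k) (y : Fin d → ℝ) :
    0 < ∫ s, (G (Fin.insertNth 0 s y) ^ (k + 1))⁻¹ := by
  have hp : ∀ s, 0 < (G (Fin.insertNth 0 s y) ^ (k + 1))⁻¹ := fun s =>
    inv_pos.2 (pow_pos (hG.pos _) _)
  rw [integral_pos_iff_support_of_nonneg (fun x => (hp x).le) (hG.fiber_integrable hk y)]
  have : Function.support (fun s => (G (Fin.insertNth 0 s y) ^ (k + 1))⁻¹) = univ := by
    ext s; simpa using (hG.pos (Fin.insertNth 0 s y)).ne'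
  rw [this]; simp

theorem LinearGrowth.marginal_pow (hG : LinearGrowth G) (hk : 0 < k) (y : Fin d → ℝ) :
    marginal k G y ^ k = (∫ s, (G (Fin.insertNth 0 s y) ^ (k + 1))⁻¹)⁻¹ :=
  Real.rpow_inv_natCast_pow (inv_nonneg.2 (hG.fiber_integral_pos hk y).le) hk.ne'

theorem LinearGrowth.continuous_fiber_integral (hG : LinearGrowth G) (hk : 0 < k) :
    Continuous fun y : Fin d → ℝ => ∫ s, (G (Fin.insertNth 0 s y) ^ (k + 1))⁻¹ := by
  obtain ⟨c, hc, h⟩ := hG.insertNth_bound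
  have hb : Integrable fun s : ℝ => ((c * (1 + ‖s‖)) ^ (k + 1))⁻¹ :=
    integrable_inv_pow_of_growth volume (by fun_prop) hc (fun s => le_rfl) (by simpa)
  refine continuous_of_dominated (fun y => (hG.fiber_integrable hk y).aestronglyMeasurable)
    (fun y => Eventually.of_forall fun s => ?_) hb (Eventually.of_forall fun s => ?_)
  · have := hG.pos (Fin.insertNth 0 s y)
    rw [Real.norm_of_nonneg (by positivity)]
    gcongr
    refine le_trans ?_ (h s y)
    have := norm_nonneg y
    rw [Real.norm_eq_abs]
    gcongr
    linarith
  · exact ((hG.1.comp (Continuous.finInsertNth (A := fun _ : Fin (d + 1) => ℝ) 0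
      (continuous_const (y := s)) continuous_id)).pow _).inv₀
      fun y => (pow_pos (hG.pos _) _).ne'

theorem LinearGrowth.rescaled_marginal (hG : LinearGrowth G) (hk : 0 < k) :
    LinearGrowth (marginal (d := d) k G) := by
  refine ⟨((hG.continuous_fiber_integral hk).inv₀
    fun y => (hG.fiber_integral_pos hk y).ne').rpow_const fun y => Or.inr (by positivity), ?_⟩
  obtain ⟨c, hc, h⟩ := hG.insertNth_bound
  set K : ℝ := ∫ s : ℝ, ((1 + ‖s‖) ^ (k + 1))⁻¹ with hK
  have hKi : Integrable fun s : ℝ => ((1 + ‖s‖) ^ (k + 1))⁻¹ :=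
    integrable_inv_pow_of_growth volume (by fun_prop) one_pos (fun s => by rw [one_mul]) (by simpa)
  have hKpos : 0 < K := by
    rw [hK, integral_pos_iff_support_of_nonneg (fun x => by positivity) hKi]
    have : Function.support (fun s : ℝ => ((1 + ‖s‖) ^ (k + 1))⁻¹) = univ := by
      ext s
      have : 0 < 1 + ‖s‖ := by positivity
      simpa using this.ne'
    rw [this]; simp
  set C : ℝ := c ^ (k + 1) / K
  have hC : 0 < C := by positivity
  refine ⟨C ^ ((k : ℝ)⁻¹), by positivity, fun y => ?_⟩
  have hB : 0 < 1 + ‖y‖ := by positivity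
  have hle : ∫ s, (G (Fin.insertNth 0 s y) ^ (k + 1))⁻¹ ≤ (C * (1 + ‖y‖) ^ k)⁻¹ := by
    calc ∫ s, (G (Fin.insertNth 0 s y) ^ (k + 1))⁻¹
        ≤ ∫ s : ℝ, ((c * (1 + ‖y‖)) ^ (k + 1))⁻¹ * ((1 + ‖s / (1 + ‖y‖)‖) ^ (k + 1))⁻¹ := by
          refine integral_mono (hG.fiber_integrable hk y)
            ((hKi.comp_div hB.ne').const_mul _) fun s => ?_
          have e : (c * (1 + ‖y‖)) * (1 + ‖s / (1 + ‖y‖)‖) = c * (1 + ‖y‖ + |s|) := by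
            rw [norm_div, Real.norm_of_nonneg hB.le, Real.norm_eq_abs]; field_simp
          simp only
          rw [← mul_inv, ← mul_pow, e]
          gcongr
          exact h s y
      _ = (C * (1 + ‖y‖) ^ k)⁻¹ := by
          rw [integral_const_mul, Measure.integral_comp_div (fun s : ℝ => ((1 + ‖s‖) ^ (k + 1))⁻¹),
            ← hK, abs_of_pos hB, smul_eq_mul]
          simp only [C, mul_pow, pow_succ]
          field_simp
  have h2 : C * (1 + ‖y‖) ^ k ≤ (∫ s, (G (Fin.insertNth 0 s y) ^ (k + 1))⁻¹)⁻¹ :=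
    (le_inv_comm₀ (by positivity) (hG.fiber_integral_pos hk y)).2 hle
  calc C ^ ((k : ℝ)⁻¹) * (1 + ‖y‖) = (C * (1 + ‖y‖) ^ k) ^ ((k : ℝ)⁻¹) := by
        rw [Real.mul_rpow hC.le (by positivity), Real.pow_rpow_inv_natCast hB.le hk.ne']
    _ ≤ _ := Real.rpow_le_rpow (by positivity) h2 (by positivity)

theorem LinearGrowth.integral_marginal (hG : LinearGrowth G) (hk : d < k) :
    ∫ y, (marginal (d := d) k G y ^ k)⁻¹ = ∫ y, (G y ^ (k + 1))⁻¹ := by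
  have hmp := (volume_preserving_piFinSuccAbove (fun _ : Fin (d + 1) => ℝ) 0).symm
  have h_int : Integrable fun y => (G y ^ (k + 1))⁻¹ := hG.integrable (by omega)
  rw [← hmp.integral_comp' (fun y => (G y ^ (k + 1))⁻¹)]
  have h_int' := (hmp.integrable_comp_emb (MeasurableEquiv.measurableEmbedding _)).2 h_int
  refine Eq.symm ((integral_prod_symm _ h_int').trans ?_)
  refine integral_congr_ae (Eventually.of_forall fun y => ?_)
  simp only
  rw [hG.marginal_pow (by omega), inv_inv]
  rfl

end marginal

/-- A Borell–Brascamp–Lieb inequality at the midpoint, with negative exponent. -/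
theorem borell_brascamp_lieb (d : ℕ) : ∀ (m : ℕ) (_ : 0 < m) {G₁ G₂ H : (Fin d → ℝ) → ℝ}
    (_ : LinearGrowth G₁) (_ : LinearGrowth G₂) (_ : LinearGrowth H)
    (_ : ∀ x y, H ((2 : ℝ)⁻¹ • (x + y)) ≤ (G₁ x + G₂ y) / 2) {a b : ℝ} (_ : 0 < a) (_ : 0 < b)
    (_ : ∫ x, (G₁ x ^ (d + m))⁻¹ = (a ^ m)⁻¹) (_ : ∫ x, (G₂ x ^ (d + m))⁻¹ = (b ^ m)⁻¹),
    (((a + b) / 2) ^ m)⁻¹ ≤ ∫ x, (H x ^ (d + m))⁻¹ := by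
  induction d with
  | zero =>
    intro m hm G₁ G₂ H hG₁ hG₂ hH h a b ha hb hIa hIb
    have hvol : ∀ F : (Fin 0 → ℝ) → ℝ, ∫ x, F x = F 0 := fun F => by
      rw [Measure.volume_pi_eq_dirac 0, integral_dirac]
    rw [hvol] at *
    simp only [zero_add, inv_inj] at *
    have e1 : G₁ 0 = a := (pow_left_inj₀ (hG₁.pos 0).le ha.le hm.ne').1 hIa
    have e2 : G₂ 0 = b := (pow_left_inj₀ (hG₂.pos 0).le hb.le hm.ne').1 hIb
    have := h 0 0
    simp only [add_zero, smul_zero, e1, e2] at this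
    have := hH.pos 0
    gcongr
  | succ d ih =>
    intro m hm G₁ G₂ H hG₁ hG₂ hH h a b ha hb hIa hIb
    have hk : d < d + m := by omega
    have hk0 : 0 < d + m := by omega
    have e : d + 1 + m = (d + m) + 1 := by omega
    rw [e] at hIa hIb ⊢
    rw [← hG₁.integral_marginal hk] at hIa
    rw [← hG₂.integral_marginal hk] at hIb
    rw [← hH.integral_marginal hk]
    refine ih m hm (hG₁.rescaled_marginal hk0) (hG₂.rescaled_marginal hk0) (hH.rescaled_marginal hk0) (fun x y => ?_) ha hb
      hIa hIb
    have hx := (hG₁.rescaled_marginal (k := d + m) hk0).pos x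
    have hy := (hG₂.rescaled_marginal (k := d + m) hk0).pos y
    have key := le_integral_of_midpoint_le (d + m) (hG₁.fiber_continuous x)
      (hG₂.fiber_continuous y) (fun s => hG₁.pos _) (fun s => hG₂.pos _)
      (fun s => hH.pos (Fin.insertNth 0 s ((2 : ℝ)⁻¹ • (x + y)))) (hG₁.fiber_integrable hk0 x)
      (hG₂.fiber_integrable hk0 y) (hH.fiber_integrable hk0 _) (fun s t => ?_) hx hy
      (by rw [hG₁.marginal_pow hk0, inv_inv]) (by rw [hG₂.marginal_pow hk0, inv_inv])
    · rw [← inv_inv (∫ _, _), ← hH.marginal_pow hk0] at key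
      have h3 := (inv_le_inv₀ (by positivity) (pow_pos ((hH.rescaled_marginal hk0).pos _) _)).1 key
      exact le_of_pow_le_pow_left₀ hk0.ne' (by positivity) h3
    · refine le_trans (le_of_eq ?_) (h _ _)
      congr 1
      ext j
      refine Fin.cases ?_ (fun j => ?_) j
      · simp; ring
      · simp; ring

/-- Euclidean space of dimension `m + 1`. -/
abbrev Euc (m : ℕ) := EuclideanSpace ℝ (Fin (m + 1))

variable {m : ℕ} {R M p : ℝ} {W : Set (Euc m × ℝ)}

/-- The point of `Euc m` with `i`-th coordinate `s` and remaining coordinates `u`. -/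
noncomputable def ins (i : Fin (m + 1)) (s : ℝ) (u : Fin m → ℝ) : Euc m :=
  WithLp.toLp 2 (i.insertNth s u)

/-- The coordinates of a point other than the `i`-th one. -/
def rest (i : Fin (m + 1)) (x : Euc m) : Fin m → ℝ := fun k => x (i.succAbove k)

@[simp] theorem ins_self (i : Fin (m + 1)) (s : ℝ) (u : Fin m → ℝ) : ins i s u i = s := by
  simp [ins]

@[simp] theorem ins_succAbove (i : Fin (m + 1)) (s : ℝ) (u : Fin m → ℝ) (k : Fin m) :
    ins i s u (i.succAbove k) = u k := by
  simp [ins]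

@[simp] theorem rest_ins (i : Fin (m + 1)) (s : ℝ) (u : Fin m → ℝ) : rest i (ins i s u) = u := by
  ext k; simp [rest]

theorem ext_ins (i : Fin (m + 1)) {x y : Euc m} (h : x i = y i)
    (h' : ∀ k, x (i.succAbove k) = y (i.succAbove k)) : x = y := by
  ext j
  rcases i.eq_self_or_eq_succAbove j with rfl | ⟨k, rfl⟩
  · exact h
  · exact h' k

@[simp] theorem ins_rest (i : Fin (m + 1)) (x : Euc m) : ins i (x i) (rest i x) = x :=
  ext_ins i (by simp) (by simp [rest])

theorem ins_add_ins (i : Fin (m + 1)) (s t : ℝ) (u v : Fin m → ℝ) :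
    ins i s u + ins i t v = ins i (s + t) (u + v) :=
  ext_ins i (by simp) (by simp)

theorem smul_ins (i : Fin (m + 1)) (a s : ℝ) (u : Fin m → ℝ) :
    a • ins i s u = ins i (a * s) (a • u) :=
  ext_ins i (by simp) (by simp)

theorem neg_ins (i : Fin (m + 1)) (s : ℝ) (u : Fin m → ℝ) : -ins i s u = ins i (-s) (-u) :=
  ext_ins i (by simp) (by simp)

theorem inner_ins (i : Fin (m + 1)) (s t : ℝ) (u v : Fin m → ℝ) :
    ⟪ins i s u, ins i t v⟫ = s * t + u ⬝ᵥ v := by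
  simp [PiLp.inner_apply, i.sum_univ_succAbove, dotProduct, mul_comm]

theorem norm_ins_sq (i : Fin (m + 1)) (s : ℝ) (u : Fin m → ℝ) :
    ‖ins i s u‖ ^ 2 = s ^ 2 + u ⬝ᵥ u := by
  rw [← real_inner_self_eq_norm_sq, inner_ins]; ring

theorem continuous_ins (i : Fin (m + 1)) :
    Continuous fun q : ℝ × (Fin m → ℝ) => ins i q.1 q.2 := by
  refine (PiLp.continuous_toLp 2 _).comp (continuous_pi fun j => ?_)
  rcases i.eq_self_or_eq_succAbove j with rfl | ⟨k, rfl⟩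
  · simpa using continuous_fst
  · simp only [Fin.insertNth_apply_succAbove]
    fun_prop

theorem continuous_rest (i : Fin (m + 1)) : Continuous (rest (m := m) i) :=
  continuous_pi fun _ => PiLp.continuous_apply 2 _ _

/-- Separation of the `i`-th coordinate as a measurable equivalence. -/
noncomputable def splitEquiv (i : Fin (m + 1)) : ℝ × (Fin m → ℝ) ≃ᵐ Euc m :=
  (MeasurableEquiv.piFinSuccAbove (fun _ => ℝ) i).symm.trans (MeasurableEquiv.toLp 2 _)

theorem splitEquiv_apply (i : Fin (m + 1)) (q : ℝ × (Fin m → ℝ)) :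
    splitEquiv i q = ins i q.1 q.2 := rfl

theorem measurePreserving_splitEquiv (i : Fin (m + 1)) :
    MeasurePreserving (splitEquiv (m := m) i) :=
  (volume_preserving_piFinSuccAbove (fun _ => ℝ) i).symm.trans (PiLp.volume_preserving_toLp _)

/-- Separation of the `i`-th coordinate in `Euc m × ℝ`. -/
noncomputable def fiberEquiv (i : Fin (m + 1)) : ℝ × ((Fin m → ℝ) × ℝ) ≃ᵐ Euc m × ℝ :=
  MeasurableEquiv.prodAssoc.symm.trans ((splitEquiv i).prodCongr (MeasurableEquiv.refl ℝ))

theorem measurePreserving_fiberEquiv (i : Fin (m + 1)) :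
    MeasurePreserving (fiberEquiv (m := m) i) :=
  (MeasurePreserving.symm _ (measurePreserving_prodAssoc volume volume volume)).trans
    ((measurePreserving_splitEquiv i).prod (MeasurePreserving.id volume))

theorem integral_eq_integral_fiber (i : Fin (m + 1)) {F : Euc m × ℝ → ℝ} (hF : Integrable F) :
    ∫ w, F w = ∫ r : (Fin m → ℝ) × ℝ, ∫ s, F (ins i s r.1, r.2) := by
  have h := (measurePreserving_fiberEquiv (m := m) i)
  rw [← h.integral_comp' F]
  exact integral_prod_symm _ ((h.integrable_comp_emb (fiberEquiv i).measurableEmbedding).2 hF)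

theorem integral_le_of_fiber (i : Fin (m + 1)) {F G : Euc m × ℝ → ℝ} (hF : Integrable F)
    (hG : Integrable G)
    (h : ∀ u τ, ∫ s, F (ins i s u, τ) ≤ ∫ s, G (ins i s u, τ)) : ∫ w, F w ≤ ∫ w, G w := by
  have hm := (measurePreserving_fiberEquiv (m := m) i)
  have hi : ∀ {H : Euc m × ℝ → ℝ}, Integrable H →
      Integrable fun r : (Fin m → ℝ) × ℝ => ∫ s, H (ins i s r.1, r.2) := fun hH =>
    ((hm.integrable_comp_emb (fiberEquiv i).measurableEmbedding).2 hH).integral_prod_right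
  rw [integral_eq_integral_fiber i hF, integral_eq_integral_fiber i hG]
  exact integral_mono (hi hF) (hi hG) fun r => h r.1 r.2

/-- Measurable subsets of a fixed bounded cylinder lying above the hyperplane `τ = 0`. -/
structure IsBody (R M : ℝ) (W : Set (Euc m × ℝ)) : Prop where
  meas : MeasurableSet W
  norm_le : ∀ w ∈ W, ‖w.1‖ ≤ R
  pos : ∀ w ∈ W, 0 < w.2
  le : ∀ w ∈ W, w.2 ≤ M

/-- The fiber of a set in the direction of the `i`-th coordinate. -/
def fib (i : Fin (m + 1)) (W : Set (Euc m × ℝ)) (r : (Fin m → ℝ) × ℝ) : Set ℝ :=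
  {s | (ins i s r.1, r.2) ∈ W}

/-- Steiner symmetrization in the direction of the `i`-th coordinate. -/
def steiner (i : Fin (m + 1)) (W : Set (Euc m × ℝ)) : Set (Euc m × ℝ) :=
  {w | 2 * |w.1 i| < volume.real (fib i W (rest i w.1, w.2))}

theorem setIntegral_le_of_fiber (i : Fin (m + 1)) {W W' : Set (Euc m × ℝ)} {F G : Euc m × ℝ → ℝ}
    (hW : MeasurableSet W) (hW' : MeasurableSet W') (hF : IntegrableOn F W)
    (hG : IntegrableOn G W')
    (h : ∀ r, ∫ s in fib i W r, F (ins i s r.1, r.2) ≤ ∫ s in fib i W' r, G (ins i s r.1, r.2)) :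
    ∫ w in W, F w ≤ ∫ w in W', G w := by
  have key : ∀ {V : Set (Euc m × ℝ)} {H : Euc m × ℝ → ℝ}, MeasurableSet V → ∀ u τ,
      ∫ s, V.indicator H (ins i s u, τ) = ∫ s in fib i V (u, τ), H (ins i s u, τ) := by
    intro V H hV u τ
    have hm : MeasurableSet (fib i V (u, τ)) := by
      have : Measurable fun s : ℝ => (ins i s u, τ) :=
        ((continuous_ins i).measurable.comp (measurable_id.prodMk measurable_const)).prodMk
          measurable_const
      exact this hV
    rw [← integral_indicator hm]
    rfl
  rw [← integral_indicator hW, ← integral_indicator hW']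
  refine integral_le_of_fiber i ((integrable_indicator_iff hW).2 hF)
    ((integrable_indicator_iff hW').2 hG) fun u τ => ?_
  rw [key hW, key hW']
  exact h (u, τ)

namespace IsBody

theorem subset (hW : IsBody R M W) : W ⊆ Metric.closedBall 0 R ×ˢ Icc 0 M := fun w hw =>
  ⟨by simpa using hW.norm_le w hw, (hW.pos w hw).le, hW.le w hw⟩

theorem integrableOn (hW : IsBody R M W) {F : Euc m × ℝ → ℝ} (hF : Continuous F) :
    IntegrableOn F W :=
  (hF.continuousOn.integrableOn_compact
    ((isCompact_closedBall (0 : Euc m) R).prod isCompact_Icc)).mono_set hW.subset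

theorem measure_lt_top (hW : IsBody R M W) : volume W < ∞ :=
  (measure_mono hW.subset).trans_lt
    ((isCompact_closedBall (0 : Euc m) R).prod isCompact_Icc).measure_lt_top

theorem measurableSet_fib (hW : IsBody R M W) (i : Fin (m + 1)) (r : (Fin m → ℝ) × ℝ) :
    MeasurableSet (fib i W r) := by
  have : Measurable fun s : ℝ => (ins i s r.1, r.2) :=
    ((continuous_ins i).measurable.comp (measurable_id.prodMk measurable_const)).prodMk
      measurable_const
  exact this hW.meas

theorem sq_le_of_mem_fib (hW : IsBody R M W) {i : Fin (m + 1)} {r : (Fin m → ℝ) × ℝ} {s : ℝ}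
    (hs : s ∈ fib i W r) : s ^ 2 + r.1 ⬝ᵥ r.1 ≤ R ^ 2 := by
  rw [← norm_ins_sq i]
  exact pow_le_pow_left₀ (norm_nonneg _) (hW.norm_le _ hs) 2

theorem fib_subset (hW : IsBody R M W) (i : Fin (m + 1)) (r : (Fin m → ℝ) × ℝ) :
    fib i W r ⊆ Icc (-√(R ^ 2 - r.1 ⬝ᵥ r.1)) √(R ^ 2 - r.1 ⬝ᵥ r.1) := fun s hs => by
  have := hW.sq_le_of_mem_fib hs
  exact abs_le.1 (Real.abs_le_sqrt (by linarith))

theorem measurable_volume_fib (hW : IsBody R M W) (i : Fin (m + 1)) :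
    Measurable fun r => volume.real (fib i W r) := by
  have : MeasurableSet {q : ((Fin m → ℝ) × ℝ) × ℝ | (ins i q.2 q.1.1, q.1.2) ∈ W} := by
    have : Measurable fun q : ((Fin m → ℝ) × ℝ) × ℝ => (ins i q.2 q.1.1, q.1.2) := by
      refine Measurable.prodMk ?_ (by fun_prop)
      exact (continuous_ins i).measurable.comp
        (measurable_snd.prodMk (measurable_fst.comp measurable_fst))
    exact this hW.meas
  exact (measurable_measure_prodMk_left this).ennreal_toReal

end IsBody

theorem fib_steiner (i : Fin (m + 1)) (W : Set (Euc m × ℝ)) (r : (Fin m → ℝ) × ℝ) :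
    fib i (steiner i W) r =
      Ioo (-(volume.real (fib i W r) / 2)) (volume.real (fib i W r) / 2) := by
  ext s
  simp only [fib, steiner, mem_ofPred_eq, rest_ins, ins_self, mem_Ioo]
  rw [← abs_lt]
  constructor <;> intro h <;> linarith

theorem volume_fib_steiner (i : Fin (m + 1)) (W : Set (Euc m × ℝ)) (r : (Fin m → ℝ) × ℝ) :
    volume.real (fib i (steiner i W) r) = volume.real (fib i W r) := by
  rw [fib_steiner, Real.volume_real_Ioo_of_le]
  · ring
  · have : 0 ≤ volume.real (fib i W r) := measureReal_nonneg
    linarith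

namespace IsBody

theorem steiner (hW : IsBody R M W) (i : Fin (m + 1)) : IsBody R M (steiner i W) := by
  have hne : ∀ w ∈ AsymmetricBS.steiner i W, (fib i W (rest i w.1, w.2)).Nonempty := by
    intro w hw
    by_contra h
    rw [not_nonempty_iff_eq_empty] at h
    simp only [AsymmetricBS.steiner, mem_ofPred_eq, h, measureReal_empty] at hw
    linarith [abs_nonneg (w.1 i)]
  refine ⟨?_, fun w hw => ?_, fun w hw => ?_, fun w hw => ?_⟩
  · refine measurableSet_lt (by fun_prop) ((hW.measurable_volume_fib i).comp ?_)
    exact ((continuous_rest i).measurable.comp measurable_fst).prodMk measurable_snd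
  · obtain ⟨s, hs⟩ := hne w hw
    have hR : 0 ≤ R := (norm_nonneg _).trans (hW.norm_le _ hs)
    have h1 := hW.sq_le_of_mem_fib hs
    have h2 : volume.real (fib i W (rest i w.1, w.2)) ≤ 2 * √(R ^ 2 - rest i w.1 ⬝ᵥ rest i w.1) := by
      refine (measureReal_mono (hW.fib_subset i _)
        (isCompact_Icc.measure_lt_top).ne).trans_eq ?_
      rw [Real.volume_real_Icc_of_le (by linarith [Real.sqrt_nonneg (R ^ 2 - rest i w.1 ⬝ᵥ rest i w.1)])]
      ring
    have h3 : |w.1 i| ≤ √(R ^ 2 - rest i w.1 ⬝ᵥ rest i w.1) := by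
      have : 2 * |w.1 i| < volume.real (fib i W (rest i w.1, w.2)) := hw
      linarith
    have h4 : (w.1 i) ^ 2 ≤ R ^ 2 - rest i w.1 ⬝ᵥ rest i w.1 := by
      rw [← sq_abs]
      refine (pow_le_pow_left₀ (abs_nonneg _) h3 2).trans_eq (Real.sq_sqrt ?_)
      simp only at h1
      nlinarith [sq_nonneg s]
    refine (pow_le_pow_iff_left₀ (norm_nonneg _) hR two_ne_zero).1 ?_
    rw [← ins_rest i w.1, norm_ins_sq]
    linarith
  · obtain ⟨s, hs⟩ := hne w hw
    exact hW.pos (ins i s (rest i w.1), w.2) hs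
  · obtain ⟨s, hs⟩ := hne w hw
    exact hW.le (ins i s (rest i w.1), w.2) hs

/-- Steiner symmetrization does not change integrals of functions that are constant in the
direction of symmetrization. -/
theorem integral_steiner (hW : IsBody R M W) (i : Fin (m + 1)) {F : Euc m × ℝ → ℝ}
    (hF : Continuous F) (h : ∀ s u τ, F (ins i s u, τ) = F (ins i 0 u, τ)) :
    ∫ w in AsymmetricBS.steiner i W, F w = ∫ w in W, F w := by
  have key : ∀ r, ∫ s in fib i (AsymmetricBS.steiner i W) r, F (ins i s r.1, r.2) =
      ∫ s in fib i W r, F (ins i s r.1, r.2) := by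
    intro r
    simp only [h _ r.1 r.2, setIntegral_const, volume_fib_steiner]
  exact le_antisymm
    (setIntegral_le_of_fiber i (hW.steiner i).meas hW.meas ((hW.steiner i).integrableOn hF)
      (hW.integrableOn hF) fun r => (key r).le)
    (setIntegral_le_of_fiber i hW.meas (hW.steiner i).meas (hW.integrableOn hF)
      ((hW.steiner i).integrableOn hF) fun r => (key r).ge)

end IsBody

/-- The positive part, raised to the power `p`. -/
noncomputable def ppow (p s : ℝ) : ℝ := (max s 0) ^ p

theorem ppow_nonneg (p s : ℝ) : 0 ≤ ppow p s := Real.rpow_nonneg (le_max_right _ _) _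

theorem monotone_ppow (hp : 0 ≤ p) : Monotone (ppow p) := fun _ _ h =>
  Real.rpow_le_rpow (le_max_right _ _) (max_le_max_right _ h) hp

theorem continuous_ppow (hp : 0 ≤ p) : Continuous (ppow p) :=
  (continuous_id.max continuous_const).rpow_const fun _ => Or.inr hp

theorem convexOn_ppow (hp : 1 ≤ p) : ConvexOn ℝ univ (ppow p) := by
  have h1 : ConvexOn ℝ univ fun s : ℝ => max s 0 :=
    (convexOn_id convex_univ).sup (convexOn_const 0 convex_univ)
  refine ⟨convex_univ, fun x _ y _ a b ha hb hab => ?_⟩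
  refine le_trans (Real.rpow_le_rpow (le_max_right _ _) (h1.2 trivial trivial ha hb hab)
    (by linarith)) ?_
  exact (convexOn_rpow hp).2 (le_max_right x 0) (le_max_right y 0) ha hb hab

theorem ppow_mul (p : ℝ) {t : ℝ} (ht : 0 ≤ t) (s : ℝ) : ppow p (t * s) = t ^ p * ppow p s := by
  have : max (t * s) 0 = t * max s 0 := by rw [mul_max_of_nonneg _ _ ht, mul_zero]
  rw [ppow, this, Real.mul_rpow ht (le_max_right _ _)]; rfl

theorem ppow_pos {s : ℝ} (hs : 0 < s) (p : ℝ) : 0 < ppow p s :=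
  Real.rpow_pos_of_pos (lt_max_of_lt_left hs) _

theorem ppow_of_nonpos (hp : 0 < p) {s : ℝ} (hs : s ≤ 0) : ppow p s = 0 := by
  rw [ppow, max_eq_right hs, Real.zero_rpow hp.ne']

theorem ppow_of_nonneg {s : ℝ} (hs : 0 ≤ s) (p : ℝ) : ppow p s = s ^ p := by
  rw [ppow, max_eq_left hs]

/-- A pointwise form of Minkowski's inequality at the midpoint. -/
theorem ppow_midpoint_le (hp : 1 ≤ p) {α β : ℝ} (hα : 0 < α) (hβ : 0 < β) (x y : ℝ) :
    ppow p ((x + y) / 2) ≤ ((α + β) / 2) ^ p / (α + β) * (α * (α ^ p)⁻¹ * ppow p x +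
      β * (β ^ p)⁻¹ * ppow p y) := by
  have h := (convexOn_ppow hp).2 (mem_univ (x / α)) (mem_univ (y / β))
    (show 0 ≤ α / (α + β) by positivity) (show 0 ≤ β / (α + β) by positivity) (by field_simp)
  simp only [smul_eq_mul] at h
  have e1 : α / (α + β) * (x / α) + β / (α + β) * (y / β) = (x + y) / (α + β) := by field_simp
  rw [e1, div_eq_inv_mul x, div_eq_inv_mul y, ppow_mul p (by positivity),
    ppow_mul p (by positivity), Real.inv_rpow hα.le, Real.inv_rpow hβ.le] at h
  have e2 : (x + y) / 2 = (α + β) / 2 * ((x + y) / (α + β)) := by field_simp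
  rw [e2, ppow_mul p (by positivity)]
  refine (mul_le_mul_of_nonneg_left h (by positivity)).trans_eq ?_
  field_simp

theorem setIntegral_le_of_level {ψ : ℝ → ℝ} {I S : Set ℝ} {κ : ℝ} (hI : MeasurableSet I)
    (hS : MeasurableSet S) (hψI : IntegrableOn ψ I) (hψS : IntegrableOn ψ S)
    (hIt : volume I < ∞) (hSt : volume S < ∞)
    (hvol : volume.real I = volume.real S) (hin : ∀ s ∈ I, ψ s ≤ κ) (hout : ∀ s ∉ I, κ ≤ ψ s) :
    ∫ s in I, ψ s ≤ ∫ s in S, ψ s := by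
  have hI' : IntegrableOn (fun s => ψ s - κ) I := hψI.sub (integrableOn_const hIt.ne)
  have hS' : IntegrableOn (fun s => ψ s - κ) S := hψS.sub (integrableOn_const hSt.ne)
  have h : ∫ s in I, (ψ s - κ) ≤ ∫ s in S, (ψ s - κ) := by
    rw [← integral_indicator hI, ← integral_indicator hS]
    refine integral_mono ((integrable_indicator_iff hI).2 hI')
      ((integrable_indicator_iff hS).2 hS') fun s => ?_
    simp only [indicator]
    split_ifs with h1 h2 h2
    · rfl
    · linarith [hin s h1]
    · linarith [hout s h1]
    · rfl
  rw [integral_sub hψI (integrableOn_const hIt.ne), integral_sub hψS (integrableOn_const hSt.ne),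
    setIntegral_const, setIntegral_const, hvol] at h
  linarith

/-- If a convex function takes the same value at the endpoints of an interval, it has a smaller
integral over this interval than over any other bounded set of the same measure. -/
theorem setIntegral_Ioo_le_of_convexOn {ψ : ℝ → ℝ} (hψ : ConvexOn ℝ univ ψ) (hc : Continuous ψ)
    {S : Set ℝ} (hS : MeasurableSet S) {K : ℝ} (hSK : S ⊆ Icc (-K) K) {c : ℝ}
    (h : ψ (c - volume.real S / 2) = ψ (c + volume.real S / 2)) :
    ∫ s in Ioo (c - volume.real S / 2) (c + volume.real S / 2), ψ s ≤ ∫ s in S, ψ s := by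
  set r := volume.real S / 2 with hr
  have hr0 : 0 ≤ r := by have := measureReal_nonneg (μ := volume) (s := S); positivity
  have hSt : volume S < ∞ := (measure_mono hSK).trans_lt isCompact_Icc.measure_lt_top
  have hψS : IntegrableOn ψ S :=
    (hc.continuousOn.integrableOn_compact isCompact_Icc).mono_set hSK
  rcases hr0.eq_or_lt with h0 | h0
  · have hv : volume S = 0 := by
      have : volume.real S = 0 := by linarith
      exact (measureReal_eq_zero_iff hSt.ne).1 this
    rw [← h0, setIntegral_measure_zero _ hv]
    simp
  refine setIntegral_le_of_level (κ := ψ (c + r)) measurableSet_Ioo hS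
    ((hc.continuousOn.integrableOn_compact isCompact_Icc).mono_set Ioo_subset_Icc_self) hψS
    measure_Ioo_lt_top hSt ?_ (fun s hs => ?_) (fun s hs => ?_)
  · rw [Real.volume_real_Ioo_of_le (by linarith)]; linarith
  · have := hψ.le_max_of_mem_Icc (mem_univ (c - r)) (mem_univ (c + r)) ⟨hs.1.le, hs.2.le⟩
    simpa [h] using this
  · rw [mem_Ioo, not_and_or, not_lt, not_lt] at hs
    rcases hs with hs | hs
    · rcases hs.eq_or_lt with rfl | hs
      · exact h.ge
      by_contra! hlt
      have := hψ.lt_right_of_left_lt (mem_univ s) (mem_univ (c + r))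
        (show c - r ∈ openSegment ℝ s (c + r) by
          rw [openSegment_eq_Ioo (by linarith)]; exact ⟨hs, by linarith⟩) (by rw [h]; exact hlt)
      linarith
    · rcases hs.eq_or_lt with rfl | hs
      · exact le_rfl
      by_contra! hlt
      have := hψ.lt_left_of_right_lt (mem_univ (c - r)) (mem_univ s)
        (show c + r ∈ openSegment ℝ (c - r) s by
          rw [openSegment_eq_Ioo (by linarith)]; exact ⟨by linarith, hs⟩) hlt
      linarith

/-- The one-dimensional inequality behind the behaviour of asymmetric moments under Steiner
symmetrization. -/
theorem setIntegral_ppow_midpoint_le (hp : 1 ≤ p) {S : Set ℝ} (hS : MeasurableSet S) {K : ℝ}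
    (hSK : S ⊆ Icc (-K) K) {α β : ℝ} (hα : 0 < α) (hβ : 0 < β) (x y : ℝ) :
    ∫ s in Ioo (-(volume.real S / 2)) (volume.real S / 2), ppow p ((x + y) / 2 + s) ≤
      ∫ s in S, ((α + β) / 2) ^ p / (α + β) * (α * (α ^ p)⁻¹ * ppow p (x + s) +
        β * (β ^ p)⁻¹ * ppow p (y - s)) := by
  set a := ((α + β) / 2) ^ p / (α + β) * (α * (α ^ p)⁻¹) with ha
  set b := ((α + β) / 2) ^ p / (α + β) * (β * (β ^ p)⁻¹) with hb
  have ha0 : 0 ≤ a := by positivity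
  have hb0 : 0 ≤ b := by positivity
  have hp0 : 0 ≤ p := by linarith
  set ψ : ℝ → ℝ := fun s => a * ppow p (x + s) + b * ppow p (y - s) with hψ
  have hpt : ∀ u v, ppow p ((u + v) / 2) ≤ a * ppow p u + b * ppow p v := fun u v => by
    refine (ppow_midpoint_le hp hα hβ u v).trans_eq ?_
    simp only [ha, hb]; ring
  have hcp := continuous_ppow hp0
  have hc : Continuous ψ := by fun_prop
  have hconv : ConvexOn ℝ univ ψ := by
    refine ConvexOn.add (ConvexOn.smul ha0 ?_) (ConvexOn.smul hb0 ?_)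
    · refine ⟨convex_univ, fun s _ t _ c d hc hd hcd => ?_⟩
      have := (convexOn_ppow hp).2 (mem_univ (x + s)) (mem_univ (x + t)) hc hd hcd
      simp only [smul_eq_mul] at this ⊢
      convert this using 2
      linear_combination -x * hcd
    · refine ⟨convex_univ, fun s _ t _ c d hc hd hcd => ?_⟩
      have := (convexOn_ppow hp).2 (mem_univ (y - s)) (mem_univ (y - t)) hc hd hcd
      simp only [smul_eq_mul] at this ⊢
      convert this using 2
      linear_combination -y * hcd
  set r := volume.real S / 2 with hr
  have hr0 : 0 ≤ r := by have := measureReal_nonneg (μ := volume) (s := S); positivity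
  obtain ⟨c, hcr⟩ : ∃ c, ψ (c - r) = ψ (c + r) := by
    have hlo : ∃ c, ψ (c + r) ≤ ψ (c - r) := by
      refine ⟨min (-x) y - r, ?_⟩
      have h1 : ppow p (x + (min (-x) y - r + r)) = 0 :=
        ppow_of_nonpos (by linarith) (by linarith [min_le_left (-x) y])
      have h2 : ppow p (y - (min (-x) y - r + r)) ≤ ppow p (y - (min (-x) y - r - r)) :=
        monotone_ppow hp0 (by linarith)
      simp only [hψ, h1]
      nlinarith [mul_nonneg ha0 (ppow_nonneg p (x + (min (-x) y - r - r))),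
        mul_le_mul_of_nonneg_left h2 hb0]
    have hhi : ∃ c, ψ (c - r) ≤ ψ (c + r) := by
      refine ⟨max (-x) y + r, ?_⟩
      have h1 : ppow p (y - (max (-x) y + r - r)) = 0 :=
        ppow_of_nonpos (by linarith) (by linarith [le_max_right (-x) y])
      have h2 : ppow p (x + (max (-x) y + r - r)) ≤ ppow p (x + (max (-x) y + r + r)) :=
        monotone_ppow hp0 (by linarith)
      simp only [hψ, h1]
      nlinarith [mul_nonneg hb0 (ppow_nonneg p (y - (max (-x) y + r + r))),
        mul_le_mul_of_nonneg_left h2 ha0]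
    obtain ⟨c₁, h₁⟩ := hlo
    obtain ⟨c₂, h₂⟩ := hhi
    obtain ⟨c, -, h⟩ := isPreconnected_univ.intermediate_value₂ (mem_univ c₂) (mem_univ c₁)
      (f := fun c => ψ (c - r)) (g := fun c => ψ (c + r)) (by fun_prop) (by fun_prop) h₂ h₁
    exact ⟨c, h⟩
  have hii : ∀ {φ : ℝ → ℝ} {u v : ℝ}, Continuous φ → IntervalIntegrable φ volume u v :=
    fun h => h.intervalIntegrable _ _
  calc ∫ s in Ioo (-r) r, ppow p ((x + y) / 2 + s)
      ≤ ∫ s in Ioo (-r) r, (a * ppow p (x + c + s) + b * ppow p (y - c + s)) := by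
        refine setIntegral_mono_on ?_ ?_ measurableSet_Ioo fun s _ => ?_
        · exact ((by fun_prop : Continuous fun s => ppow p ((x + y) / 2 + s)).continuousOn
            |>.integrableOn_compact isCompact_Icc).mono_set Ioo_subset_Icc_self
        · exact ((by fun_prop : Continuous fun s => a * ppow p (x + c + s) +
            b * ppow p (y - c + s)).continuousOn
            |>.integrableOn_compact isCompact_Icc).mono_set Ioo_subset_Icc_self
        · have := hpt (x + c + s) (y - c + s)
          rwa [show (x + c + s + (y - c + s)) / 2 = (x + y) / 2 + s by ring] at this
    _ = ∫ s in Ioo (c - r) (c + r), ψ s := by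
        rw [← integral_Ioc_eq_integral_Ioo, ← integral_Ioc_eq_integral_Ioo,
          ← intervalIntegral.integral_of_le (by linarith),
          ← intervalIntegral.integral_of_le (by linarith),
          intervalIntegral.integral_add (hii (by fun_prop)) (hii (by fun_prop)),
          intervalIntegral.integral_add (hii (by fun_prop)) (hii (by fun_prop))]
        congr 1
        · have := intervalIntegral.integral_comp_add_left (a := -r) (b := r)
            (fun s => a * ppow p (x + s)) c
          rw [← sub_eq_add_neg] at this
          rw [← this]
          congr 1; ext s; congr 2; ring
        · have := intervalIntegral.integral_comp_sub_left (a := -r) (b := r)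
            (fun s => b * ppow p (y - s)) c
          rw [sub_neg_eq_add] at this
          rw [← this]
          congr 1; ext s; congr 2; ring
    _ ≤ ∫ s in S, ψ s := setIntegral_Ioo_le_of_convexOn hconv hc hS hSK hcr
    _ = _ := by
        congr 1; ext s; simp only [hψ, ha, hb]; ring

/-- The asymmetric `p`-th moment of `W` in the direction `y`, with respect to the point `-c`. -/
noncomputable def mom (p : ℝ) (W : Set (Euc m × ℝ)) (c y : Euc m) : ℝ :=
  ∫ w in W, ppow p ⟪w.1 + c, y⟫

theorem mom_nonneg (p : ℝ) (W : Set (Euc m × ℝ)) (c y : Euc m) : 0 ≤ mom p W c y :=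
  integral_nonneg fun _ => ppow_nonneg _ _

theorem mom_smul (p : ℝ) (W : Set (Euc m × ℝ)) (c y : Euc m) {t : ℝ} (ht : 0 ≤ t) :
    mom p W c (t • y) = t ^ p * mom p W c y := by
  simp only [mom, real_inner_smul_right, ppow_mul p ht, integral_const_mul]

theorem continuous_ppow_inner (hp : 0 ≤ p) (c y : Euc m) :
    Continuous fun w : Euc m × ℝ => ppow p ⟪w.1 + c, y⟫ :=
  (continuous_ppow hp).comp (by fun_prop)

namespace IsBody

theorem continuous_mom (hW : IsBody R M W) (hp : 0 ≤ p) :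
    Continuous fun q : Euc m × Euc m => mom p W q.1 q.2 := by
  refine continuous_iff_continuousAt.2 fun q₀ => ?_
  have : IsFiniteMeasure (volume.restrict W) := ⟨by simpa using hW.measure_lt_top⟩
  refine continuousAt_of_dominated (bound := fun _ => (max ((R + ‖q₀‖ + 1) * (‖q₀‖ + 1)) 0) ^ p)
    (Eventually.of_forall fun q => (continuous_ppow_inner hp q.1 q.2).aestronglyMeasurable)
    ?_ (integrable_const _) (Eventually.of_forall fun w => ?_)
  · have hb : ∀ᶠ q in 𝓝 q₀, ‖q‖ < ‖q₀‖ + 1 :=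
      (continuous_norm.tendsto q₀).eventually (gt_mem_nhds (lt_add_one _))
    filter_upwards [hb] with q hq
    filter_upwards [ae_restrict_mem hW.meas] with w hw
    rw [Real.norm_of_nonneg (ppow_nonneg _ _)]
    refine Real.rpow_le_rpow (le_max_right _ _) (max_le_max_right _ ?_) hp
    refine (real_inner_le_norm _ _).trans ?_
    have h1 := hW.norm_le w hw
    have h2 := norm_add_le w.1 q.1
    have h3 := norm_fst_le q
    have h4 := norm_snd_le q
    have := norm_nonneg w.1
    have := norm_nonneg q₀
    exact mul_le_mul (by linarith) (by linarith) (norm_nonneg _) (by linarith)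
  · exact ((continuous_ppow hp).comp (by fun_prop :
      Continuous fun q : Euc m × Euc m => ⟪w.1 + q.1, q.2⟫)).continuousAt

/-- Midpoint convexity of moments under Steiner symmetrization. -/
theorem mom_steiner_le (hW : IsBody R M W) (hp : 1 ≤ p) (i : Fin (m + 1)) {a : ℝ}
    {c u v : Fin m → ℝ} {α β : ℝ} (hα : 0 < α) (hβ : 0 < β)
    (h₁ : mom p W (ins i a c) (ins i 1 u) ≤ α ^ p)
    (h₂ : mom p W (ins i a c) (ins i (-1) v) ≤ β ^ p) :
    mom p (AsymmetricBS.steiner i W) (ins i 0 c) (ins i 1 ((2 : ℝ)⁻¹ • (u + v))) ≤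
      ((α + β) / 2) ^ p := by
  have hp0 : 0 ≤ p := by linarith
  set C := ((α + β) / 2) ^ p / (α + β) with hC
  set F : Euc m × ℝ → ℝ := fun w => C * (α * (α ^ p)⁻¹ * ppow p ⟪w.1 + ins i a c, ins i 1 u⟫ +
    β * (β ^ p)⁻¹ * ppow p ⟪w.1 + ins i a c, ins i (-1) v⟫) with hF
  have hc₁ := continuous_ppow_inner hp0 (ins i a c) (ins i 1 u)
  have hc₂ := continuous_ppow_inner hp0 (ins i a c) (ins i (-1) v)
  have hFc : Continuous F := by fun_prop
  calc _ ≤ ∫ w in W, F w := by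
        refine setIntegral_le_of_fiber i (hW.steiner i).meas hW.meas
          ((hW.steiner i).integrableOn (continuous_ppow_inner hp0 _ _)) (hW.integrableOn hFc)
          fun r => ?_
        rw [fib_steiner]
        have := setIntegral_ppow_midpoint_le hp (hW.measurableSet_fib i r) (hW.fib_subset i r) hα hβ
          (a + (r.1 + c) ⬝ᵥ u) (-a + (r.1 + c) ⬝ᵥ v)
        simp only [hF, ins_add_ins, inner_ins]
        refine (le_of_eq ?_).trans (this.trans_eq ?_)
        · congr 1; ext s; congr 1
          simp only [dotProduct_smul, dotProduct_add, smul_eq_mul]; ring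
        · congr 1; ext s
          rw [show (s + a) * 1 + (r.1 + c) ⬝ᵥ u = a + (r.1 + c) ⬝ᵥ u + s by ring,
            show (s + a) * -1 + (r.1 + c) ⬝ᵥ v = -a + (r.1 + c) ⬝ᵥ v - s by ring]
    _ = C * (α * (α ^ p)⁻¹ * mom p W (ins i a c) (ins i 1 u) +
          β * (β ^ p)⁻¹ * mom p W (ins i a c) (ins i (-1) v)) := by
        simp only [hF, integral_const_mul, mom]
        rw [integral_add ((hW.integrableOn hc₁).const_mul _) ((hW.integrableOn hc₂).const_mul _)]
        simp only [integral_const_mul]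
    _ ≤ C * (α * (α ^ p)⁻¹ * α ^ p + β * (β ^ p)⁻¹ * β ^ p) := by gcongr
    _ = _ := by
        have := Real.rpow_pos_of_pos hα p
        have := Real.rpow_pos_of_pos hβ p
        simp only [hC]; field_simp

end IsBody

/-- Nonnegative continuous functions that are positively homogeneous of degree `p`. -/
structure IsGauge (p : ℝ) (A : Euc m → ℝ) : Prop where
  cont : Continuous A
  nonneg : ∀ y, 0 ≤ A y
  smul : ∀ y, ∀ t : ℝ, 0 ≤ t → A (t • y) = t ^ p * A y

/-- The integral of `A ^ (-n / p)` over the hyperplane `y i = σ`. -/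
noncomputable def gno (p : ℝ) (i : Fin (m + 1)) (σ : ℝ) (A : Euc m → ℝ) : ℝ≥0∞ :=
  ∫⁻ u, ENNReal.ofReal (A (ins i σ u)) ^ (-(((m + 1 : ℕ) : ℝ) / p))

theorem norm_le_norm_ins (i : Fin (m + 1)) (s : ℝ) (u : Fin m → ℝ) : ‖u‖ ≤ ‖ins i s u‖ := by
  refine (pi_norm_le_iff_of_nonneg (norm_nonneg _)).2 fun k => ?_
  simpa using PiLp.norm_apply_le (ins i s u) (i.succAbove k)

theorem abs_le_norm_ins (i : Fin (m + 1)) (s : ℝ) (u : Fin m → ℝ) : |s| ≤ ‖ins i s u‖ := by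
  simpa using PiLp.norm_apply_le (ins i s u) i

theorem continuous_ins_right (i : Fin (m + 1)) (σ : ℝ) :
    Continuous fun u : Fin m → ℝ => ins i σ u :=
  (continuous_ins i).comp (continuous_const.prodMk continuous_id)

theorem ins_ne_zero (i : Fin (m + 1)) {σ : ℝ} (hσ : |σ| = 1) (u : Fin m → ℝ) :
    ins i σ u ≠ 0 := by
  have := abs_le_norm_ins i σ u
  rw [← norm_pos_iff]; linarith

namespace IsGauge
variable {A : Euc m → ℝ}

theorem linearGrowth (hA : IsGauge p A) (hp : 0 < p) (i : Fin (m + 1)) {σ : ℝ} (hσ : |σ| = 1)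
    (hpos : ∀ y, y ≠ 0 → 0 ≤ σ * y i → 0 < A y) :
    LinearGrowth fun u => A (ins i σ u) ^ p⁻¹ := by
  have hσ2 : σ * σ = 1 := by rw [← abs_mul_abs_self, hσ, one_mul]
  refine ⟨(hA.cont.comp (continuous_ins_right i σ)).rpow_const fun _ =>
    Or.inr (by positivity), ?_⟩
  set K : Set (Euc m) := Metric.sphere 0 1 ∩ {y | 0 ≤ σ * y i} with hK
  have hKc : IsCompact K := (isCompact_sphere _ _).inter_right
    (isClosed_le continuous_const (by fun_prop))
  have hmem : ∀ u, (‖ins i σ u‖⁻¹ : ℝ) • ins i σ u ∈ K := fun u => by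
    have h0 := norm_pos_iff.2 (ins_ne_zero i hσ u)
    refine ⟨by simp [norm_smul, h0.ne'], ?_⟩
    simp only [mem_ofPred_eq, PiLp.smul_apply, ins_self, smul_eq_mul]
    rw [mul_left_comm, hσ2]; positivity
  obtain ⟨z, hz, hmin⟩ := hKc.exists_isMinOn ⟨_, hmem 0⟩
    ((hA.cont.rpow_const fun _ => Or.inr (by positivity : (0:ℝ) ≤ p⁻¹)).continuousOn)
  have hz0 : 0 < A z := hpos z (by rintro rfl; simp [hK] at hz) hz.2
  refine ⟨A z ^ p⁻¹ / 2, by positivity, fun u => ?_⟩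
  have h0 := norm_pos_iff.2 (ins_ne_zero i hσ u)
  have h1 : A z ^ p⁻¹ ≤ A ((‖ins i σ u‖⁻¹ : ℝ) • ins i σ u) ^ p⁻¹ := hmin (hmem u)
  rw [hA.smul _ _ (by positivity), Real.mul_rpow (by positivity) (hA.nonneg _),
    Real.rpow_rpow_inv (by positivity) hp.ne', inv_mul_eq_div, le_div_iff₀ h0] at h1
  refine le_trans ?_ h1
  have h2 := norm_le_norm_ins i σ u
  have h3 := abs_le_norm_ins i σ u
  have := Real.rpow_pos_of_pos hz0 p⁻¹
  nlinarith

theorem gno_eq (hA : IsGauge p A) (hp : 0 < p) (i : Fin (m + 1)) {σ : ℝ} (hσ : |σ| = 1)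
    (hpos : ∀ y, y ≠ 0 → 0 ≤ σ * y i → 0 < A y) :
    gno p i σ A = ENNReal.ofReal (∫ u, ((A (ins i σ u) ^ p⁻¹) ^ (m + 1))⁻¹) := by
  have hG := hA.linearGrowth hp i hσ hpos
  rw [ofReal_integral_eq_lintegral_ofReal (hG.integrable (lt_add_one m))
    (Eventually.of_forall fun u => by have := hG.pos u; positivity)]
  refine lintegral_congr fun u => ?_
  have hσ2 : σ * σ = 1 := by rw [← abs_mul_abs_self, hσ, one_mul]
  have h : 0 < A (ins i σ u) := hpos _ (ins_ne_zero i hσ u) (by simp [hσ2])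
  rw [ENNReal.ofReal_rpow_of_pos h, Real.rpow_neg h.le, ← Real.rpow_natCast, ← Real.rpow_mul h.le,
    div_eq_inv_mul]

theorem gno_lt_top (hA : IsGauge p A) (hp : 0 < p) (i : Fin (m + 1)) {σ : ℝ} (hσ : |σ| = 1)
    (hpos : ∀ y, y ≠ 0 → 0 ≤ σ * y i → 0 < A y) : gno p i σ A < ∞ := by
  rw [hA.gno_eq hp i hσ hpos]; exact ENNReal.ofReal_lt_top

end IsGauge

theorem lintegral_exp_neg_mul_rpow (hp : 0 < p) {a : ℝ} (ha : 0 < a) (m : ℕ) :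
    ∫⁻ t in Ioi (0 : ℝ), ENNReal.ofReal (t ^ m) * ENNReal.ofReal (Real.exp (-(t ^ p * a))) =
      ENNReal.ofReal (Real.Gamma ((m + 1 : ℕ) / p) / p) *
        ENNReal.ofReal a ^ (-(((m + 1 : ℕ) : ℝ) / p)) := by
  have hm : (-1 : ℝ) < m := by have : (0 : ℝ) ≤ m := by positivity
                               linarith
  have h := integral_rpow_mul_exp_neg_mul_rpow hp hm ha
  have hi := integrableOn_rpow_mul_exp_neg_mul_rpow hm hp ha
  have hΓ : 0 ≤ Real.Gamma ((m + 1 : ℕ) / p) := (Real.Gamma_pos_of_pos (by positivity)).le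
  rw [ENNReal.ofReal_rpow_of_pos ha, ← ENNReal.ofReal_mul (by positivity)]
  have e : ∀ t ∈ Ioi (0 : ℝ), ENNReal.ofReal (t ^ m) * ENNReal.ofReal (Real.exp (-(t ^ p * a))) =
      ENNReal.ofReal (t ^ (m : ℝ) * Real.exp (-a * t ^ p)) := fun t ht => by
    rw [← ENNReal.ofReal_mul (pow_nonneg (le_of_lt ht) _), Real.rpow_natCast]
    congr 3; ring
  rw [setLIntegral_congr_fun measurableSet_Ioi e, ← ofReal_integral_eq_lintegral_ofReal hi, h]
  · congr 1; push_cast; rw [neg_div]; ring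
  · filter_upwards [ae_restrict_mem measurableSet_Ioi] with t ht
    have : (0 : ℝ) < t := ht
    positivity

theorem lintegral_half_exp {A : Euc m → ℝ} (hA : IsGauge p A) (hp : 0 < p) (i : Fin (m + 1))
    {σ : ℝ} (hpos : ∀ u, 0 < A (ins i σ u)) :
    ∫⁻ s in Ioi (0 : ℝ), ∫⁻ u, ENNReal.ofReal (Real.exp (-A (ins i (s * σ) u))) =
      ENNReal.ofReal (Real.Gamma ((m + 1 : ℕ) / p) / p) * gno p i σ A := by
  have h1 : ∀ s ∈ Ioi (0 : ℝ), ∫⁻ u, ENNReal.ofReal (Real.exp (-A (ins i (s * σ) u))) =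
      ∫⁻ u, ENNReal.ofReal (s ^ m) * ENNReal.ofReal (Real.exp (-(s ^ p * A (ins i σ u)))) := by
    intro s hs
    have hs' : (0 : ℝ) < s := hs
    rw [lintegral_const_mul' _ _ ENNReal.ofReal_ne_top]
    have h2 : ∀ u, s ^ p * A (ins i σ u) = A (ins i (s * σ) (s • u)) := fun u => by
      rw [← smul_ins, hA.smul _ _ hs'.le]
    simp only [h2]
    have h3 : Measurable fun u : Fin m → ℝ => ENNReal.ofReal (Real.exp (-A (ins i (s * σ) u))) :=
      ENNReal.measurable_ofReal.comp (Real.measurable_exp.comp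
        (hA.cont.comp (continuous_ins_right i _)).measurable.neg)
    rw [← lintegral_map h3 (measurable_const_smul s), Measure.map_addHaar_smul _ hs'.ne',
      lintegral_smul_measure, Module.finrank_fin_fun, smul_eq_mul, ← mul_assoc,
      ← ENNReal.ofReal_mul (by positivity), abs_of_pos (by positivity),
      mul_inv_cancel₀ (by positivity), ENNReal.ofReal_one, one_mul]
  have hmeas : Measurable fun q : ℝ × (Fin m → ℝ) => ENNReal.ofReal (q.1 ^ m) *
      ENNReal.ofReal (Real.exp (-(q.1 ^ p * A (ins i σ q.2)))) := by
    have := (hA.cont.comp (continuous_ins_right i σ)).measurable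
    have h2 : Measurable fun q : ℝ × (Fin m → ℝ) => A (ins i σ q.2) := this.comp measurable_snd
    have h3 : Measurable fun q : ℝ × (Fin m → ℝ) => q.1 ^ p := measurable_fst.pow_const p
    exact (measurable_fst.pow_const m).ennreal_ofReal.mul
      (Real.measurable_exp.comp (h3.mul h2).neg).ennreal_ofReal
  rw [setLIntegral_congr_fun measurableSet_Ioi h1, lintegral_lintegral_swap hmeas.aemeasurable,
    gno, ← lintegral_const_mul' _ _ ENNReal.ofReal_ne_top]
  exact lintegral_congr fun u => lintegral_exp_neg_mul_rpow hp (hpos u) m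

theorem IsGauge.lintegral_exp_neg {A : Euc m → ℝ} (hA : IsGauge p A) (hp : 0 < p)
    (hpos : ∀ y, y ≠ 0 → 0 < A y) (i : Fin (m + 1)) :
    ∫⁻ y, ENNReal.ofReal (Real.exp (-A y)) =
      ENNReal.ofReal (Real.Gamma ((m + 1 : ℕ) / p) / p) * (gno p i 1 A + gno p i (-1) A) := by
  have hpos' : ∀ σ : ℝ, |σ| = 1 → ∀ u, 0 < A (ins i σ u) := fun σ hσ u =>
    hpos _ (ins_ne_zero i hσ u)
  have hF : Measurable fun y => ENNReal.ofReal (Real.exp (-A y)) := by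
    have := hA.cont
    fun_prop
  rw [← (measurePreserving_splitEquiv i).lintegral_comp hF, Measure.volume_eq_prod,
    lintegral_prod (fun a => ENNReal.ofReal (Real.exp (-A (splitEquiv i a))))
      (hF.comp (splitEquiv i).measurable).aemeasurable, mul_add,
    ← lintegral_half_exp hA hp i (hpos' 1 (by simp)),
    ← lintegral_half_exp hA hp i (hpos' (-1) (by simp))]
  simp only [splitEquiv_apply, mul_one, mul_neg_one]
  have h := lintegral_add_compl (μ := volume)
    (fun s => ∫⁻ u, ENNReal.ofReal (Real.exp (-A (ins i s u)))) (measurableSet_Ioi (a := (0 : ℝ)))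
  rw [← h, compl_Ioi, setLIntegral_congr Iio_ae_eq_Iic.symm]
  congr 1
  have h2 := (Measure.measurePreserving_neg (volume : Measure ℝ)).setLIntegral_comp_preimage_emb
    (MeasurableEquiv.neg ℝ).measurableEmbedding
    (fun s => ∫⁻ u, ENNReal.ofReal (Real.exp (-A (ins i s u)))) (Iio 0)
  rw [← h2]
  congr 2
  simp

/-- The integral of `exp (-A)`. -/
noncomputable def zint (A : Euc m → ℝ) : ℝ≥0∞ := ∫⁻ y, ENNReal.ofReal (Real.exp (-A y))

namespace IsBody

theorem isGauge (hW : IsBody R M W) (hp : 0 ≤ p) (c : Euc m) : IsGauge p (mom p W c) := by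
  have h : Continuous fun y : Euc m => (c, y) := by fun_prop
  have h' := (hW.continuous_mom hp).comp h
  simp only [Function.comp_def] at h'
  exact ⟨h', mom_nonneg p W c, fun y t ht => mom_smul p W c y ht⟩

theorem mom_steiner_neg (hW : IsBody R M W) (hp : 0 ≤ p) (i : Fin (m + 1)) (c u : Fin m → ℝ) :
    mom p (AsymmetricBS.steiner i W) (ins i 0 c) (ins i (-1) u) =
      mom p (AsymmetricBS.steiner i W) (ins i 0 c) (ins i 1 u) := by
  have key : ∀ r, ∫ s in fib i (AsymmetricBS.steiner i W) r,
      ppow p ⟪ins i s r.1 + ins i 0 c, ins i (-1) u⟫ =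
      ∫ s in fib i (AsymmetricBS.steiner i W) r, ppow p ⟪ins i s r.1 + ins i 0 c, ins i 1 u⟫ := by
    intro r
    have hr : 0 ≤ volume.real (fib i W r) := measureReal_nonneg
    rw [fib_steiner, ← integral_Ioc_eq_integral_Ioo, ← integral_Ioc_eq_integral_Ioo,
      ← intervalIntegral.integral_of_le (by linarith),
      ← intervalIntegral.integral_of_le (by linarith)]
    have := intervalIntegral.integral_comp_neg (a := -(volume.real (fib i W r) / 2))
      (b := volume.real (fib i W r) / 2)
      (fun s => ppow p ⟪ins i s r.1 + ins i 0 c, ins i 1 u⟫)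
    rw [neg_neg] at this
    rw [← this]
    congr 1; ext s
    simp only [ins_add_ins, inner_ins]
    congr 1; ring
  have hS := hW.steiner i
  exact le_antisymm
    (setIntegral_le_of_fiber i hS.meas hS.meas (hS.integrableOn (continuous_ppow_inner hp _ _))
      (hS.integrableOn (continuous_ppow_inner hp _ _)) fun r => (key r).le)
    (setIntegral_le_of_fiber i hS.meas hS.meas (hS.integrableOn (continuous_ppow_inner hp _ _))
      (hS.integrableOn (continuous_ppow_inner hp _ _)) fun r => (key r).ge)

/-- Steiner symmetrization increases `zint`, provided that the two halves are balanced. -/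
theorem zint_le_steiner (hW : IsBody R M W) (hp : 1 ≤ p) (i : Fin (m + 1)) {a : ℝ}
    {c : Fin m → ℝ} (hpos : ∀ y, y ≠ 0 → 0 < mom p W (ins i a c) y)
    (hpos' : ∀ y, y ≠ 0 → 0 < mom p (AsymmetricBS.steiner i W) (ins i 0 c) y)
    (hbal : gno p i 1 (mom p W (ins i a c)) = gno p i (-1) (mom p W (ins i a c))) :
    zint (mom p W (ins i a c)) ≤ zint (mom p (AsymmetricBS.steiner i W) (ins i 0 c)) := by
  have hp0 : 0 < p := by linarith
  have hA := hW.isGauge hp0.le (ins i a c)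
  have hB := (hW.steiner i).isGauge hp0.le (ins i 0 c)
  have h1 : |(1 : ℝ)| = 1 := abs_one
  have h2 : |(-1 : ℝ)| = 1 := by simp
  have hG₁ := hA.linearGrowth hp0 i h1 fun y hy _ => hpos y hy
  have hG₂ := hA.linearGrowth hp0 i h2 fun y hy _ => hpos y hy
  have hH := hB.linearGrowth hp0 i h1 fun y hy _ => hpos' y hy
  have e1 := hA.gno_eq hp0 i h1 fun y hy _ => hpos y hy
  have e2 := hA.gno_eq hp0 i h2 fun y hy _ => hpos y hy
  have e3 := hB.gno_eq hp0 i h1 fun y hy _ => hpos' y hy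
  set J := ∫ u, ((mom p W (ins i a c) (ins i 1 u) ^ p⁻¹) ^ (m + 1))⁻¹ with hJ
  have hJpos : 0 < J := by
    rw [hJ, integral_pos_iff_support_of_nonneg (fun u => by have := hG₁.pos u; positivity)
      (hG₁.integrable (lt_add_one m))]
    have : Function.support (fun u => ((mom p W (ins i a c) (ins i 1 u) ^ p⁻¹) ^ (m + 1))⁻¹) =
        univ := by
      ext u; simpa using (pow_pos (hG₁.pos u) (m + 1)).ne'
    rw [this]
    exact isOpen_univ.measure_pos volume univ_nonempty
  have hJ2 : ∫ u, ((mom p W (ins i a c) (ins i (-1) u) ^ p⁻¹) ^ (m + 1))⁻¹ = J := by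
    rw [hbal, e2] at e1
    refine (ENNReal.ofReal_eq_ofReal_iff ?_ hJpos.le).1 e1
    exact integral_nonneg fun u => by have := hG₂.pos u; positivity
  have hBBL := borell_brascamp_lieb m 1 one_pos hG₁ hG₂ hH (fun u v => ?_) (inv_pos.2 hJpos)
    (inv_pos.2 hJpos) (by rw [pow_one, inv_inv]) (by rw [pow_one, inv_inv, hJ2])
  · rw [add_self_div_two, pow_one, inv_inv] at hBBL
    rw [zint, zint, hA.lintegral_exp_neg hp0 hpos i, hB.lintegral_exp_neg hp0 hpos' i]
    have h4 : gno p i (-1) (mom p (AsymmetricBS.steiner i W) (ins i 0 c)) =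
        gno p i 1 (mom p (AsymmetricBS.steiner i W) (ins i 0 c)) := by
      simp only [gno, hW.mom_steiner_neg hp0.le]
    rw [h4, ← hbal, e1, e3]
    gcongr
  · have := hW.mom_steiner_le hp i (a := a) (c := c) (u := u) (v := v) (hG₁.pos u) (hG₂.pos v)
      (Real.rpow_inv_rpow (mom_nonneg _ _ _ _) hp0.ne').ge
      (Real.rpow_inv_rpow (mom_nonneg _ _ _ _) hp0.ne').ge
    refine (Real.rpow_le_rpow (mom_nonneg _ _ _ _) this (by positivity)).trans_eq ?_
    have := hG₁.pos u
    have := hG₂.pos v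
    exact Real.rpow_rpow_inv (by positivity) hp0.ne'

theorem mom_le_of_mom_eq_zero (hW : IsBody R M W) (hp : 0 < p) {c y₀ : Euc m}
    (h : mom p W c y₀ = 0) (y : Euc m) :
    mom p W c y ≤ volume.real W * (|R + ‖c‖| * ‖y - y₀‖) ^ p := by
  have h0 : (fun w : Euc m × ℝ => ppow p ⟪w.1 + c, y₀⟫) =ᵐ[volume.restrict W] 0 :=
    (integral_eq_zero_iff_of_nonneg (fun _ => ppow_nonneg _ _)
      (hW.integrableOn (continuous_ppow_inner hp.le _ _))).1 h
  have hfin : IsFiniteMeasure (volume.restrict W) := ⟨by simpa using hW.measure_lt_top⟩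
  calc mom p W c y ≤ ∫ w in W, (|R + ‖c‖| * ‖y - y₀‖) ^ p := by
        refine integral_mono_ae (hW.integrableOn (continuous_ppow_inner hp.le _ _))
          (integrable_const _) ?_
        filter_upwards [h0, ae_restrict_mem hW.meas] with w hw hwW
        have h1 : ⟪w.1 + c, y₀⟫ ≤ 0 := by
          by_contra! hlt
          exact (ppow_pos hlt p).ne' hw
        have h2 : ‖w.1 + c‖ ≤ |R + ‖c‖| := (norm_add_le _ _).trans
          (le_trans (by linarith [hW.norm_le w hwW]) (le_abs_self _))
        have h3 : ⟪w.1 + c, y⟫ ≤ |R + ‖c‖| * ‖y - y₀‖ := by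
          calc ⟪w.1 + c, y⟫ = ⟪w.1 + c, y - y₀⟫ + ⟪w.1 + c, y₀⟫ := by rw [inner_sub_right]; ring
            _ ≤ ‖w.1 + c‖ * ‖y - y₀‖ := by linarith [real_inner_le_norm (w.1 + c) (y - y₀)]
            _ ≤ _ := by gcongr
        exact Real.rpow_le_rpow (le_max_right _ _) (max_le h3 (by positivity)) hp.le
    _ = _ := by rw [setIntegral_const, smul_eq_mul]

end IsBody

theorem gno_eq_top_of_le {A : Euc m → ℝ} (hp : 0 < p) (i : Fin (m + 1)) {σ : ℝ} {u₀ : Fin m → ℝ}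
    {K : ℝ} (h : ∀ u, A (ins i σ u) ≤ (K * ‖ins i σ u - ins i σ u₀‖) ^ p) (hK : 0 < K) :
    gno p i σ A = ∞ := by
  set L := K * (m + 1) with hL
  have hLpos : 0 < L := by positivity
  have hle : ∀ u, A (ins i σ u) ≤ (L * ‖u - u₀‖) ^ p := fun u => by
    refine (h u).trans (Real.rpow_le_rpow (by positivity) ?_ hp.le)
    have e : ins i σ u - ins i σ u₀ = ins i 0 (u - u₀) := ext_ins i (by simp) (by simp)
    have h2 : ‖ins i 0 (u - u₀)‖ ≤ (m + 1) * ‖u - u₀‖ := by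
      refine (pow_le_pow_iff_left₀ (norm_nonneg _) (by positivity) two_ne_zero).1 ?_
      rw [norm_ins_sq]
      have : (u - u₀) ⬝ᵥ (u - u₀) ≤ ∑ _k : Fin m, ‖u - u₀‖ ^ 2 := by
        refine Finset.sum_le_sum fun k _ => ?_
        rw [← sq, ← sq_abs]
        exact pow_le_pow_left₀ (abs_nonneg _) (norm_le_pi_norm (u - u₀) k) 2
      simp only [Finset.sum_const, Finset.card_univ, Fintype.card_fin, nsmul_eq_mul] at this
      have hm : (0 : ℝ) ≤ m := by positivity
      nlinarith [sq_nonneg ‖u - u₀‖, mul_nonneg hm (sq_nonneg ‖u - u₀‖),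
        mul_nonneg (mul_nonneg hm hm) (sq_nonneg ‖u - u₀‖)]
    rw [e, hL, mul_assoc]
    gcongr
  have hball : ∀ r : ℝ, 0 < r → ENNReal.ofReal ((L * r) ^ (m + 1))⁻¹ *
      (ENNReal.ofReal (r ^ m) * volume (Metric.ball (0 : Fin m → ℝ) 1)) ≤ gno p i σ A := by
    intro r hr
    have hv := Measure.addHaar_ball_of_pos (volume : Measure (Fin m → ℝ)) u₀ hr
    rw [Module.finrank_fin_fun] at hv
    rw [← hv, ← setLIntegral_const]
    refine (setLIntegral_mono' measurableSet_ball fun u hu => ?_).trans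
      (setLIntegral_le_lintegral _ _)
    have h1 : A (ins i σ u) ≤ (L * r) ^ p := by
      refine (hle u).trans (Real.rpow_le_rpow (by positivity) ?_ hp.le)
      rw [Metric.mem_ball, dist_eq_norm] at hu
      gcongr
    have h2 : (0 : ℝ) ≤ ((m + 1 : ℕ) : ℝ) / p := by positivity
    have h3 : ENNReal.ofReal ((L * r) ^ (m + 1))⁻¹ =
        ENNReal.ofReal ((L * r) ^ p) ^ (-(((m + 1 : ℕ) : ℝ) / p)) := by
      rw [ENNReal.ofReal_rpow_of_pos (by positivity), ← Real.rpow_mul (by positivity),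
        mul_neg, mul_div_cancel₀ _ hp.ne', Real.rpow_neg (by positivity), Real.rpow_natCast]
    rw [h3, ENNReal.rpow_neg, ENNReal.rpow_neg, ENNReal.inv_le_inv]
    exact ENNReal.rpow_le_rpow (ENNReal.ofReal_le_ofReal h1) h2
  set V := volume (Metric.ball (0 : Fin m → ℝ) 1) with hV
  have hV0 : 0 < V.toReal := ENNReal.toReal_pos (Metric.measure_ball_pos _ _ one_pos).ne'
    measure_ball_lt_top.ne
  refine ENNReal.eq_top_of_forall_nnreal_le fun q => ?_
  have hr : 0 < V.toReal / (L ^ (m + 1) * (q + 1)) := by positivity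
  refine le_trans ?_ (hball _ hr)
  rw [← ENNReal.ofReal_toReal (a := V) measure_ball_lt_top.ne, ← ENNReal.ofReal_mul (by positivity),
    ← ENNReal.ofReal_mul (by positivity), ENNReal.ofReal_toReal measure_ball_lt_top.ne,
    ← ENNReal.ofReal_coe_nnreal]
  refine ENNReal.ofReal_le_ofReal ?_
  set r := V.toReal / (L ^ (m + 1) * (q + 1)) with hr'
  have : ((L * r) ^ (m + 1))⁻¹ * (r ^ m * V.toReal) = V.toReal / (L ^ (m + 1) * r) := by
    rw [mul_pow, pow_succ r]; field_simp
  rw [this, hr']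
  have hq : (0 : ℝ) ≤ q := q.2
  have : V.toReal / (L ^ (m + 1) * (V.toReal / (L ^ (m + 1) * (q + 1)))) = q + 1 := by
    field_simp
  rw [this]; linarith

theorem IsBody.gno_eq_top (hW : IsBody R M W) (hp : 0 < p) (i : Fin (m + 1)) {σ : ℝ}
    {c : Euc m} {u₀ : Fin m → ℝ} (h : mom p W c (ins i σ u₀) = 0) :
    gno p i σ (mom p W c) = ∞ := by
  refine gno_eq_top_of_le hp i (u₀ := u₀) (K := volume.real W ^ p⁻¹ * |R + ‖c‖| + 1)
    (fun u => ?_) (by positivity)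
  refine (hW.mom_le_of_mom_eq_zero hp h _).trans ?_
  set N := ‖ins i σ u - ins i σ u₀‖
  have h1 : volume.real W = (volume.real W ^ p⁻¹) ^ p :=
    (Real.rpow_inv_rpow measureReal_nonneg hp.ne').symm
  calc volume.real W * (|R + ‖c‖| * N) ^ p = (volume.real W ^ p⁻¹ * (|R + ‖c‖| * N)) ^ p := by
        conv_lhs => rw [h1]
        rw [← Real.mul_rpow (by positivity) (by positivity)]
    _ ≤ _ := by
        refine Real.rpow_le_rpow (by positivity) ?_ hp.le
        have : 0 ≤ N := norm_nonneg _
        nlinarith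

namespace IsBody

theorem mom_mono (hW : IsBody R M W) (hp : 0 ≤ p) (i : Fin (m + 1)) (σ : ℝ)
    (c u : Fin m → ℝ) {b b' : ℝ} (h : b ≤ b') :
    mom p W (ins i (σ * b) c) (ins i σ u) ≤ mom p W (ins i (σ * b') c) (ins i σ u) := by
  refine setIntegral_mono (hW.integrableOn (continuous_ppow_inner hp _ _))
    (hW.integrableOn (continuous_ppow_inner hp _ _)) fun w => monotone_ppow hp ?_
  simp only [inner_add_left, inner_ins]
  nlinarith [mul_nonneg (mul_self_nonneg σ) (sub_nonneg.2 h)]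

theorem mom_ins_zero (hW : IsBody R M W) (hp : 0 ≤ p) (i : Fin (m + 1)) (a : ℝ)
    (c u : Fin m → ℝ) :
    mom p W (ins i a c) (ins i 0 u) =
      mom p (AsymmetricBS.steiner i W) (ins i 0 c) (ins i 0 u) := by
  have e : ∀ w : Euc m × ℝ,
      ⟪w.1 + ins i 0 c, ins i 0 u⟫ = ⟪w.1 + ins i a c, ins i 0 u⟫ := fun w => by
    simp only [inner_add_left, inner_ins]; ring
  simp only [mom, e]
  refine (hW.integral_steiner i (continuous_ppow_inner hp _ _) fun s u' τ => ?_).symm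
  simp only [ins_add_ins, inner_ins, mul_zero]

theorem continuous_gno (hW : IsBody R M W) (hp : 0 < p) (i : Fin (m + 1)) {σ : ℝ}
    (hσ : |σ| = 1) (c : Fin m → ℝ)
    (hrec : ∀ u, u ≠ 0 → 0 < mom p (AsymmetricBS.steiner i W) (ins i 0 c) (ins i 0 u)) :
    Continuous fun b => gno p i σ (mom p W (ins i (σ * b) c)) := by
  have hσ2 : σ * σ = 1 := by rw [← abs_mul_abs_self, hσ, one_mul]
  have hins : Continuous fun b : ℝ => ins i (σ * b) c :=
    (continuous_ins i).comp ((continuous_const.mul continuous_id).prodMk continuous_const)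
  have hjoint : Continuous fun q : ℝ × Euc m => mom p W (ins i (σ * q.1) c) q.2 := by
    have h := (hW.continuous_mom hp.le).comp ((hins.comp continuous_fst).prodMk
      (continuous_snd (X := ℝ) (Y := Euc m)))
    simpa only [Function.comp_def] using h
  have hcontu : ∀ u, Continuous fun b => mom p W (ins i (σ * b) c) (ins i σ u) := fun u => by
    have h := hjoint.comp (continuous_id.prodMk (continuous_const (y := ins i σ u)))
    simpa only [Function.comp_def, id] using h
  have hmeas : ∀ b, Measurable fun u : Fin m → ℝ =>
      ENNReal.ofReal (mom p W (ins i (σ * b) c) (ins i σ u)) ^ (-(((m + 1 : ℕ) : ℝ) / p)) :=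
    fun b => ((((hW.isGauge hp.le (ins i (σ * b) c)).cont.comp
      (continuous_ins_right i σ)).measurable).ennreal_ofReal).pow_const _
  have hpt : ∀ u b₀, Tendsto (fun b => ENNReal.ofReal (mom p W (ins i (σ * b) c) (ins i σ u)) ^
      (-(((m + 1 : ℕ) : ℝ) / p))) (𝓝 b₀)
      (𝓝 (ENNReal.ofReal (mom p W (ins i (σ * b₀) c) (ins i σ u)) ^
      (-(((m + 1 : ℕ) : ℝ) / p)))) := fun u b₀ =>
    ((ENNReal.continuous_rpow_const.comp ENNReal.continuous_ofReal).comp (hcontu u)).tendsto b₀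
  have hrec' : ∀ b y, y ≠ 0 → σ * y i = 0 → 0 < mom p W (ins i (σ * b) c) y := by
    intro b y hy h0
    have h1 : y i = 0 := by
      have : σ ≠ 0 := by rintro rfl; simp at hσ
      simpa [this] using h0
    have h2 : y = ins i 0 (rest i y) := by rw [← h1, ins_rest]
    rw [h2, hW.mom_ins_zero hp.le]
    refine hrec _ fun h => hy ?_
    rw [h2, h]; exact ext_ins i (by simp) (by simp)
  refine continuous_iff_continuousAt.2 fun b₀ => ?_
  by_cases hz : ∃ u₀, mom p W (ins i (σ * b₀) c) (ins i σ u₀) = 0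
  · obtain ⟨u₀, hu₀⟩ := hz
    have htop : gno p i σ (mom p W (ins i (σ * b₀) c)) = ∞ := hW.gno_eq_top hp i hu₀
    refine tendsto_of_seq_tendsto fun b hb => ?_
    simp only [Function.comp_def]
    rw [htop]
    have hF := lintegral_liminf_le (u := atTop) (μ := volume) (f := fun (k : ℕ) u =>
      ENNReal.ofReal (mom p W (ins i (σ * b k) c) (ins i σ u)) ^ (-(((m + 1 : ℕ) : ℝ) / p)))
      fun k => hmeas (b k)
    have hlim : ∀ u, liminf (fun k => ENNReal.ofReal (mom p W (ins i (σ * b k) c) (ins i σ u)) ^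
        (-(((m + 1 : ℕ) : ℝ) / p))) atTop =
        ENNReal.ofReal (mom p W (ins i (σ * b₀) c) (ins i σ u)) ^ (-(((m + 1 : ℕ) : ℝ) / p)) :=
      fun u => ((hpt u b₀).comp hb).liminf_eq
    simp only [hlim] at hF
    refine tendsto_of_le_liminf_of_limsup_le ?_ le_top
    exact htop.ge.trans hF
  · push Not at hz
    have hpos : ∀ y ∈ Metric.sphere (0 : Euc m) 1 ∩ {y | 0 ≤ σ * y i},
        0 < mom p W (ins i (σ * b₀) c) y := by
      rintro y ⟨hy1, hy2⟩
      have hy0 : y ≠ 0 := by rintro rfl; simp at hy1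
      rcases (show 0 ≤ σ * y i from hy2).eq_or_lt with h0 | h0
      · exact hrec' b₀ y hy0 h0.symm
      · have : y = (σ * y i) • ins i σ ((σ * y i)⁻¹ • rest i y) := by
          rw [smul_ins, smul_smul, mul_inv_cancel₀ h0.ne', one_smul]
          conv_lhs => rw [← ins_rest i y]
          congr 1
          linear_combination -y i * hσ2
        rw [this, mom_smul _ _ _ _ h0.le]
        exact mul_pos (Real.rpow_pos_of_pos h0 _)
          (lt_of_le_of_ne (mom_nonneg _ _ _ _) (hz _).symm)
    have hKc : IsCompact (Metric.sphere (0 : Euc m) 1 ∩ {y | 0 ≤ σ * y i}) :=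
      (isCompact_sphere _ _).inter_right (isClosed_le continuous_const (by fun_prop))
    have hev : ∀ᶠ b in 𝓝 b₀, ∀ y ∈ Metric.sphere (0 : Euc m) 1 ∩ {y | 0 ≤ σ * y i},
        0 < mom p W (ins i (σ * b) c) y :=
      hKc.eventually_forall_of_forall_eventually fun y hy =>
        (hjoint.tendsto (b₀, y)).eventually (lt_mem_nhds (hpos y hy))
    obtain ⟨b₁, hb₁, hlt⟩ := (hev.filter_mono nhdsWithin_le_nhds |>.and
      (self_mem_nhdsWithin (a := b₀) (s := Iio b₀))).exists
    have hpos₁ : ∀ y, y ≠ 0 → 0 ≤ σ * y i → 0 < mom p W (ins i (σ * b₁) c) y := by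
      intro y hy h0
      have hn := norm_pos_iff.2 hy
      have : y = ‖y‖ • ((‖y‖⁻¹ : ℝ) • y) := by rw [smul_smul, mul_inv_cancel₀ hn.ne', one_smul]
      rw [this, mom_smul _ _ _ _ hn.le]
      refine mul_pos (Real.rpow_pos_of_pos hn _) (hb₁ _ ⟨by simp [norm_smul, hn.ne'], ?_⟩)
      simp only [mem_ofPred_eq, PiLp.smul_apply, smul_eq_mul]
      rw [mul_left_comm]; positivity
    have hfin := (hW.isGauge hp.le (ins i (σ * b₁) c)).gno_lt_top hp i hσ hpos₁
    refine tendsto_lintegral_filter_of_dominated_convergence _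
      (Eventually.of_forall fun b => hmeas b) ?_ hfin.ne
      (Eventually.of_forall fun u => hpt u b₀)
    filter_upwards [lt_mem_nhds (show b₁ < b₀ from hlt)] with b hb
    refine Eventually.of_forall fun u => ?_
    have h2 : (0 : ℝ) ≤ ((m + 1 : ℕ) : ℝ) / p := by positivity
    rw [ENNReal.rpow_neg, ENNReal.rpow_neg, ENNReal.inv_le_inv]
    exact ENNReal.rpow_le_rpow (ENNReal.ofReal_le_ofReal
      (hW.mom_mono hp.le i σ c u hb.le)) h2

/-- The two halves cut off by a coordinate hyperplane can be balanced by moving the center. -/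
theorem exists_balanced (hW : IsBody R M W) (hp : 1 ≤ p) (i : Fin (m + 1)) (c : Fin m → ℝ)
    (hpos : ∀ y, y ≠ 0 → 0 < mom p (AsymmetricBS.steiner i W) (ins i 0 c) y) :
    ∃ a, (∀ y, y ≠ 0 → 0 < mom p W (ins i a c) y) ∧
      gno p i 1 (mom p W (ins i a c)) = gno p i (-1) (mom p W (ins i a c)) := by
  have hp0 : 0 < p := by linarith
  have hrec : ∀ u, u ≠ 0 → 0 < mom p (AsymmetricBS.steiner i W) (ins i 0 c) (ins i 0 u) :=
    fun u hu => hpos _ fun h => hu (by rw [← rest_ins i 0 u, h]; rfl)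
  have hc₁ := hW.continuous_gno hp0 i abs_one c hrec
  have hc₂ := (hW.continuous_gno hp0 i (σ := -1) (by simp) c hrec).comp continuous_neg
  simp only [one_mul] at hc₁
  simp only [Function.comp_def, neg_mul, one_mul, neg_neg] at hc₂
  have hend : ∀ σ : ℝ, σ * σ = 1 → gno p i σ (mom p W (ins i (-(σ * |R|)) c)) = ∞ := by
    intro σ hσ
    refine hW.gno_eq_top hp0 i (u₀ := 0) ?_
    refine setIntegral_eq_zero_of_forall_eq_zero fun w hw => ppow_of_nonpos hp0 ?_
    have h1 := abs_le_norm_ins i (w.1 i) (rest i w.1)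
    rw [ins_rest] at h1
    have h2 := (h1.trans (hW.norm_le w hw)).trans (le_abs_self R)
    have hσ1 : |σ| = 1 := by
      have := abs_mul_abs_self σ
      nlinarith [abs_nonneg σ]
    have h3 : w.1 i * σ ≤ |R| := by
      refine (le_abs_self _).trans ?_
      rw [abs_mul, hσ1, mul_one]; exact h2
    rw [← ins_rest i w.1, ins_add_ins, inner_ins, dotProduct_zero]
    have h4 : (w.1 i + -(σ * |R|)) * σ + 0 = w.1 i * σ - |R| := by linear_combination (-|R|) * hσ
    linarith
  obtain ⟨a, -, ha⟩ := isPreconnected_univ.intermediate_value₂ (mem_univ (|R|)) (mem_univ (-|R|))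
    hc₁.continuousOn hc₂.continuousOn
    (by have := hend (-1) (by norm_num); simp only [neg_mul, one_mul, neg_neg] at this
        rw [this]; exact le_top)
    (by have := hend 1 (by norm_num); simp only [one_mul] at this
        rw [this]; exact le_top)
  refine ⟨a, ?_, ha⟩
  have hfin : gno p i 1 (mom p W (ins i a c)) ≠ ∞ := by
    intro htop
    have hzero : ∀ σ : ℝ, |σ| = 1 → gno p i σ (mom p W (ins i a c)) = ∞ →
        ∃ u, mom p W (ins i a c) (ins i σ u) = 0 := by
      intro σ hσ h
      have hσ2 : σ * σ = 1 := by rw [← abs_mul_abs_self, hσ, one_mul]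
      by_contra! hne
      refine ((hW.isGauge hp0.le (ins i a c)).gno_lt_top hp0 i hσ fun y hy h0 => ?_).ne h
      rcases h0.eq_or_lt with h0 | h0
      · have h1 : y i = 0 := by
          have : σ ≠ 0 := by rintro rfl; simp at hσ
          simpa [this] using h0.symm
        have h2 : y = ins i 0 (rest i y) := by rw [← h1, ins_rest]
        rw [h2, hW.mom_ins_zero hp0.le]
        exact hpos _ (h2 ▸ hy)
      · have : y = (σ * y i) • ins i σ ((σ * y i)⁻¹ • rest i y) := by
          rw [smul_ins, smul_smul, mul_inv_cancel₀ h0.ne', one_smul]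
          conv_lhs => rw [← ins_rest i y]
          congr 1
          linear_combination -y i * hσ2
        rw [this, mom_smul _ _ _ _ h0.le]
        exact mul_pos (Real.rpow_pos_of_pos h0 _)
          (lt_of_le_of_ne (mom_nonneg _ _ _ _) (hne _).symm)
    obtain ⟨u, hu⟩ := hzero 1 abs_one htop
    obtain ⟨v, hv⟩ := hzero (-1) (by simp) (ha ▸ htop)
    have hH := hpos _ (ins_ne_zero i abs_one ((2 : ℝ)⁻¹ • (u + v)))
    set H := mom p (AsymmetricBS.steiner i W) (ins i 0 c) (ins i 1 ((2 : ℝ)⁻¹ • (u + v))) with hHdef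
    have hε : 0 < (H / 2) ^ p⁻¹ := by positivity
    have := hW.mom_steiner_le hp i hε hε (by rw [hu]; positivity) (by rw [hv]; positivity)
    rw [add_self_div_two, Real.rpow_inv_rpow (by positivity) hp0.ne', ← hHdef] at this
    linarith
  have hne : ∀ σ : ℝ, gno p i σ (mom p W (ins i a c)) ≠ ∞ → ∀ u,
      0 < mom p W (ins i a c) (ins i σ u) := fun σ h u =>
    lt_of_le_of_ne (mom_nonneg _ _ _ _) fun h0 => h (hW.gno_eq_top hp0 i h0.symm)
  intro y hy
  rcases lt_trichotomy (y i) 0 with h0 | h0 | h0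
  · have : y = (-y i) • ins i (-1) ((-y i)⁻¹ • rest i y) := by
      rw [smul_ins, smul_smul, mul_inv_cancel₀ (by linarith), one_smul, mul_neg_one, neg_neg,
        ins_rest]
    rw [this, mom_smul _ _ _ _ (by linarith)]
    exact mul_pos (Real.rpow_pos_of_pos (by linarith) _) (hne (-1) (ha ▸ hfin) _)
  · have h2 : y = ins i 0 (rest i y) := by rw [← h0, ins_rest]
    rw [h2, hW.mom_ins_zero hp0.le]
    exact hpos _ (h2 ▸ hy)
  · have : y = y i • ins i 1 ((y i)⁻¹ • rest i y) := by
      rw [smul_ins, smul_smul, mul_inv_cancel₀ h0.ne', one_smul, mul_one, ins_rest]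
    rw [this, mom_smul _ _ _ _ h0.le]
    exact mul_pos (Real.rpow_pos_of_pos h0 _) (hne 1 hfin _)

end IsBody

/-- Integration in polar coordinates. -/
theorem lintegral_polar {F : Euc m → ℝ≥0∞} (hF : Measurable F) :
    ∫⁻ y, F y = ∫⁻ ξ : Metric.sphere (0 : Euc m) 1,
      (∫⁻ t in Ioi (0 : ℝ), ENNReal.ofReal (t ^ m) * F (t • (ξ : Euc m)))
        ∂(volume : Measure (Euc m)).toSphere := by
  have hmp := (volume : Measure (Euc m)).measurePreserving_homeomorphUnitSphereProd
  have hG : Measurable fun q : Metric.sphere (0 : Euc m) 1 × Ioi (0 : ℝ) =>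
      F ((q.2 : ℝ) • (q.1 : Euc m)) :=
    hF.comp ((measurable_subtype_coe.comp measurable_snd).smul
      (measurable_subtype_coe.comp measurable_fst))
  have h1 : ∫⁻ y, F y = ∫⁻ y : ({0}ᶜ : Set (Euc m)), F y ∂(Measure.comap Subtype.val volume) := by
    rw [lintegral_subtype_comap (measurableSet_singleton _).compl, restrict_compl_singleton]
  have h2 := hmp.lintegral_comp hG
  have h3 : ∀ y : ({0}ᶜ : Set (Euc m)), F ((((homeomorphUnitSphereProd (Euc m)) y).2 : ℝ) •
      (((homeomorphUnitSphereProd (Euc m)) y).1 : Euc m)) = F y := fun y => by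
    have hy : ‖(y : Euc m)‖ ≠ 0 := norm_ne_zero_iff.2 y.2
    simp [smul_smul, mul_inv_cancel₀ hy]
  simp only [h3] at h2
  rw [h1, h2, lintegral_prod _ hG.aemeasurable]
  refine lintegral_congr fun ξ => ?_
  have hd : Module.finrank ℝ (Euc m) - 1 = m := by simp [finrank_euclideanSpace]
  have hξ : Measurable fun t : Ioi (0 : ℝ) => F ((t : ℝ) • (ξ : Euc m)) :=
    hG.comp (measurable_prodMk_left (x := ξ))
  have hd' := lintegral_withDensity_eq_lintegral_mul (Measure.comap Subtype.val volume)
    (f := fun t : Ioi (0 : ℝ) => ENNReal.ofReal ((t : ℝ) ^ m))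
    ((measurable_subtype_coe.pow_const _).ennreal_ofReal) hξ
  rw [Measure.volumeIoiPow, hd]
  exact hd'.trans (lintegral_subtype_comap measurableSet_Ioi
    fun t => ENNReal.ofReal (t ^ m) * F (t • (ξ : Euc m)))

theorem IsGauge.zint_eq {A : Euc m → ℝ} (hA : IsGauge p A) (hp : 0 < p)
    (hpos : ∀ y, y ≠ 0 → 0 < A y) :
    zint A = ENNReal.ofReal (Real.Gamma ((m + 1 : ℕ) / p) / p) *
      ∫⁻ ξ : Metric.sphere (0 : Euc m) 1, ENNReal.ofReal (A ξ) ^ (-(((m + 1 : ℕ) : ℝ) / p))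
        ∂(volume : Measure (Euc m)).toSphere := by
  have hF : Measurable fun y => ENNReal.ofReal (Real.exp (-A y)) := by
    have := hA.cont
    fun_prop
  rw [zint, lintegral_polar hF, ← lintegral_const_mul' _ _ ENNReal.ofReal_ne_top]
  refine lintegral_congr fun ξ => ?_
  have hξ : (ξ : Euc m) ≠ 0 := fun h => by
    have := ξ.2
    simp [h] at this
  rw [← lintegral_exp_neg_mul_rpow hp (hpos _ hξ) m]
  refine setLIntegral_congr_fun measurableSet_Ioi fun t ht => ?_
  simp only [hA.smul _ t (le_of_lt ht)]

/-- The preimage of a subset of `Euc m × ℝ` under a linear isometry of the first factor. -/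
def rot (Q : Euc m ≃ₗᵢ[ℝ] Euc m) (W : Set (Euc m × ℝ)) : Set (Euc m × ℝ) :=
  (fun w => (Q w.1, w.2)) ⁻¹' W

theorem measurePreserving_rot (Q : Euc m ≃ₗᵢ[ℝ] Euc m) :
    MeasurePreserving fun w : Euc m × ℝ => (Q w.1, w.2) :=
  Q.measurePreserving.prod (MeasurePreserving.id volume)

theorem measurableEmbedding_rot (Q : Euc m ≃ₗᵢ[ℝ] Euc m) :
    MeasurableEmbedding fun w : Euc m × ℝ => (Q w.1, w.2) :=
  (Q.toHomeomorph.prodCongr (Homeomorph.refl ℝ)).measurableEmbedding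

theorem integral_rot (Q : Euc m ≃ₗᵢ[ℝ] Euc m) (W : Set (Euc m × ℝ)) (F : Euc m × ℝ → ℝ) :
    ∫ w in rot Q W, F (Q w.1, w.2) = ∫ w in W, F w :=
  (measurePreserving_rot Q).setIntegral_preimage_emb (measurableEmbedding_rot Q) F W

theorem IsBody.rot (hW : IsBody R M W) (Q : Euc m ≃ₗᵢ[ℝ] Euc m) :
    IsBody R M (AsymmetricBS.rot Q W) :=
  ⟨(measurePreserving_rot Q).measurable hW.meas,
    fun w hw => by simpa using hW.norm_le _ hw, fun w hw => hW.pos (Q w.1, w.2) hw,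
    fun w hw => hW.le (Q w.1, w.2) hw⟩

theorem IsBody.volume_real_steiner (hW : IsBody R M W) (i : Fin (m + 1)) :
    volume.real (AsymmetricBS.steiner i W) = volume.real W := by
  have := hW.integral_steiner i (F := fun _ => (1 : ℝ)) continuous_const fun _ _ _ => rfl
  simpa using this

theorem mom_rot (Q : Euc m ≃ₗᵢ[ℝ] Euc m) (p : ℝ) (W : Set (Euc m × ℝ)) (y : Euc m) :
    mom p (rot Q W) 0 y = mom p W 0 (Q y) := by
  rw [mom, mom, ← integral_rot Q W]
  simp

theorem zint_rot (Q : Euc m ≃ₗᵢ[ℝ] Euc m) (p : ℝ) (W : Set (Euc m × ℝ)) :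
    zint (mom p (rot Q W) 0) = zint (mom p W 0) := by
  simp only [zint, mom_rot]
  exact Q.measurePreserving.lintegral_comp_emb Q.toHomeomorph.measurableEmbedding
    fun y => ENNReal.ofReal (Real.exp (-mom p W 0 y))

/-- Invariance under `(x, τ) ↦ (-x, τ)`. -/
def IsEven (W : Set (Euc m × ℝ)) : Prop := ∀ x τ, (x, τ) ∈ W → (-x, τ) ∈ W

namespace IsEven

theorem rot_neg (hE : IsEven W) : rot (LinearIsometryEquiv.neg ℝ) W = W := by
  ext ⟨x, τ⟩
  exact ⟨fun h => by simpa using hE _ _ h, fun h => hE _ _ h⟩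

theorem rot (hE : IsEven W) (Q : Euc m ≃ₗᵢ[ℝ] Euc m) : IsEven (rot Q W) := fun x τ h => by
  have := hE _ _ h
  rwa [← map_neg] at this

theorem mom_neg (hE : IsEven W) (p : ℝ) (y : Euc m) : mom p W 0 (-y) = mom p W 0 y := by
  conv_rhs => rw [← hE.rot_neg, mom_rot]
  rfl

theorem steiner (hE : IsEven W) (i : Fin (m + 1)) : IsEven (steiner i W) := fun x τ h => by
  have h1 : fib i W (rest i (-x), τ) = -fib i W (rest i x, τ) := by
    ext s
    have e : ins i s (rest i (-x)) = -ins i (-s) (rest i x) := by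
      rw [neg_ins, neg_neg]; rfl
    simp only [fib, mem_ofPred_eq, Set.mem_neg, e]
    exact ⟨fun h => by simpa using hE _ _ h, fun h => hE _ _ h⟩
  have h2 : volume.real (fib i W (rest i (-x), τ)) = volume.real (fib i W (rest i x, τ)) := by
    rw [h1, measureReal_def, Measure.measure_neg, measureReal_def]
  simp only [AsymmetricBS.steiner, mem_ofPred_eq, h2, PiLp.neg_apply, abs_neg] at h ⊢
  exact h

theorem mom_pos (hE : IsEven W) (hW : IsBody R M W) (hv : volume W ≠ 0) (hp : 0 < p) {y : Euc m}
    (hy : y ≠ 0) : 0 < mom p W 0 y := by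
  refine lt_of_le_of_ne (mom_nonneg _ _ _ _) fun h => hv ?_
  have key : ∀ z, mom p W 0 z = 0 → ∀ᵐ w ∂volume.restrict W, ⟪w.1, z⟫ ≤ 0 := fun z hz => by
    have := (integral_eq_zero_iff_of_nonneg (fun _ => ppow_nonneg _ _)
      (hW.integrableOn (continuous_ppow_inner hp.le 0 z))).1 hz
    filter_upwards [this] with w hw
    by_contra! hlt
    rw [add_zero] at hw
    exact (ppow_pos hlt p).ne' hw
  have h1 : ∀ᵐ w ∂volume.restrict W, ⟪w.1, y⟫ = 0 := by
    filter_upwards [key y h.symm, key (-y) (by rw [hE.mom_neg, ← h])] with w h1 h2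
    rw [inner_neg_right] at h2
    linarith
  set L : Euc m × ℝ →ₗ[ℝ] ℝ := ((innerSL ℝ y).comp (ContinuousLinearMap.fst ℝ (Euc m) ℝ)).toLinearMap
    with hL
  have hadd : (volume : Measure (Euc m × ℝ)).IsAddHaarMeasure :=
    inferInstanceAs ((volume : Measure (Euc m)).prod (volume : Measure ℝ)).IsAddHaarMeasure
  have h2 : (volume : Measure (Euc m × ℝ)) (LinearMap.ker L : Set (Euc m × ℝ)) = 0 := by
    refine Measure.addHaar_submodule _ _ fun htop => hy ?_
    have : (y, (0 : ℝ)) ∈ LinearMap.ker L := by rw [htop]; trivial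
    simpa [hL] using this
  rw [ae_restrict_iff' hW.meas, ae_iff] at h1
  refine measure_mono_null (fun w hw => ?_) (measure_union_null h1 h2)
  by_cases h0 : ⟪w.1, y⟫ = 0
  · exact Or.inr (by simpa [hL, real_inner_comm] using h0)
  · exact Or.inl fun h => h0 (h hw)

theorem zint_le_steiner (hE : IsEven W) (hW : IsBody R M W) (hv : volume.real W ≠ 0) (hp : 1 ≤ p)
    (i : Fin (m + 1)) : zint (mom p W 0) ≤ zint (mom p (AsymmetricBS.steiner i W) 0) := by
  have e0 : (0 : Euc m) = ins i 0 0 := ext_ins i (by simp) (by simp)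
  have hp0 : 0 < p := by linarith
  have hv' : ∀ {V : Set (Euc m × ℝ)}, volume.real V ≠ 0 → volume V ≠ 0 := fun h h0 => h (by
    simp [measureReal_def, h0])
  have h1 : ∀ y, y ≠ 0 → 0 < mom p W 0 y := fun y hy => hE.mom_pos hW (hv' hv) hp0 hy
  have h2 : ∀ y, y ≠ 0 → 0 < mom p (AsymmetricBS.steiner i W) 0 y := fun y hy =>
    (hE.steiner i).mom_pos (hW.steiner i)
      (hv' ((hW.volume_real_steiner i).symm ▸ hv)) hp0 hy
  have h3 : gno p i 1 (mom p W 0) = gno p i (-1) (mom p W 0) := by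
    have e : ∀ u, mom p W 0 (ins i (-1) u) = mom p W 0 (ins i 1 (-u)) := fun u => by
      rw [← hE.mom_neg, neg_ins, neg_neg]
    simp only [gno, e]
    exact (lintegral_neg_eq_self fun u =>
      ENNReal.ofReal (mom p W 0 (ins i 1 u)) ^ (-(((m + 1 : ℕ) : ℝ) / p))).symm
  have := hW.zint_le_steiner hp i (a := 0) (c := 0)
  rw [← e0] at this
  exact this h1 h2 h3

end IsEven

/-- A quantitative bathtub principle for the second moment of a set of reals. -/
theorem setIntegral_sub_le_of_sq {E : Set ℝ} {ρ r K ε : ℝ} {f : ℝ → ℝ} (hE : MeasurableSet E)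
    (hEρ : E ⊆ Icc (-ρ) ρ) (hr : 2 * r = volume.real E) (hf : Continuous f)
    (hK : ∀ s ∈ E ∪ Ioo (-r) r, |f s| ≤ K) (hK0 : 0 ≤ K) (hε : 0 < ε) :
    ε * (∫ s in E, f s) + K * (∫ s in Ioo (-r) r, s ^ 2) ≤
      ε * (∫ s in Ioo (-r) r, f s) + K * (∫ s in E, s ^ 2) + K * ε * (4 * √ε) := by
  have hr0 : 0 ≤ r := by have : 0 ≤ volume.real E := measureReal_nonneg
                         linarith
  have hsq : 0 < √ε := Real.sqrt_pos.2 hε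
  have h_int : ∀ {g : ℝ → ℝ} {S : Set ℝ} {a b : ℝ}, Continuous g → S ⊆ Icc a b →
      MeasurableSet S → Integrable (S.indicator g) := fun hg hS hm =>
    (integrable_indicator_iff hm).2 ((hg.integrableOn_Icc).mono_set hS)
  have hfE := h_int hf hEρ hE
  have hfI := h_int hf Ioo_subset_Icc_self (measurableSet_Ioo (a := -r) (b := r))
  have hqE := h_int (continuous_pow 2) hEρ hE
  have hqI := h_int (continuous_pow 2) Ioo_subset_Icc_self (measurableSet_Ioo (a := -r) (b := r))
  have h1E := h_int (continuous_const (y := (1 : ℝ))) hEρ hE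
  have h1I := h_int (continuous_const (y := (1 : ℝ))) Ioo_subset_Icc_self
    (measurableSet_Ioo (a := -r) (b := r))
  have h1B : ∀ a b : ℝ, Integrable ((Ioo a b).indicator fun _ : ℝ => (1 : ℝ)) := fun a b =>
    h_int continuous_const Ioo_subset_Icc_self measurableSet_Ioo
  have hpt : ∀ s, ε * E.indicator f s + K * (Ioo (-r) r).indicator (fun s => s ^ 2) s ≤
      ε * (Ioo (-r) r).indicator f s + K * E.indicator (fun s => s ^ 2) s +
      K * r ^ 2 * ((Ioo (-r) r).indicator (fun _ => 1) s - E.indicator (fun _ => 1) s) +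
      K * ε * ((Ioo (r - √ε) (r + √ε)).indicator (fun _ => 1) s +
        (Ioo (-r - √ε) (-r + √ε)).indicator (fun _ => 1) s) := by
    intro s
    set B := (Ioo (r - √ε) (r + √ε)).indicator (fun _ => (1 : ℝ)) s +
        (Ioo (-r - √ε) (-r + √ε)).indicator (fun _ => (1 : ℝ)) s with hB
    have hB0 : 0 ≤ B := add_nonneg (indicator_nonneg (fun _ _ => zero_le_one) _)
      (indicator_nonneg (fun _ _ => zero_le_one) _)
    have hB1 : ε ≤ |s ^ 2 - r ^ 2| + ε * B := by
      by_cases hs : |(|s| - r)| < √ε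
      · have : 1 ≤ B := by
          rw [abs_lt] at hs
          rcases le_total 0 s with h | h
          · rw [abs_of_nonneg h] at hs
            rw [hB, indicator_of_mem (s := Ioo (r - √ε) (r + √ε)) ⟨by linarith, by linarith⟩]
            linarith [indicator_nonneg (s := Ioo (-r - √ε) (-r + √ε))
              (fun _ _ => zero_le_one (α := ℝ)) s]
          · rw [abs_of_nonpos h] at hs
            rw [hB, indicator_of_mem (s := Ioo (-r - √ε) (-r + √ε)) ⟨by linarith, by linarith⟩]
            linarith [indicator_nonneg (s := Ioo (r - √ε) (r + √ε))
              (fun _ _ => zero_le_one (α := ℝ)) s]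
        nlinarith [abs_nonneg (s ^ 2 - r ^ 2)]
      · have h1 : |s ^ 2 - r ^ 2| = |(|s| - r)| * (|s| + r) := by
          rw [← sq_abs s, sq_sub_sq, abs_mul, abs_of_nonneg (by positivity : 0 ≤ |s| + r), mul_comm]
        have h2 : |(|s| - r)| ≤ |s| + r := abs_le.2 ⟨by linarith [abs_nonneg s], by linarith⟩
        have h3 : ε = √ε * √ε := (Real.mul_self_sqrt hε.le).symm
        have h4 : √ε ≤ |(|s| - r)| := not_lt.1 hs
        have h5 : √ε * √ε ≤ |(|s| - r)| * (|s| + r) :=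
          mul_le_mul h4 (h4.trans h2) hsq.le (abs_nonneg _)
        nlinarith
    have hB2 : K * ε ≤ K * |s ^ 2 - r ^ 2| + K * ε * B := by nlinarith
    have hKB : 0 ≤ K * ε * B := by positivity
    by_cases hsE : s ∈ E <;> by_cases hsI : s ∈ Ioo (-r) r <;>
      simp only [indicator_of_mem, indicator_of_notMem, hsE, hsI, not_false_eq_true]
    · linarith
    · have h1 := (abs_le.1 (hK s (Or.inl hsE))).2
      have h2 : r ≤ |s| := by
        by_contra! h
        exact hsI ⟨by linarith [neg_abs_le s], (le_abs_self s).trans_lt h⟩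
      have h3 : r ^ 2 ≤ s ^ 2 := by rw [← sq_abs s]; exact pow_le_pow_left₀ hr0 h2 2
      rw [abs_of_nonneg (by linarith)] at hB2
      nlinarith
    · have h1 := (abs_le.1 (hK s (Or.inr hsI))).1
      have h3 : s ^ 2 ≤ r ^ 2 := by
        rw [← sq_abs s]; exact pow_le_pow_left₀ (abs_nonneg _) (abs_le.2 ⟨hsI.1.le, hsI.2.le⟩) 2
      rw [abs_of_nonpos (by linarith)] at hB2
      nlinarith
    · linarith
  have hI := integral_mono ((hfE.const_mul ε).add (hqI.const_mul K))
    ((((hfI.const_mul ε).add (hqE.const_mul K)).add ((h1I.sub h1E).const_mul (K * r ^ 2))).add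
      (((h1B (r - √ε) (r + √ε)).add (h1B (-r - √ε) (-r + √ε))).const_mul (K * ε))) hpt
  rw [integral_add' (hfE.const_mul ε) (hqI.const_mul K), integral_add'
    (((hfI.const_mul ε).add (hqE.const_mul K)).add ((h1I.sub h1E).const_mul (K * r ^ 2)))
      (((h1B (r - √ε) (r + √ε)).add (h1B (-r - √ε) (-r + √ε))).const_mul (K * ε)),
    integral_add' ((hfI.const_mul ε).add (hqE.const_mul K)) ((h1I.sub h1E).const_mul (K * r ^ 2)),
    integral_add' (hfI.const_mul ε) (hqE.const_mul K)] at hI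
  simp only [integral_const_mul] at hI
  rw [integral_sub' h1I h1E, integral_add' (h1B _ _) (h1B _ _)] at hI
  simp only [integral_indicator hE, integral_indicator measurableSet_Ioo, setIntegral_const,
    smul_eq_mul, mul_one] at hI
  rw [Real.volume_real_Ioo_of_le (by linarith), Real.volume_real_Ioo_of_le (by linarith),
    Real.volume_real_Ioo_of_le (by linarith)] at hI
  have e : r - -r = volume.real E := by linarith
  rw [e, sub_self] at hI
  nlinarith

/-- A cylinder of height one in the direction of the `i`-th coordinate. -/
def cyl (i : Fin (m + 1)) (R M : ℝ) : Set (Euc m × ℝ) :=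
  {w | w.1 i ∈ Icc (-1 / 2 : ℝ) (1 / 2) ∧ rest i w.1 ∈ Metric.closedBall 0 R ∧ w.2 ∈ Icc 0 M}

theorem measurableSet_cyl (i : Fin (m + 1)) (R M : ℝ) : MeasurableSet (cyl i R M) :=
  (measurableSet_Icc.preimage (by fun_prop : Measurable fun w : Euc m × ℝ => w.1 i)).inter
    ((Metric.isClosed_closedBall.measurableSet.preimage
      ((continuous_rest i).measurable.comp measurable_fst)).inter
      (measurableSet_Icc.preimage measurable_snd))

theorem volume_cyl_lt_top (i : Fin (m + 1)) (R M : ℝ) : volume (cyl i R M) < ∞ := by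
  rw [← (measurePreserving_fiberEquiv i).measure_preimage (measurableSet_cyl i R M).nullMeasurableSet]
  refine (measure_mono (t := Icc (-1 / 2 : ℝ) (1 / 2) ×ˢ
    (Metric.closedBall (0 : Fin m → ℝ) R ×ˢ Icc (0 : ℝ) M)) ?_).trans_lt
    (isCompact_Icc.prod ((isCompact_closedBall _ _).prod isCompact_Icc)).measure_lt_top
  rintro ⟨s, u, τ⟩ ⟨h1, h2, h3⟩
  change ins i s u i ∈ _ at h1
  change rest i (ins i s u) ∈ _ at h2
  rw [ins_self] at h1
  rw [rest_ins] at h2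
  exact ⟨h1, h2, h3⟩

theorem IsBody.fiber_deficit (hW : IsBody R M W) (i : Fin (m + 1)) (u : Fin m → ℝ) (τ : ℝ)
    {F : Euc m × ℝ → ℝ} {K ε : ℝ} (hF : Continuous F) (hK : ∀ w, ‖w.1‖ ≤ R → |F w| ≤ K)
    (hK0 : 0 ≤ K) (hε : 0 < ε) :
    ε * (∫ s in fib i W (u, τ), F (ins i s u, τ)) +
        K * (∫ s in fib i (AsymmetricBS.steiner i W) (u, τ), s ^ 2) ≤
      ε * (∫ s in fib i (AsymmetricBS.steiner i W) (u, τ), F (ins i s u, τ)) +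
        K * (∫ s in fib i W (u, τ), s ^ 2) +
        K * ε * (4 * √ε) * volume.real (fib i (cyl i R M) (u, τ)) := by
  rcases (fib i W (u, τ)).eq_empty_or_nonempty with he | ⟨s₀, hs₀⟩
  · rw [fib_steiner, he]
    simp only [measureReal_empty, zero_div, neg_zero, Ioo_self, setIntegral_empty, mul_zero,
      add_zero, zero_add]
    positivity
  · have hw₀ : (ins i s₀ u, τ) ∈ W := hs₀
    have hu' : ‖ins i s₀ u‖ ≤ R := hW.norm_le (ins i s₀ u, τ) hw₀
    have hu : ‖u‖ ≤ R := (norm_le_norm_ins i s₀ u).trans hu'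
    have hC1 : fib i (cyl i R M) (u, τ) = Icc (-1 / 2) (1 / 2) := by
      ext s
      have h0 := (hW.pos (ins i s₀ u, τ) hw₀).le
      have h1 := hW.le (ins i s₀ u, τ) hw₀
      simp only [fib, cyl, mem_ofPred_eq, ins_self, rest_ins, mem_closedBall_zero_iff]
      exact ⟨fun h => h.1, fun h => ⟨h, hu, h0, h1⟩⟩
    have h1 := fib_steiner i W (u, τ)
    have hIs : ∀ s ∈ fib i (AsymmetricBS.steiner i W) (u, τ), ‖ins i s u‖ ≤ R := fun s hs =>
      (hW.steiner i).norm_le (ins i s u, τ) hs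
    have hc : Continuous fun s => F (ins i s u, τ) :=
      hF.comp (((continuous_ins i).comp (continuous_id.prodMk continuous_const)).prodMk
        continuous_const)
    rw [hC1, Real.volume_real_Icc_of_le (by norm_num)]
    rw [h1] at hIs ⊢
    have h2 := setIntegral_sub_le_of_sq (K := K) (hW.measurableSet_fib i (u, τ))
      (hW.fib_subset i (u, τ)) (by ring) hc
      (fun s hs => hK _ (hs.elim (fun h => hW.norm_le (ins i s u, τ) h) (hIs s))) hK0 hε
    exact h2.trans_eq (by norm_num)

/-- If Steiner symmetrization changes the second moment only slightly, then it changes the integral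
of a bounded function only slightly. -/
theorem IsBody.steiner_deficit (hW : IsBody R M W) (i : Fin (m + 1)) {F : Euc m × ℝ → ℝ} {K ε : ℝ}
    (hF : Continuous F) (hK : ∀ w, ‖w.1‖ ≤ R → |F w| ≤ K) (hK0 : 0 ≤ K) (hε : 0 < ε) :
    ε * (∫ w in W, F w) + K * (∫ w in AsymmetricBS.steiner i W, ‖w.1‖ ^ 2) ≤
      ε * (∫ w in AsymmetricBS.steiner i W, F w) + K * (∫ w in W, ‖w.1‖ ^ 2) +
        K * ε * (4 * √ε) * volume.real (cyl i R M) := by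
  have hS := hW.steiner i
  have hq : Continuous fun w : Euc m × ℝ => w.1 i ^ 2 := by fun_prop
  have hq' : Continuous fun w : Euc m × ℝ => ‖w.1‖ ^ 2 - w.1 i ^ 2 := by fun_prop
  have hn : Continuous fun w : Euc m × ℝ => ‖w.1‖ ^ 2 := by fun_prop
  have e1 := hW.integral_steiner i hq' fun s u τ => by simp [norm_ins_sq]
  rw [integral_sub (hS.integrableOn hn) (hS.integrableOn hq),
    integral_sub (hW.integrableOn hn) (hW.integrableOn hq)] at e1
  suffices h : ε * (∫ w in W, F w) + K * (∫ w in AsymmetricBS.steiner i W, w.1 i ^ 2) ≤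
      ε * (∫ w in AsymmetricBS.steiner i W, F w) + K * (∫ w in W, w.1 i ^ 2) +
        K * ε * (4 * √ε) * volume.real (cyl i R M) by
    have e2 : K * (∫ w in AsymmetricBS.steiner i W, ‖w.1‖ ^ 2) -
        K * (∫ w in AsymmetricBS.steiner i W, w.1 i ^ 2) =
        K * (∫ w in W, ‖w.1‖ ^ 2) - K * (∫ w in W, w.1 i ^ 2) := by
      rw [← mul_sub, ← mul_sub, e1]
    linarith
  have hi : ∀ {V : Set (Euc m × ℝ)} {H : Euc m × ℝ → ℝ}, IsBody R M V → Continuous H →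
      Integrable (V.indicator H) := fun hV hH =>
    (integrable_indicator_iff hV.meas).2 (hV.integrableOn hH)
  have hC : Integrable ((cyl i R M).indicator fun _ : Euc m × ℝ => (1 : ℝ)) :=
    (integrable_indicator_iff (measurableSet_cyl i R M)).2
      (integrableOn_const (volume_cyl_lt_top i R M).ne)
  have iL := ((hi hW hF).const_mul ε).add ((hi hS hq).const_mul K)
  have iR' := ((hi hS hF).const_mul ε).add ((hi hW hq).const_mul K)
  have iR := iR'.add (hC.const_mul (K * ε * (4 * √ε)))
  have key : ∀ {V : Set (Euc m × ℝ)} {H : Euc m × ℝ → ℝ}, IsBody R M V → Continuous H → ∀ u τ,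
      Integrable ((fib i V (u, τ)).indicator fun s => H (ins i s u, τ)) ∧
      ∫ s, V.indicator H (ins i s u, τ) = ∫ s in fib i V (u, τ), H (ins i s u, τ) := by
    intro V H hV hH u τ
    refine ⟨(integrable_indicator_iff (hV.measurableSet_fib i _)).2 ((Continuous.integrableOn_Icc
      ?_).mono_set (hV.fib_subset i _)), ?_⟩
    · exact hH.comp (((continuous_ins i).comp (continuous_id.prodMk continuous_const)).prodMk
        continuous_const)
    · rw [← integral_indicator (hV.measurableSet_fib i _)]
      rfl
  have hmain := integral_le_of_fiber i iL iR fun u τ => ?_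
  · rw [integral_add' ((hi hW hF).const_mul ε) ((hi hS hq).const_mul K),
      integral_add' iR' (hC.const_mul (K * ε * (4 * √ε))),
      integral_add' ((hi hS hF).const_mul ε) ((hi hW hq).const_mul K)] at hmain
    simp only [integral_const_mul] at hmain
    rw [integral_indicator hW.meas, integral_indicator hS.meas, integral_indicator hW.meas,
      integral_indicator hS.meas, integral_indicator (measurableSet_cyl i R M), setIntegral_const,
      smul_eq_mul, mul_one] at hmain
    exact hmain
  · obtain ⟨j1, k1⟩ := key hW hF u τ
    obtain ⟨j2, k2⟩ := key hS hq u τ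
    obtain ⟨j3, k3⟩ := key hS hF u τ
    obtain ⟨j4, k4⟩ := key hW hq u τ
    have hfC : (fun s => (cyl i R M).indicator (fun _ => (1 : ℝ)) (ins i s u, τ)) =
        (fib i (cyl i R M) (u, τ)).indicator fun _ => 1 := rfl
    have hCsub : fib i (cyl i R M) (u, τ) ⊆ Icc (-1 / 2) (1 / 2) := fun s hs => by
      have : ins i s u i ∈ Icc (-1 / 2 : ℝ) (1 / 2) := hs.1
      rwa [ins_self] at this
    have hCm : MeasurableSet (fib i (cyl i R M) (u, τ)) :=
      (measurableSet_cyl i R M).preimage (((continuous_ins i).measurable.comp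
        (measurable_id.prodMk measurable_const)).prodMk measurable_const)
    have j5 : Integrable ((fib i (cyl i R M) (u, τ)).indicator fun _ => (1 : ℝ)) :=
      (integrable_indicator_iff hCm).2
        ((continuous_const.integrableOn_Icc).mono_set hCsub)
    have k5 : ∫ s, (cyl i R M).indicator (fun _ => (1 : ℝ)) (ins i s u, τ) =
        volume.real (fib i (cyl i R M) (u, τ)) := by
      rw [hfC, integral_indicator hCm, setIntegral_const, smul_eq_mul, mul_one]
    have hsum := integral_add (j1.const_mul ε) (j2.const_mul K)
    have hsum' := integral_add ((j3.const_mul ε).add (j4.const_mul K))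
      (j5.const_mul (K * ε * (4 * √ε)))
    have hsum'' := integral_add (j3.const_mul ε) (j4.const_mul K)
    have hgoal := hW.fiber_deficit i u τ hF hK hK0 hε
    simp only [ins_self] at k2 k4
    rw [← k1, ← k2, ← k3, ← k4, ← k5, ← integral_const_mul, ← integral_const_mul,
      ← integral_const_mul, ← integral_const_mul, ← integral_const_mul] at hgoal
    exact hsum.trans_le (hgoal.trans_eq ((congrArg (· + _) hsum''.symm).trans hsum'.symm))

theorem exists_isometry_ins {ξ ξ' : Euc m} (h : ‖ξ‖ = ‖ξ'‖) (hne : ξ ≠ ξ') :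
    ∃ (Q : Euc m ≃ₗᵢ[ℝ] Euc m) (s : ℝ) (u : Fin m → ℝ),
      Q (ins 0 s u) = ξ ∧ Q (ins 0 (-s) u) = ξ' := by
  set d := ‖ξ - ξ'‖ with hd
  have hd0 : d ≠ 0 := norm_ne_zero_iff.2 (sub_ne_zero.2 hne)
  have hn : ‖ins 0 d (0 : Fin m → ℝ)‖ = ‖ξ - ξ'‖ := by
    rw [← abs_norm, ← abs_norm (ξ - ξ'), ← sq_eq_sq_iff_abs_eq_abs, norm_ins_sq]
    simp [hd]
  set Q := (ℝ ∙ (ins 0 d (0 : Fin m → ℝ) - (ξ - ξ')))ᗮ.reflection with hQ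
  have hQd : Q (ins 0 d 0) = ξ - ξ' := Submodule.reflection_sub hn
  set a := Q.symm ξ with ha
  have hb : Q.symm ξ' = ins 0 (a 0 - d) (rest 0 a) := by
    have h1 : Q.symm ξ' = a + (-1 : ℝ) • ins 0 d 0 := by
      rw [← Q.symm_apply_apply (ins 0 d 0), hQd, map_sub]
      module
    rw [h1, smul_ins]
    conv_lhs => rw [← ins_rest 0 a]
    rw [ins_add_ins]
    congr 1
    · ring
    · simp
  have hab : ‖ins 0 (a 0 - d) (rest 0 a)‖ ^ 2 = ‖ins 0 (a 0) (rest 0 a)‖ ^ 2 := by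
    rw [← hb, ins_rest, ha, Q.symm.norm_map, Q.symm.norm_map, h]
  rw [norm_ins_sq, norm_ins_sq] at hab
  have h2 : a 0 - d = -a 0 := by
    have : d * (2 * a 0 - d) = 0 := by linarith
    rcases mul_eq_zero.1 this with h | h
    · exact absurd h hd0
    · linarith
  refine ⟨Q, a 0, rest 0 a, ?_, ?_⟩
  · rw [ins_rest, ha, Q.apply_symm_apply]
  · rw [← h2, ← hb, Q.apply_symm_apply]

theorem IsBody.mom_steiner_ins_neg (hW : IsBody R M W) (hp : 0 ≤ p) (i : Fin (m + 1)) (s : ℝ)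
    (u : Fin m → ℝ) :
    mom p (AsymmetricBS.steiner i W) 0 (ins i (-s) u) =
      mom p (AsymmetricBS.steiner i W) 0 (ins i s u) := by
  have e0 : (0 : Euc m) = ins i 0 0 := ext_ins i (by simp) (by simp)
  have key : ∀ t : ℝ, 0 < t → ∀ u, mom p (AsymmetricBS.steiner i W) 0 (ins i (-t) u) =
      mom p (AsymmetricBS.steiner i W) 0 (ins i t u) := fun t ht u => by
    have h1 : ins i (-t) u = t • ins i (-1) (t⁻¹ • u) := by
      rw [smul_ins, smul_smul, mul_inv_cancel₀ ht.ne', one_smul, mul_neg_one]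
    have h2 : ins i t u = t • ins i 1 (t⁻¹ • u) := by
      rw [smul_ins, smul_smul, mul_inv_cancel₀ ht.ne', one_smul, mul_one]
    rw [h1, h2, mom_smul _ _ _ _ ht.le, mom_smul _ _ _ _ ht.le, e0, hW.mom_steiner_neg hp]
  rcases lt_trichotomy s 0 with h | h | h
  · rw [← key (-s) (by linarith), neg_neg]
  · rw [h, neg_zero]
  · exact key s h u

/-- Some even body with the same invariants has a nearly rotation invariant moment function. -/
theorem exists_nearly_isotropic (hW : IsBody R M W) (hE : IsEven W)
    (hv : volume.real W ≠ 0) (hp : 1 ≤ p) {g : ℝ → ℝ} (hg : Continuous g) {δ : ℝ} (hδ : 0 < δ) :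
    ∃ V, IsBody R M V ∧ volume.real V = volume.real W ∧
      ∫ w in V, g w.2 = ∫ w in W, g w.2 ∧ zint (mom p W 0) ≤ zint (mom p V 0) ∧
      ∀ ξ ξ' : Euc m, ‖ξ‖ = 1 → ‖ξ'‖ = 1 → mom p V 0 ξ ≤ mom p V 0 ξ' + δ := by
  set S : Set (Set (Euc m × ℝ)) := {V | IsBody R M V ∧ IsEven V ∧ volume.real V = volume.real W ∧
      ∫ w in V, g w.2 = ∫ w in W, g w.2 ∧ zint (mom p W 0) ≤ zint (mom p V 0)} with hS
  have hg' : Continuous fun w : Euc m × ℝ => g w.2 := hg.comp continuous_snd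
  have hSrot : ∀ V ∈ S, ∀ Q, rot Q V ∈ S := by
    rintro V ⟨h1, h2, h3, h4, h5⟩ Q
    refine ⟨h1.rot Q, h2.rot Q, ?_, ?_, ?_⟩
    · rw [← h3, measureReal_def, measureReal_def]
      exact congrArg _ ((measurePreserving_rot Q).measure_preimage h1.meas.nullMeasurableSet)
    · rw [← h4, ← integral_rot Q V]
    · rwa [zint_rot]
  have hSst : ∀ V ∈ S, ∀ i, AsymmetricBS.steiner i V ∈ S := by
    rintro V ⟨h1, h2, h3, h4, h5⟩ i
    exact ⟨h1.steiner i, h2.steiner i, (h1.volume_real_steiner i).trans h3,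
      (h1.integral_steiner i hg' fun _ _ _ => rfl).trans h4,
      h5.trans (h2.zint_le_steiner h1 (h3 ▸ hv) hp i)⟩
  set J : Set (Euc m × ℝ) → ℝ := fun V => ∫ w in V, ‖w.1‖ ^ 2 with hJ
  have hJ0 : ∀ V, 0 ≤ J V := fun V => integral_nonneg fun w => by positivity
  set K := (max R 0) ^ p with hK
  have hK0 : 0 ≤ K := by positivity
  set C := volume.real (cyl (m := m) 0 R M) with hC
  have hC0 : 0 ≤ C := measureReal_nonneg
  set t := δ / (16 * (K * C + 1)) with ht
  have ht0 : 0 < t := by positivity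
  have htδ : 4 * K * t * C ≤ δ / 4 := by
    have : t * (16 * (K * C + 1)) = δ := div_mul_cancel₀ _ (by positivity)
    nlinarith
  set η := t ^ 2 * δ / (4 * (K + 1)) with hη
  have hη0 : 0 < η := by positivity
  have hηδ : K * η ≤ t ^ 2 * (δ / 4) := by
    have : η * (4 * (K + 1)) = t ^ 2 * δ := div_mul_cancel₀ _ (by positivity)
    nlinarith
  have hbdd : BddBelow (J '' S) := ⟨0, by rintro _ ⟨V, -, rfl⟩; exact hJ0 V⟩
  have hWS : W ∈ S := ⟨hW, hE, rfl, rfl, le_rfl⟩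
  obtain ⟨_, ⟨V, hV, rfl⟩, hVlt⟩ :=
    exists_lt_of_csInf_lt ⟨_, mem_image_of_mem J hWS⟩ (lt_add_of_pos_right (sInf (J '' S)) hη0)
  refine ⟨V, hV.1, hV.2.2.1, hV.2.2.2.1, hV.2.2.2.2, fun ξ ξ' hξ hξ' => ?_⟩
  by_cases hne : ξ = ξ'
  · rw [hne]; linarith
  obtain ⟨Q, s, u, rfl, rfl⟩ := exists_isometry_ins (hξ.trans hξ'.symm) hne
  rw [Q.norm_map] at hξ hξ'
  rw [← mom_rot, ← mom_rot]
  have hU := hSrot V hV Q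
  have hUV : J (rot Q V) = J V := by
    simp only [hJ]
    rw [← integral_rot Q V]
    simp
  set U := rot Q V with hUdef
  have hle : J V ≤ J (steiner 0 U) + η := by
    have := csInf_le hbdd (mem_image_of_mem J (hSst U hU 0))
    linarith
  have hF : ∀ y : Euc m, ‖y‖ = 1 → ∀ w : Euc m × ℝ, ‖w.1‖ ≤ R → |ppow p ⟪w.1 + 0, y⟫| ≤ K := by
    intro y hy w hw
    rw [abs_of_nonneg (ppow_nonneg _ _), ppow, add_zero]
    refine Real.rpow_le_rpow (le_max_right _ _) (max_le_max_right _ ?_) (by linarith)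
    have := real_inner_le_norm w.1 y
    rw [hy, mul_one] at this
    linarith
  have hcont : ∀ y : Euc m, Continuous fun w : Euc m × ℝ => ppow p ⟪w.1 + 0, y⟫ :=
    continuous_ppow_inner (by linarith) 0
  have hsqrt : √(t ^ 2) = t := Real.sqrt_sq ht0.le
  have d1 := hU.1.steiner_deficit 0 (hcont (ins 0 s u)) (hF _ hξ) hK0 (ε := t ^ 2) (by positivity)
  have d2 := hU.1.steiner_deficit 0 (F := fun w => -ppow p ⟪w.1 + 0, ins 0 (-s) u⟫)
    (hcont (ins 0 (-s) u)).neg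
    (fun w hw => (abs_neg _).trans_le (hF _ hξ' w hw)) hK0 (ε := t ^ 2) (by positivity)
  have hsym := hU.1.mom_steiner_ins_neg (p := p) (by linarith) 0 s u
  simp only [integral_neg] at d2
  change t ^ 2 * mom p U 0 (ins 0 s u) + K * J (steiner 0 U) ≤
    t ^ 2 * mom p (steiner 0 U) 0 (ins 0 s u) + K * J U + _ at d1
  change t ^ 2 * -mom p U 0 (ins 0 (-s) u) + K * J (steiner 0 U) ≤
    t ^ 2 * -mom p (steiner 0 U) 0 (ins 0 (-s) u) + K * J U + _ at d2
  rw [hsym] at d2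
  rw [hsqrt, hUV, ← hC] at d1 d2
  have h3 : K * J V ≤ K * J (steiner 0 U) + K * η := by nlinarith
  have h4 : K * t ^ 2 * (4 * t) * C ≤ t ^ 2 * (δ / 4) := by
    have := mul_le_mul_of_nonneg_left htδ (sq_nonneg t)
    linarith
  have ht2 : 0 < t ^ 2 := by positivity
  refine le_of_mul_le_mul_left ?_ ht2
  linarith

theorem lintegral_gaussian_rpow {q : ℝ} (hq : -1 < q) :
    ∫⁻ t in Ioi (0 : ℝ), ENNReal.ofReal (t ^ q * Real.exp (-t ^ 2)) =
      ENNReal.ofReal (Real.Gamma ((q + 1) / 2) / 2) := by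
  have h1 := integral_rpow_mul_exp_neg_rpow (p := 2) (q := q) (by norm_num) hq
  have h2 := integrableOn_rpow_mul_exp_neg_rpow (p := 2) (s := q) hq (by norm_num)
  simp only [Real.rpow_two] at h1 h2
  rw [← ofReal_integral_eq_lintegral_ofReal h2, h1]
  · congr 1; ring
  · filter_upwards [ae_restrict_mem measurableSet_Ioi] with t ht
    have : (0 : ℝ) < t := ht
    positivity

theorem lintegral_gaussian_pi (m : ℕ) :
    ∫⁻ u : Fin m → ℝ, ENNReal.ofReal (Real.exp (-(u ⬝ᵥ u))) = ENNReal.ofReal (√π ^ m) := by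
  have h1 := GaussianFourier.integral_rexp_neg_mul_sq_norm (V := EuclideanSpace ℝ (Fin m))
    (b := 1) one_pos
  have hmp := (EuclideanSpace.volume_preserving_symm_measurableEquiv_toLp (Fin m)).symm
  have h2 : ∀ u : Fin m → ℝ, ‖(WithLp.toLp 2 u : EuclideanSpace ℝ (Fin m))‖ ^ 2 = u ⬝ᵥ u :=
    fun u => by
      rw [EuclideanSpace.norm_sq_eq]
      simp [dotProduct, sq]
  have h_int : Integrable fun u : Fin m → ℝ => Real.exp (-(u ⬝ᵥ u)) := by
    have : (fun u : Fin m → ℝ => Real.exp (-(u ⬝ᵥ u))) =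
        fun u => ∏ k, Real.exp (-1 * u k ^ 2) := by
      ext u
      rw [← Real.exp_sum, dotProduct, ← Finset.sum_neg_distrib]
      congr 1
      exact Finset.sum_congr rfl fun k _ => by ring
    rw [this]
    exact Integrable.fintype_prod (f := fun _ (s : ℝ) => Real.exp (-1 * s ^ 2))
      fun _ => integrable_exp_neg_mul_sq one_pos
  rw [← ofReal_integral_eq_lintegral_ofReal h_int (ae_of_all _ fun _ => (Real.exp_pos _).le)]
  congr 1
  have h3 := hmp.integral_comp' (g := fun v : EuclideanSpace ℝ (Fin m) => Real.exp (-1 * ‖v‖ ^ 2))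
  rw [h1] at h3
  have h4 : ∫ u : Fin m → ℝ, Real.exp (-(u ⬝ᵥ u)) = (π / 1) ^ (Module.finrank ℝ (EuclideanSpace ℝ (Fin m)) / 2 : ℝ) := by
    rw [← h3]
    refine integral_congr_ae (ae_of_all _ fun u => ?_)
    simp only [neg_mul, one_mul]
    rw [← h2]; rfl
  rw [h4, div_one, finrank_euclideanSpace, Fintype.card_fin, Real.sqrt_eq_rpow, ← Real.rpow_natCast,
    ← Real.rpow_mul pi_pos.le]
  congr 1; ring

theorem lintegral_ppow_gaussian (hp : 0 < p) :
    ∫⁻ y : Euc m, ENNReal.ofReal (ppow p (y 0)) * ENNReal.ofReal (Real.exp (-‖y‖ ^ 2)) =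
      ENNReal.ofReal (Real.Gamma ((p + 1) / 2) / 2) * ENNReal.ofReal (√π ^ m) := by
  have hmp := measurePreserving_splitEquiv (m := m) 0
  rw [← hmp.lintegral_comp_emb (splitEquiv 0).measurableEmbedding]
  simp only [splitEquiv_apply, ins_self, norm_ins_sq]
  have h1 : ∀ q : ℝ × (Fin m → ℝ), ENNReal.ofReal (ppow p q.1) *
      ENNReal.ofReal (Real.exp (-(q.1 ^ 2 + q.2 ⬝ᵥ q.2))) =
      ENNReal.ofReal (ppow p q.1 * Real.exp (-q.1 ^ 2)) *
        ENNReal.ofReal (Real.exp (-(q.2 ⬝ᵥ q.2))) := fun q => by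
    rw [neg_add, Real.exp_add, ENNReal.ofReal_mul (Real.exp_pos _).le,
      ENNReal.ofReal_mul (ppow_nonneg _ _), mul_assoc]
  simp only [h1]
  have hc := continuous_ppow hp.le
  rw [Measure.volume_eq_prod, lintegral_prod_mul (f := fun s : ℝ => ENNReal.ofReal (ppow p s * Real.exp (-s ^ 2)))
    (g := fun u : Fin m → ℝ => ENNReal.ofReal (Real.exp (-(u ⬝ᵥ u)))) (by fun_prop)
    (by unfold dotProduct; fun_prop), lintegral_gaussian_pi]
  congr 1
  rw [← lintegral_gaussian_rpow (by linarith), ← lintegral_indicator measurableSet_Ioi]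
  refine lintegral_congr fun s => ?_
  by_cases hs : 0 < s
  · rw [indicator_of_mem (show s ∈ Ioi (0 : ℝ) from hs), ppow_of_nonneg hs.le]
  · rw [indicator_of_notMem (show s ∉ Ioi (0 : ℝ) from hs), ppow_of_nonpos hp (not_lt.1 hs)]
    simp

theorem lintegral_norm_gaussian (hp : 0 < p) :
    ∫⁻ y : Euc m, ENNReal.ofReal (‖y‖ ^ p) * ENNReal.ofReal (Real.exp (-‖y‖ ^ 2)) =
      ENNReal.ofReal (Real.Gamma (((m + 1 : ℕ) + p) / 2) / 2) *
        (volume : Measure (Euc m)).toSphere univ := by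
  have hc : Continuous fun y : Euc m => ‖y‖ ^ p :=
    continuous_norm.rpow_const fun _ => Or.inr hp.le
  rw [lintegral_polar (by fun_prop)]
  rw [← lintegral_const]
  refine lintegral_congr fun ξ => ?_
  have hm : (-1 : ℝ) < m + p := by have := m.cast_nonneg (α := ℝ); linarith
  have := lintegral_gaussian_rpow hm
  rw [show ((m + 1 : ℕ) + p : ℝ) = m + p + 1 by push_cast; ring, ← this]
  refine setLIntegral_congr_fun measurableSet_Ioi fun t ht => ?_
  have ht : (0 : ℝ) < t := ht
  have hξ : ‖(ξ : Euc m)‖ = 1 := norm_eq_of_mem_sphere ξ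
  simp only [norm_smul, hξ, mul_one, Real.norm_eq_abs, abs_of_pos ht]
  rw [← ENNReal.ofReal_mul (by positivity), ← ENNReal.ofReal_mul (by positivity),
    Real.rpow_add ht, Real.rpow_natCast, mul_assoc]

theorem lintegral_ppow_inner_gaussian (hp : 0 < p) (x : Euc m) :
    ∫⁻ y : Euc m, ENNReal.ofReal (ppow p ⟪x, y⟫) * ENNReal.ofReal (Real.exp (-‖y‖ ^ 2)) =
      ENNReal.ofReal (‖x‖ ^ p) *
        (ENNReal.ofReal (Real.Gamma ((p + 1) / 2) / 2) * ENNReal.ofReal (√π ^ m)) := by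
  have hn : ‖x‖ = ‖ins 0 ‖x‖ (0 : Fin m → ℝ)‖ := by
    rw [← abs_norm, ← abs_norm (ins _ _ _), ← sq_eq_sq_iff_abs_eq_abs, norm_ins_sq]
    simp
  set Q := (ℝ ∙ (x - ins 0 ‖x‖ (0 : Fin m → ℝ)))ᗮ.reflection with hQ
  have hQx : Q x = ins 0 ‖x‖ 0 := Submodule.reflection_sub hn
  have h1 : ∀ y, ppow p ⟪x, Q.symm y⟫ = ‖x‖ ^ p * ppow p (y 0) := fun y => by
    rw [← Q.inner_map_map, Q.apply_symm_apply, hQx, ← ppow_mul _ (norm_nonneg _)]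
    conv_lhs => rw [← ins_rest 0 y, inner_ins]
    simp
  rw [← (Q.symm.measurePreserving).lintegral_comp_emb
    Q.symm.toMeasurableEquiv.measurableEmbedding, ← lintegral_ppow_gaussian hp,
    ← lintegral_const_mul' _ _ ENNReal.ofReal_ne_top]
  refine lintegral_congr fun y => ?_
  rw [h1, Q.symm.norm_map, ENNReal.ofReal_mul (by positivity), mul_assoc]

/-- The ratio between the mean of `ppow p ⟪x, ·⟫` over the unit sphere and `‖x‖ ^ p`. -/
noncomputable def sphereMean (m : ℕ) (p : ℝ) : ℝ :=
  Real.Gamma ((p + 1) / 2) * √π ^ m /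
    (Real.Gamma (((m + 1 : ℕ) + p) / 2) * (volume : Measure (Euc m)).toSphere.real univ)

theorem toSphere_real_univ_pos (m : ℕ) : 0 < (volume : Measure (Euc m)).toSphere.real univ := by
  rw [Measure.toSphere_real_apply_univ, finrank_euclideanSpace, Fintype.card_fin]
  have := Metric.measure_ball_pos (volume : Measure (Euc m)) 0 one_pos
  have h2 : 0 < (volume : Measure (Euc m)).real (Metric.ball 0 1) :=
    ENNReal.toReal_pos this.ne' measure_ball_lt_top.ne
  positivity

theorem sphereMean_pos (hp : 0 < p) : 0 < sphereMean m p := by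
  have h1 := toSphere_real_univ_pos m
  have h2 : 0 < Real.Gamma ((p + 1) / 2) := Real.Gamma_pos_of_pos (by linarith)
  have h3 : 0 < Real.Gamma (((m + 1 : ℕ) + p) / 2) := Real.Gamma_pos_of_pos (by positivity)
  have := pi_pos
  unfold sphereMean
  positivity

theorem IsBody.sphereMean_mul_le (hW : IsBody R M W) (hp : 0 < p) {a : ℝ}
    (h : ∀ ξ, ‖ξ‖ = 1 → mom p W 0 ξ ≤ a) :
    sphereMean m p * ∫ w in W, ‖w.1‖ ^ p ≤ a := by
  have hcn : Continuous fun y : Euc m => ‖y‖ ^ p :=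
    continuous_norm.rpow_const fun _ => Or.inr hp.le
  have hcp := continuous_ppow hp.le
  have ha : 0 ≤ a := (mom_nonneg _ _ _ _).trans (h (ins 0 1 0) (by
    rw [← abs_norm, ← abs_one, ← sq_eq_sq_iff_abs_eq_abs, norm_ins_sq]; simp))
  have hle : ∀ y : Euc m, mom p W 0 y ≤ ‖y‖ ^ p * a := fun y => by
    by_cases hy : y = 0
    · subst hy
      simp [mom, ppow, hp.ne']
    · have hy' : ‖y‖ ≠ 0 := norm_ne_zero_iff.2 hy
      have : y = ‖y‖ • (‖y‖⁻¹ • y) := by rw [smul_smul, mul_inv_cancel₀ hy', one_smul]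
      conv_lhs => rw [this, mom_smul _ _ _ _ (norm_nonneg _)]
      refine mul_le_mul_of_nonneg_left (h _ ?_) (by positivity)
      rw [norm_smul, norm_inv, norm_norm, inv_mul_cancel₀ hy']
  have hT : ENNReal.ofReal (∫ w in W, ‖w.1‖ ^ p) = ∫⁻ w in W, ENNReal.ofReal (‖w.1‖ ^ p) :=
    ofReal_integral_eq_lintegral_ofReal (hW.integrableOn (hcn.comp continuous_fst))
      (ae_of_all _ fun w => by positivity)
  have hM : ∀ y, ENNReal.ofReal (mom p W 0 y) = ∫⁻ w in W, ENNReal.ofReal (ppow p ⟪w.1, y⟫) :=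
    fun y => by
      rw [mom]
      simp only [add_zero]
      exact ofReal_integral_eq_lintegral_ofReal (hW.integrableOn (by fun_prop))
        (ae_of_all _ fun w => ppow_nonneg _ _)
  have hmain : ENNReal.ofReal (∫ w in W, ‖w.1‖ ^ p) *
      (ENNReal.ofReal (Real.Gamma ((p + 1) / 2) / 2) * ENNReal.ofReal (√π ^ m)) ≤
      ENNReal.ofReal a * (ENNReal.ofReal (Real.Gamma (((m + 1 : ℕ) + p) / 2) / 2) *
        (volume : Measure (Euc m)).toSphere univ) := by
    rw [hT, ← lintegral_mul_const _ (by fun_prop), ← lintegral_norm_gaussian hp,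
      ← lintegral_const_mul' _ _ ENNReal.ofReal_ne_top]
    simp only [← lintegral_ppow_inner_gaussian hp]
    rw [lintegral_lintegral_swap (by fun_prop)]
    refine lintegral_mono fun y => ?_
    rw [lintegral_mul_const _ (by fun_prop), ← hM, ← mul_assoc, mul_comm (ENNReal.ofReal a),
      ← ENNReal.ofReal_mul (p := ‖y‖ ^ p) (by positivity)]
    gcongr
    exact hle y
  have hS : (volume : Measure (Euc m)).toSphere univ =
      ENNReal.ofReal ((volume : Measure (Euc m)).toSphere.real univ) := by
    rw [Measure.real, ENNReal.ofReal_toReal (measure_ne_top _ _)]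
  have hTn : 0 ≤ ∫ w in W, ‖w.1‖ ^ p := integral_nonneg fun w => by positivity
  have h1 := toSphere_real_univ_pos m
  have h2 : 0 < Real.Gamma ((p + 1) / 2) := Real.Gamma_pos_of_pos (by linarith)
  have h3 : 0 < Real.Gamma (((m + 1 : ℕ) + p) / 2) := Real.Gamma_pos_of_pos (by positivity)
  rw [hS, ← ENNReal.ofReal_mul (by positivity), ← ENNReal.ofReal_mul (by positivity),
    ← ENNReal.ofReal_mul (by positivity), ← ENNReal.ofReal_mul (by positivity),
    ENNReal.ofReal_le_ofReal_iff (by positivity)] at hmain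
  unfold sphereMean
  rw [div_mul_eq_mul_div, div_le_iff₀ (by positivity)]
  linarith

open ProbabilityTheory in
theorem integral_rpow_mul_ppow_one_sub {a q : ℝ} (ha : 0 < a) (hq : 0 < q) :
    ∫ y in Ioi (0 : ℝ), y ^ (a - 1) * ppow q (1 - y) = beta a (q + 1) := by
  have hB := beta_pos ha (show 0 < q + 1 by linarith)
  have hn : ∀ x, 0 ≤ betaPDFReal a (q + 1) x := fun x => by
    by_cases hx : 0 < x ∧ x < 1
    · exact (betaPDFReal_pos hx.1 hx.2 ha (by linarith)).le
    · rw [betaPDFReal, if_neg hx]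
  have h1 : ∫ x, betaPDFReal a (q + 1) x = 1 := by
    rw [integral_eq_lintegral_of_nonneg_ae (ae_of_all _ hn)
      (measurable_betaPDFReal _ _).aestronglyMeasurable]
    have := lintegral_betaPDF_eq_one ha (show 0 < q + 1 by linarith)
    simp only [betaPDF] at this
    rw [this, ENNReal.toReal_one]
  have h2 : ∫ x, betaPDFReal a (q + 1) x = ∫ x in Ioi (0 : ℝ), betaPDFReal a (q + 1) x := by
    refine (setIntegral_eq_integral_of_forall_compl_eq_zero fun x hx => ?_).symm
    rw [betaPDFReal, if_neg fun h => hx h.1]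
  rw [h2] at h1
  suffices h : ∫ y in Ioi (0 : ℝ), y ^ (a - 1) * ppow q (1 - y) =
      ∫ y in Ioi (0 : ℝ), beta a (q + 1) * betaPDFReal a (q + 1) y by
    rw [h, integral_const_mul, h1, mul_one]
  refine setIntegral_congr_fun measurableSet_Ioi fun y hy => ?_
  have hy : (0 : ℝ) < y := hy
  by_cases hy1 : y < 1
  · simp only [betaPDFReal, if_pos (And.intro hy hy1), ppow_of_nonneg (sub_nonneg.2 hy1.le),
      add_sub_cancel_right]
    field_simp
  · simp only [betaPDFReal, if_neg fun h : 0 < y ∧ y < 1 => hy1 h.2,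
      ppow_of_nonpos hq (sub_nonpos.2 (not_lt.1 hy1)), mul_zero]

open ProbabilityTheory in
theorem lintegral_rpow_mul_ppow {k P q a : ℝ} (hk : -1 < k) (hP : 0 < P) (hq : 0 < q)
    (ha : 0 < a) :
    ∫⁻ t in Ioi (0 : ℝ), ENNReal.ofReal (t ^ k * ppow q (1 - a * t ^ P)) =
      ENNReal.ofReal (a ^ (-((k + 1) / P)) * (beta ((k + 1) / P) (q + 1) / P)) := by
  set x := (k + 1) / P with hx
  have hx0 : 0 < x := div_pos (by linarith) hP
  have hB := beta_pos hx0 (show 0 < q + 1 by linarith)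
  have h1 := integral_comp_rpow_Ioi_of_pos (g := fun y => (a * y) ^ (x - 1) * ppow q (1 - a * y)) hP
  have h2 := integral_comp_mul_left_Ioi (fun y => y ^ (x - 1) * ppow q (1 - y)) 0 ha
  rw [mul_zero, integral_rpow_mul_ppow_one_sub hx0 hq] at h2
  rw [h2] at h1
  have h3 : ∫ t in Ioi (0 : ℝ), t ^ k * ppow q (1 - a * t ^ P) =
      a ^ (-x) * (beta x (q + 1) / P) := by
    have h4 : ∫ t in Ioi (0 : ℝ), (P * t ^ (P - 1)) • ((a * t ^ P) ^ (x - 1) *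
        ppow q (1 - a * t ^ P)) = P * a ^ (x - 1) *
          ∫ t in Ioi (0 : ℝ), t ^ k * ppow q (1 - a * t ^ P) := by
      rw [← integral_const_mul]
      refine setIntegral_congr_fun measurableSet_Ioi fun t ht => ?_
      have ht : (0 : ℝ) < t := ht
      have h5 : t ^ k = t ^ (P - 1) * t ^ (P * (x - 1)) := by
        rw [← Real.rpow_add ht]
        congr 1
        rw [hx]; field_simp; ring
      simp only [smul_eq_mul]
      rw [Real.mul_rpow ha.le (by positivity), ← Real.rpow_mul ht.le, h5]
      ring
    rw [h4, smul_eq_mul] at h1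
    have h6 : a ^ (x - 1) = a ^ x * a⁻¹ := by
      rw [Real.rpow_sub ha, Real.rpow_one, div_eq_mul_inv]
    rw [h6] at h1
    rw [Real.rpow_neg ha.le]
    have : 0 < a ^ x := by positivity
    field_simp at h1 ⊢
    linarith
  have hI : IntegrableOn (fun t => t ^ k * ppow q (1 - a * t ^ P)) (Ioi 0) := by
    apply Integrable.of_integral_ne_zero
    rw [h3]
    positivity
  rw [← h3, ofReal_integral_eq_lintegral_ofReal hI]
  filter_upwards [ae_restrict_mem measurableSet_Ioi] with t ht
  have ht : (0 : ℝ) < t := ht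
  have := ppow_nonneg q (1 - a * t ^ P)
  positivity

open ProbabilityTheory in
theorem beta_one_div_two {r : ℝ} (hr : 0 < r) : beta (1 / r) (1 + 1) / r = 1 / (1 + 1 / r) := by
  have h1 : 0 < 1 / r := by positivity
  have h0 := (Real.Gamma_pos_of_pos h1).ne'
  rw [beta, ← add_assoc, Real.Gamma_add_one (s := 1 / r + 1) (by positivity),
    Real.Gamma_add_one h1.ne', one_add_one_eq_two, Real.Gamma_two]
  field_simp
  ring

/-- The volume of the extremal body for the moment inequality. -/
noncomputable def momentConst (m : ℕ) (p s : ℝ) : ℝ :=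
  (volume : Measure (Euc m)).toSphere.real univ *
    (ProbabilityTheory.beta ((m + 1 : ℕ) / p) (s + 2) / (p * (1 + s)))

theorem momentConst_pos (hp : 0 < p) {s : ℝ} (hs : 0 < s) : 0 < momentConst m p s := by
  have h1 := toSphere_real_univ_pos m
  have h2 := ProbabilityTheory.beta_pos (show 0 < ((m + 1 : ℕ) : ℝ) / p by positivity)
    (show 0 < s + 2 by linarith)
  unfold momentConst
  positivity

theorem lintegral_extremal (hp : 0 < p) {r α β : ℝ} (hr : 0 < r) (hα : 0 < α) (hβ : 0 < β) :
    ∫⁻ x : Euc m, ∫⁻ τ in Ioi (0 : ℝ), ENNReal.ofReal (1 - α * ‖x‖ ^ p - β * τ ^ r) =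
      ENNReal.ofReal (α ^ (-((m + 1 : ℕ) / p)) * β ^ (-(1 / r)) * momentConst m p (1 / r)) := by
  have hcn : Continuous fun y : Euc m => ‖y‖ ^ p :=
    continuous_norm.rpow_const fun _ => Or.inr hp.le
  have hr' : 0 < 1 + 1 / r := by positivity
  have hcp : Continuous (ppow (1 + 1 / r)) := continuous_ppow hr'.le
  have h1 : ∀ u : ℝ, ∫⁻ τ in Ioi (0 : ℝ), ENNReal.ofReal (u - β * τ ^ r) =
      ENNReal.ofReal (β ^ (-(1 / r)) / (1 + 1 / r)) * ENNReal.ofReal (ppow (1 + 1 / r) u) := by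
    intro u
    rcases le_or_gt u 0 with hu | hu
    · rw [ppow_of_nonpos hr' hu, ENNReal.ofReal_zero, mul_zero]
      refine setLIntegral_eq_zero measurableSet_Ioi fun τ hτ => ?_
      have hτ : (0 : ℝ) < τ := hτ
      have : 0 < β * τ ^ r := by positivity
      exact ENNReal.ofReal_of_nonpos (by linarith)
    · have h2 : ∀ τ : ℝ, ENNReal.ofReal (u - β * τ ^ r) = ENNReal.ofReal u *
          ENNReal.ofReal (τ ^ (0 : ℝ) * ppow 1 (1 - β / u * τ ^ r)) := fun τ => by
        rw [Real.rpow_zero, one_mul, ← ENNReal.ofReal_mul hu.le, ppow, Real.rpow_one,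
          mul_max_of_nonneg _ _ hu.le, mul_zero]
        rw [show u * (1 - β / u * τ ^ r) = u - β * τ ^ r by field_simp]
        rcases le_total (u - β * τ ^ r) 0 with h | h
        · rw [max_eq_right h, ENNReal.ofReal_zero, ENNReal.ofReal_of_nonpos h]
        · rw [max_eq_left h]
      simp only [h2]
      rw [lintegral_const_mul' _ _ ENNReal.ofReal_ne_top, 
        lintegral_rpow_mul_ppow (k := 0) (by norm_num) hr one_pos (div_pos hβ hu), zero_add,
        beta_one_div_two hr,
        ppow_of_nonneg hu.le, ← ENNReal.ofReal_mul hu.le, ← ENNReal.ofReal_mul (by positivity)]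
      congr 1
      rw [Real.div_rpow hβ.le hu.le, Real.rpow_neg hu.le, Real.rpow_add hu, Real.rpow_one]
      field_simp
  simp only [h1]
  rw [lintegral_const_mul' _ _ ENNReal.ofReal_ne_top, lintegral_polar (by fun_prop)]
  have h3 : ∀ ξ : Metric.sphere (0 : Euc m) 1, ∫⁻ t in Ioi (0 : ℝ), ENNReal.ofReal (t ^ m) *
      ENNReal.ofReal (ppow (1 + 1 / r) (1 - α * ‖t • (ξ : Euc m)‖ ^ p)) =
      ENNReal.ofReal (α ^ (-((m + 1 : ℕ) / p)) *
        (ProbabilityTheory.beta ((m + 1 : ℕ) / p) (1 / r + 2) / p)) := fun ξ => by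
    have hm : (-1 : ℝ) < (m : ℝ) := by have := m.cast_nonneg (α := ℝ); linarith
    have h := lintegral_rpow_mul_ppow hm hp hr' hα
    rw [show (1 + 1 / r + 1) = 1 / r + 2 by ring] at h
    push_cast
    rw [← h]
    refine setLIntegral_congr_fun measurableSet_Ioi fun t ht => ?_
    have ht : (0 : ℝ) < t := ht
    have hξ : ‖(ξ : Euc m)‖ = 1 := norm_eq_of_mem_sphere ξ
    simp only [norm_smul, hξ, mul_one, Real.norm_eq_abs, abs_of_pos ht]
    rw [← ENNReal.ofReal_mul (by positivity), Real.rpow_natCast]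
  simp only [h3]
  have h4 := toSphere_real_univ_pos m
  have h5 := ProbabilityTheory.beta_pos (show 0 < ((m + 1 : ℕ) : ℝ) / p by positivity)
    (show 0 < 1 / r + 2 by positivity)
  rw [lintegral_const, ← ENNReal.ofReal_toReal (measure_ne_top (volume : Measure (Euc m)).toSphere univ),
    ← ENNReal.ofReal_mul (by positivity), ← ENNReal.ofReal_mul (by positivity)]
  congr 1
  unfold momentConst
  rw [Measure.real]
  field_simp

theorem IsBody.volume_le_moments (hW : IsBody R M W) (hp : 0 < p) {r α β : ℝ} (hr : 0 < r)
    (hα : 0 < α) (hβ : 0 < β) :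
    volume.real W ≤ α * (∫ w in W, ‖w.1‖ ^ p) + β * (∫ w in W, w.2 ^ r) +
      α ^ (-((m + 1 : ℕ) / p : ℝ)) * β ^ (-(1 / r)) * momentConst m p (1 / r) := by
  have hcn : Continuous fun w : Euc m × ℝ => ‖w.1‖ ^ p :=
    continuous_fst.norm.rpow_const fun _ => Or.inr hp.le
  have hcr : Continuous fun w : Euc m × ℝ => w.2 ^ r :=
    continuous_snd.rpow_const fun _ => Or.inr hr.le
  have hK := momentConst_pos (m := m) hp (show 0 < 1 / r by positivity)
  have hc : Continuous fun w : Euc m × ℝ => α * ‖w.1‖ ^ p + β * w.2 ^ r := by fun_prop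
  have hnn : ∀ᵐ w ∂(volume.restrict W), 0 ≤ α * ‖w.1‖ ^ p + β * w.2 ^ r := by
    filter_upwards [ae_restrict_mem hW.meas] with w hw
    have := hW.pos w hw
    positivity
  have h1 : volume W ≤ ENNReal.ofReal (∫ w in W, (α * ‖w.1‖ ^ p + β * w.2 ^ r)) +
      ∫⁻ x : Euc m, ∫⁻ τ in Ioi (0 : ℝ), ENNReal.ofReal (1 - α * ‖x‖ ^ p - β * τ ^ r) := by
    have hprod : ∫⁻ x : Euc m, ∫⁻ τ in Ioi (0 : ℝ), ENNReal.ofReal (1 - α * ‖x‖ ^ p - β * τ ^ r) =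
        ∫⁻ w in univ ×ˢ Ioi (0 : ℝ), ENNReal.ofReal (1 - α * ‖w.1‖ ^ p - β * w.2 ^ r)
          ∂((volume : Measure (Euc m)).prod (volume : Measure ℝ)) := by
      rw [← Measure.prod_restrict, Measure.restrict_univ, lintegral_prod _ (by fun_prop)]
    rw [hprod, ofReal_integral_eq_lintegral_ofReal (hW.integrableOn hc) hnn]
    have hsub : W ⊆ univ ×ˢ Ioi (0 : ℝ) := fun w hw => ⟨trivial, hW.pos w hw⟩
    refine le_trans ?_ (add_le_add le_rfl (lintegral_mono_set hsub))
    rw [← Measure.volume_eq_prod, ← lintegral_add_left (by fun_prop), ← setLIntegral_one]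
    refine lintegral_mono fun w => ?_
    refine le_trans ?_ ENNReal.ofReal_add_le
    rw [← ENNReal.ofReal_one]
    exact ENNReal.ofReal_le_ofReal (by linarith)
  rw [lintegral_extremal hp hr hα hβ, integral_add ((hW.integrableOn hcn).const_mul _)
    ((hW.integrableOn hcr).const_mul _), integral_const_mul, integral_const_mul] at h1
  have hT : 0 ≤ ∫ w in W, ‖w.1‖ ^ p := integral_nonneg fun w => by positivity
  have hN : 0 ≤ ∫ w in W, w.2 ^ r := by
    refine setIntegral_nonneg hW.meas fun w hw => ?_
    have := hW.pos w hw
    positivity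
  rw [← ENNReal.ofReal_add (by positivity) (by positivity)] at h1
  exact ENNReal.toReal_le_of_le_ofReal (by positivity) h1

/-- The sharp lower bound for the moment of a body in terms of its volume and its height moment. -/
noncomputable def momentBound (m : ℕ) (p s v N : ℝ) : ℝ :=
  (m + 1 : ℕ) / p * (v / ((m + 1 : ℕ) / p + s + 1)) *
    ((v / ((m + 1 : ℕ) / p + s + 1)) * (s * (v / ((m + 1 : ℕ) / p + s + 1)) / N) ^ s /
      momentConst m p s) ^ (p / (m + 1 : ℕ))

theorem momentBound_pos (hp : 0 < p) {s v N : ℝ} (hs : 0 < s) (hv : 0 < v) (hN : 0 < N) :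
    0 < momentBound m p s v N := by
  have := momentConst_pos (m := m) hp hs
  unfold momentBound
  positivity

theorem IsBody.momentBound_le (hW : IsBody R M W) (hp : 0 < p) {r : ℝ} (hr : 0 < r)
    (hv : 0 < volume.real W) (hN : 0 < ∫ w in W, w.2 ^ r) :
    momentBound m p (1 / r) (volume.real W) (∫ w in W, w.2 ^ r) ≤ ∫ w in W, ‖w.1‖ ^ p := by
  set s := 1 / r with hs
  have hs0 : 0 < s := by positivity
  have hK := momentConst_pos (m := m) hp hs0
  unfold momentBound
  set v := volume.real W with hvd
  set N := ∫ w in W, w.2 ^ r with hNd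
  set T := ∫ w in W, ‖w.1‖ ^ p with hTd
  set ν : ℝ := ((m + 1 : ℕ) : ℝ) with hν
  have hν0 : 0 < ν := by positivity
  set X := v / (ν / p + s + 1) with hX
  have hX0 : 0 < X := by positivity
  set K := momentConst m p s with hKd
  set Y := X * (s * X / N) ^ s / K with hY
  have hY0 : 0 < Y := by positivity
  have hα : 0 < Y ^ (-(p / ν)) := by positivity
  have h := hW.volume_le_moments hp hr hα (show 0 < s * X / N by positivity)
  rw [← hvd, ← hNd, ← hTd, ← hν, ← hs, ← hKd, ← Real.rpow_mul hY0.le,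
    show -(p / ν) * -(ν / p) = 1 by field_simp, Real.rpow_one, Real.rpow_neg (by positivity)] at h
  have h1 : Y * ((s * X / N) ^ s)⁻¹ * K = X := by
    have : 0 < (s * X / N) ^ s := by positivity
    rw [hY]; field_simp
  have h2 : s * X / N * N = s * X := by field_simp
  have h3 : v = (ν / p + s + 1) * X := by
    rw [hX]; field_simp
  rw [Real.rpow_neg (show 0 ≤ s * X / N by positivity), h1, h2, inv_mul_eq_div] at h
  have h4 : ν / p * X ≤ T / Y ^ (p / ν) := by linarith
  rwa [le_div_iff₀ (by positivity)] at h4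

/-- The bound for the integral `zint` of a moment function bounded below by `a * ‖·‖ ^ p`. -/
noncomputable def zintBound (m : ℕ) (p a : ℝ) : ℝ≥0∞ :=
  ENNReal.ofReal (Real.Gamma ((m + 1 : ℕ) / p) / p) *
    (volume : Measure (Euc m)).toSphere univ * ENNReal.ofReal a ^ (-(((m + 1 : ℕ) : ℝ) / p))

theorem zint_le_zintBound (hp : 0 < p) {a : ℝ} (ha : 0 < a) {A : Euc m → ℝ}
    (h : ∀ y, a * ‖y‖ ^ p ≤ A y) : zint A ≤ zintBound m p a := by
  have hg : IsGauge p fun y : Euc m => a * ‖y‖ ^ p :=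
    { cont := continuous_const.mul (continuous_norm.rpow_const fun _ => Or.inr hp.le)
      nonneg := fun y => by positivity
      smul := fun y t ht => by
        rw [norm_smul, Real.norm_eq_abs, abs_of_nonneg ht, Real.mul_rpow ht (norm_nonneg _)]
        ring }
  have h1 : zint A ≤ zint fun y : Euc m => a * ‖y‖ ^ p :=
    lintegral_mono fun y => ENNReal.ofReal_le_ofReal (Real.exp_le_exp.2 (neg_le_neg (h y)))
  refine h1.trans (le_of_eq ?_)
  rw [hg.zint_eq hp fun y hy => by
    have := norm_pos_iff.2 hy
    positivity]
  have h2 : ∀ ξ : Metric.sphere (0 : Euc m) 1, a * ‖(ξ : Euc m)‖ ^ p = a := fun ξ => by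
    rw [norm_eq_of_mem_sphere ξ, Real.one_rpow, mul_one]
  simp only [h2]
  rw [lintegral_const, zintBound]
  ring

theorem IsEven.zint_mom_le (hE : IsEven W) (hW : IsBody R M W) (hp : 1 ≤ p) {r : ℝ} (hr : 0 < r)
    (hv : 0 < volume.real W) (hN : 0 < ∫ w in W, w.2 ^ r) :
    zint (mom p W 0) ≤ zintBound m p (sphereMean m p *
      momentBound m p (1 / r) (volume.real W) (∫ w in W, w.2 ^ r)) := by
  have hp0 : 0 < p := by linarith
  have hκ := sphereMean_pos (m := m) hp0
  have hm := momentBound_pos (m := m) hp0 (show 0 < 1 / r by positivity) hv hN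
  set K := sphereMean m p * momentBound m p (1 / r) (volume.real W) (∫ w in W, w.2 ^ r) with hK
  have hK0 : 0 < K := by positivity
  have key : ∀ δ, 0 < δ → δ < K → zint (mom p W 0) ≤ zintBound m p (K - δ) := by
    intro δ hδ hδK
    obtain ⟨V, hV, hVv, hVN, hz, hiso⟩ := exists_nearly_isotropic (g := fun τ => τ ^ r) hW hE hv.ne'
      hp (Real.continuous_rpow_const hr.le) hδ
    refine hz.trans (zint_le_zintBound hp0 (sub_pos.2 hδK) fun y => ?_)
    have h1 : ∀ ξ, ‖ξ‖ = 1 → K - δ ≤ mom p V 0 ξ := fun ξ hξ => by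
      have h2 := hV.sphereMean_mul_le hp0 (a := mom p V 0 ξ + δ) fun ξ' hξ' => hiso ξ' ξ hξ' hξ
      have h3 := hV.momentBound_le hp0 hr (hVv.symm ▸ hv) (hVN.symm ▸ hN)
      rw [hVv, hVN] at h3
      have := mul_le_mul_of_nonneg_left h3 hκ.le
      linarith
    by_cases hy : y = 0
    · subst hy
      rw [norm_zero, Real.zero_rpow hp0.ne', mul_zero]
      exact mom_nonneg _ _ _ _
    · have hy' : ‖y‖ ≠ 0 := norm_ne_zero_iff.2 hy
      have h4 : y = ‖y‖ • (‖y‖⁻¹ • y) := by rw [smul_smul, mul_inv_cancel₀ hy', one_smul]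
      conv_rhs => rw [h4, mom_smul _ _ _ _ (norm_nonneg _)]
      rw [mul_comm]
      refine mul_le_mul_of_nonneg_left (h1 _ ?_) (by positivity)
      rw [norm_smul, norm_inv, norm_norm, inv_mul_cancel₀ hy']
  have hlim : Tendsto (fun δ => zintBound m p (K - δ)) (𝓝[>] 0) (𝓝 (zintBound m p K)) := by
    refine Tendsto.mono_left ?_ nhdsWithin_le_nhds
    have hc : Continuous fun δ : ℝ => ENNReal.ofReal (K - δ) ^ (-(((m + 1 : ℕ) : ℝ) / p)) :=
      ENNReal.continuous_rpow_const.comp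
        (ENNReal.continuous_ofReal.comp (continuous_const.sub continuous_id))
    have := ENNReal.Tendsto.const_mul (a := ENNReal.ofReal (Real.Gamma ((m + 1 : ℕ) / p) / p) *
      (volume : Measure (Euc m)).toSphere univ) (hc.tendsto 0)
      (Or.inr (ENNReal.mul_ne_top ENNReal.ofReal_ne_top (measure_ne_top _ _)))
    simpa only [zintBound, sub_zero] using this
  refine ge_of_tendsto hlim ?_
  filter_upwards [Ioo_mem_nhdsGT hK0] with δ hδ using key δ hδ.1 hδ.2

/-- Symmetry of a set under the reflection of the `j`-th coordinate. -/
def CoordSymm (j : Fin (m + 1)) (W : Set (Euc m × ℝ)) : Prop :=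
  ∀ x x' : Euc m, ∀ τ, (∀ k, k ≠ j → x' k = x k) → x' j = -x j → (x, τ) ∈ W → (x', τ) ∈ W

theorem isEven_of_coordSymm (h : ∀ j, CoordSymm j W) : IsEven W := by
  intro x τ hx
  have key : ∀ S : Finset (Fin (m + 1)),
      ((WithLp.toLp 2 fun k => if k ∈ S then -x k else x k : Euc m), τ) ∈ W := by
    intro S
    induction S using Finset.induction_on with
    | empty => simpa using hx
    | insert j S hj ih =>
      refine h j _ _ τ (fun k hk => ?_) ?_ ih
      · simp [hk]
      · simp [hj]
  have := key Finset.univ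
  have e : (WithLp.toLp 2 fun k => if k ∈ Finset.univ then -x k else x k : Euc m) = -x := by
    ext k; simp
  rwa [e] at this

theorem CoordSymm.fib_eq {i j : Fin (m + 1)} (h : CoordSymm j W) (hij : i ≠ j) {x x' : Euc m}
    (τ : ℝ) (h1 : ∀ k, k ≠ j → x' k = x k) (h2 : x' j = -x j) :
    fib i W (rest i x', τ) = fib i W (rest i x, τ) := by
  have hne : ∀ s, ∀ k, k ≠ j → ins i s (rest i x') k = ins i s (rest i x) k := fun s k hk => by
    rcases i.eq_self_or_eq_succAbove k with rfl | ⟨l, rfl⟩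
    · simp
    · simp [rest, h1 _ hk]
  have hj : ∀ s, ins i s (rest i x') j = -ins i s (rest i x) j := fun s => by
    obtain ⟨l, rfl⟩ := Fin.exists_succAbove_eq hij.symm
    simp [rest, h2]
  ext s
  exact ⟨h _ _ τ (fun k hk => (hne s k hk).symm) (by rw [hj, neg_neg]), h _ _ τ (hne s) (hj s)⟩

theorem CoordSymm.steiner_of_ne {i j : Fin (m + 1)} (h : CoordSymm j W) (hij : i ≠ j) :
    CoordSymm j (steiner i W) := by
  intro x x' τ h1 h2 hx
  simp only [steiner, mem_ofPred_eq] at hx ⊢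
  rwa [h.fib_eq hij τ h1 h2, h1 i hij]

theorem coordSymm_steiner (i : Fin (m + 1)) (W : Set (Euc m × ℝ)) :
    CoordSymm i (steiner i W) := by
  intro x x' τ h1 h2 hx
  simp only [steiner, mem_ofPred_eq] at hx ⊢
  have : rest i x' = rest i x := funext fun k => h1 _ (i.succAbove_ne k)
  rwa [h2, abs_neg, this]

theorem IsBody.exists_zint_mom_le_of_coordSymm (hp : 1 ≤ p) {r : ℝ} (hr : 0 < r)
    (T : Finset (Fin (m + 1))) : ∀ {W : Set (Euc m × ℝ)}, IsBody R M W → 0 < volume.real W →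
    0 < ∫ w in W, w.2 ^ r → (∀ j ∉ T, CoordSymm j W) →
    ∃ c : Euc m, (∀ j ∉ T, c j = 0) ∧ (∀ y, y ≠ 0 → 0 < mom p W c y) ∧
      zint (mom p W c) ≤ zintBound m p (sphereMean m p *
        momentBound m p (1 / r) (volume.real W) (∫ w in W, w.2 ^ r)) := by
  have hp0 : 0 < p := by linarith
  induction T using Finset.induction_on with
  | empty =>
    intro W hW hv hN hsym
    have hE : IsEven W := isEven_of_coordSymm fun j => hsym j (Finset.notMem_empty j)
    refine ⟨0, fun _ _ => rfl, fun y hy => hE.mom_pos hW (fun h0 => hv.ne' ?_) hp0 hy,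
      hE.zint_mom_le hW hp hr hv hN⟩
    simp [measureReal_def, h0]
  | insert i T hi ih =>
    intro W hW hv hN hsym
    have hvS := hW.volume_real_steiner i
    have hNS := hW.integral_steiner i (F := fun w => w.2 ^ r)
      (continuous_snd.rpow_const fun _ => Or.inr hr.le) fun _ _ _ => rfl
    obtain ⟨c, hc0, hcpos, hcz⟩ := ih (hW.steiner i) (hvS.symm ▸ hv) (hNS.symm ▸ hN)
      fun j hj => by
        by_cases hij : i = j
        · exact hij ▸ coordSymm_steiner i W
        · exact (hsym j fun h => hj (Finset.mem_of_mem_insert_of_ne h (Ne.symm hij))).steiner_of_ne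
            hij
    have hci : c = ins i 0 (rest i c) := by
      conv_lhs => rw [← ins_rest i c, hc0 i hi]
    rw [hvS, hNS] at hcz
    rw [hci] at hcpos hcz
    obtain ⟨a, hpos, hbal⟩ := hW.exists_balanced hp i (rest i c) hcpos
    refine ⟨ins i a (rest i c), fun j hj => ?_, hpos,
      (hW.zint_le_steiner hp i hpos hcpos hbal).trans hcz⟩
    rw [Finset.mem_insert, not_or] at hj
    obtain ⟨l, rfl⟩ := Fin.exists_succAbove_eq hj.1
    rw [ins_succAbove]
    exact hc0 _ hj.2

/-- The set form of the Blaschke–Santaló inequality. -/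
theorem IsBody.exists_zint_mom_le (hW : IsBody R M W) (hp : 1 ≤ p) {r : ℝ} (hr : 0 < r)
    (hv : 0 < volume.real W) (hN : 0 < ∫ w in W, w.2 ^ r) :
    ∃ c : Euc m, (∀ y, y ≠ 0 → 0 < mom p W c y) ∧
      zint (mom p W c) ≤ zintBound m p (sphereMean m p *
        momentBound m p (1 / r) (volume.real W) (∫ w in W, w.2 ^ r)) := by
  obtain ⟨c, -, h⟩ := exists_zint_mom_le_of_coordSymm hp hr Finset.univ hW hv hN
    fun j hj => absurd (Finset.mem_univ j) hj
  exact ⟨c, h⟩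

theorem toSphere_real_univ (m : ℕ) : (volume : Measure (Euc m)).toSphere.real univ =
    (m + 1 : ℕ) * (√π ^ (m + 1) / Real.Gamma (((m + 1 : ℕ) + 2) / 2)) := by
  have h : 0 < Real.Gamma (((m + 1 : ℕ) + 2) / 2) := Real.Gamma_pos_of_pos (by positivity)
  rw [Measure.toSphere_real_apply_univ, finrank_euclideanSpace, Fintype.card_fin, Measure.real,
    EuclideanSpace.volume_ball, Fintype.card_fin]
  rw [show (((m + 1 : ℕ) : ℝ) / 2 + 1) = ((m + 1 : ℕ) + 2) / 2 by ring]
  rw [ENNReal.ofReal_one, one_pow, one_mul, ENNReal.toReal_ofReal (by positivity)]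

theorem Rnp_eq (hp : 0 < p) : Rnp (m + 1) p =
    ((volume : Measure (Euc m)).toSphere.real univ / (m + 1 : ℕ)) ^ 2 *
      (((m + 1 : ℕ) + p) / ((m + 1 : ℕ) * sphereMean m p)) ^ (((m + 1 : ℕ) : ℝ) / p) := by
  have hν : (0 : ℝ) < (m + 1 : ℕ) := by positivity
  have hν' : (((m + 1 : ℕ) : ℝ)) = m + 1 := by push_cast; ring
  unfold sphereMean Rnp
  rw [toSphere_real_univ]
  set ν : ℝ := ((m + 1 : ℕ) : ℝ) with hνd
  have h1 : 0 < Real.Gamma ((ν + 2) / 2) := Real.Gamma_pos_of_pos (by positivity)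
  have h2 : 0 < Real.Gamma ((p + 1) / 2) := Real.Gamma_pos_of_pos (by linarith)
  have h3 : 0 < Real.Gamma ((ν + p) / 2) := Real.Gamma_pos_of_pos (by positivity)
  have h4 : Real.Gamma ((ν + p + 2) / 2) = (ν + p) / 2 * Real.Gamma ((ν + p) / 2) := by
    rw [← Real.Gamma_add_one (by positivity)]; congr 1; ring
  have hπ := pi_pos
  have hs : 0 < √π := Real.sqrt_pos.2 hπ
  have h5 : (ν + p) / (ν * (Real.Gamma ((p + 1) / 2) * √π ^ m /
      (Real.Gamma ((ν + p) / 2) * (ν * (√π ^ (m + 1) / Real.Gamma ((ν + 2) / 2)))))) =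
      √π * (2 * Real.Gamma ((ν + p + 2) / 2) /
        (Real.Gamma ((ν + 2) / 2) * Real.Gamma ((p + 1) / 2))) := by
    rw [h4, pow_succ]
    field_simp
  have h6 : π ^ (ν / (2 * p) + ν) = (√π ^ (m + 1)) ^ 2 * √π ^ (ν / p) := by
    rw [← pow_mul, ← Real.rpow_natCast, Real.sqrt_eq_rpow, ← Real.rpow_mul hπ.le,
      ← Real.rpow_mul hπ.le, ← Real.rpow_add hπ]
    congr 1
    push_cast
    rw [hν']
    field_simp
    ring
  rw [h5, h6, Real.mul_rpow hs.le (by rw [h4]; positivity), mul_div_assoc]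
  field_simp

theorem momentConst_eq (hp : 0 < p) {s : ℝ} (hs : 0 < s) : momentConst m p s =
    (volume : Measure (Euc m)).toSphere.real univ *
      ProbabilityTheory.beta ((m + 1 : ℕ) / p) (1 + s) / (p * ((m + 1 : ℕ) / p + s + 1)) := by
  have hx : (0 : ℝ) < (m + 1 : ℕ) / p := by positivity
  unfold momentConst
  set x : ℝ := (m + 1 : ℕ) / p
  have h3 : 0 < Real.Gamma (x + (1 + s)) := Real.Gamma_pos_of_pos (by positivity)
  rw [ProbabilityTheory.beta, ProbabilityTheory.beta, show s + 2 = (1 + s) + 1 by ring,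
    Real.Gamma_add_one (by positivity), ← add_assoc x, Real.Gamma_add_one (by positivity)]
  field_simp
  ring

theorem rpow_sharp_constants {n p s v L N lam x σ κ Bt : ℝ} (hn : 0 < n) (hp : 0 < p) (hs : 0 < s)
    (hv : 0 < v) (hL : 0 < L) (hσ : 0 < σ) (hκ : 0 < κ) (hB : 0 < Bt)
    (hx : x = n / p) (hlam : lam = (1 + s) / s) (hN : N = L / lam) :
    v ^ (n + (1 + s) * p) =
      (n / (n + p)) ^ n * (x * (n / ((1 + s) * p) + 1) ^ s * ((1 + s) * p / n + 1) ^ x * Bt) ^ p *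
        ((σ / n) ^ 2 * ((n + p) / (n * κ)) ^ x) ^ p * n ^ p *
      (L ^ (1 / lam)) ^ ((1 + s) * p) *
      (σ * (κ * (x * (v / (x + s + 1)) * ((v / (x + s + 1)) * (s * (v / (x + s + 1)) / N) ^ s /
        (σ * Bt / (p * (x + s + 1)))) ^ (p / n))) ^ (-x)) ^ (-p) := by
  have hx0 : 0 < x := hx ▸ div_pos hn hp
  have hl0 : 0 < lam := by rw [hlam]; positivity
  have hN0 : 0 < N := by rw [hN]; positivity
  have e1 : n / ((1 + s) * p) + 1 = (x + s + 1) / (1 + s) := by rw [hx]; field_simp; ring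
  have e2 : (1 + s) * p / n + 1 = (x + s + 1) / x := by rw [hx]; field_simp; ring
  have l1 : Real.log N = Real.log L - (Real.log (1 + s) - Real.log s) := by
    rw [hN, hlam, Real.log_div hL.ne' (by positivity), Real.log_div (by positivity) hs.ne']
  have l2 : Real.log n = Real.log x + Real.log p := by
    rw [hx, Real.log_div hn.ne' hp.ne']; ring
  have e3 : n = x * p := by rw [hx]; field_simp
  rw [e1, e2]
  refine Real.log_injOn_pos (mem_Ioi.2 (by positivity)) (mem_Ioi.2 (by positivity)) ?_
  rw [Real.log_rpow hv]
  repeat rw [Real.log_mul (by positivity) (by positivity)]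
  repeat rw [Real.log_rpow (by positivity)]
  repeat rw [Real.log_mul (by positivity) (by positivity)]
  repeat rw [Real.log_rpow (by positivity)]
  repeat rw [Real.log_mul (by positivity) (by positivity)]
  repeat rw [Real.log_rpow (by positivity)]
  repeat rw [Real.log_div (by positivity) (by positivity)]
  repeat rw [Real.log_mul (by positivity) (by positivity)]
  repeat rw [Real.log_rpow (by positivity)]
  repeat rw [Real.log_div (by positivity) (by positivity)]
  repeat rw [Real.log_mul (by positivity) (by positivity)]
  repeat rw [Real.log_div (by positivity) (by positivity)]
  rw [Real.log_pow, Real.log_div (by positivity) (by positivity), l1, l2, hlam, e3]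
  push_cast
  field_simp
  ring

variable {f : Euc m → ℝ}

/-- The region between zero and the graph of a function. -/
def hypograph (f : Euc m → ℝ) : Set (Euc m × ℝ) := {w | 0 < w.2 ∧ w.2 < f w.1}

theorem exists_isBody_hypograph (hc : Continuous f)
    (hs : HasCompactSupport f) : ∃ R M, IsBody R M (hypograph f) := by
  obtain ⟨R, hR⟩ := hs.isBounded.exists_norm_le
  obtain ⟨M, hM⟩ := hs.exists_bound_of_continuous hc
  refine ⟨R, M, ?_, fun w hw => hR _ (subset_tsupport _ ?_), fun w hw => hw.1,
    fun w hw => hw.2.le.trans ((le_abs_self _).trans (hM w.1))⟩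
  · exact ((isOpen_lt continuous_const continuous_snd).inter
      (isOpen_lt continuous_snd (hc.comp continuous_fst))).measurableSet
  · exact (hw.1.trans hw.2).ne'

theorem setIntegral_hypograph (hW : IsBody R M (hypograph f)) {F : Euc m × ℝ → ℝ}
    (hF : Continuous F) :
    ∫ w in hypograph f, F w = ∫ x, ∫ τ in Ioo 0 (f x), F (x, τ) := by
  rw [← integral_indicator hW.meas, Measure.volume_eq_prod,
    integral_prod _ ((integrable_indicator_iff hW.meas).2 (hW.integrableOn hF))]
  refine integral_congr_ae (ae_of_all _ fun x => ?_)
  simp only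
  rw [← integral_indicator measurableSet_Ioo]
  rfl

theorem volume_real_hypograph (h0 : ∀ x, 0 ≤ f x) (hW : IsBody R M (hypograph f)) :
    volume.real (hypograph f) = ∫ x, f x := by
  have h := setIntegral_hypograph hW (F := fun _ => 1) continuous_const
  simp only [setIntegral_const, smul_eq_mul, mul_one] at h
  rw [h]
  refine integral_congr_ae (ae_of_all _ fun x => ?_)
  simp [h0 x]

theorem setIntegral_rpow_hypograph (h0 : ∀ x, 0 ≤ f x) (hW : IsBody R M (hypograph f)) {r : ℝ}
    (hr : 0 < r) : ∫ w in hypograph f, w.2 ^ r = (∫ x, f x ^ (r + 1)) / (r + 1) := by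
  have h := setIntegral_hypograph hW (F := fun w => w.2 ^ r)
    (continuous_snd.rpow_const fun _ => Or.inr hr.le)
  rw [h, ← integral_div]
  refine integral_congr_ae (ae_of_all _ fun x => ?_)
  simp only
  rw [← integral_Ioc_eq_integral_Ioo, ← intervalIntegral.integral_of_le (h0 x),
    integral_rpow (Or.inl (by linarith)), Real.zero_rpow (by linarith), sub_zero]

theorem mom_hypograph (hp : 0 ≤ p) (h0 : ∀ x, 0 ≤ f x) (hW : IsBody R M (hypograph f))
    (c y : Euc m) : mom p (hypograph f) c y = ∫ x, f x * ppow p ⟪x + c, y⟫ := by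
  rw [mom, setIntegral_hypograph hW (continuous_ppow_inner hp c y)]
  refine integral_congr_ae (ae_of_all _ fun x => ?_)
  simp [h0 x]

theorem epsPow_eq (eps p s : ℝ) :
    epsPow eps p s = (1 - eps) * ppow p s + eps * ppow p (-s) := rfl

theorem integral_mul_epsPow (hp : 0 ≤ p) (hc : Continuous f) (h0 : ∀ x, 0 ≤ f x)
    (hs : HasCompactSupport f) (hW : IsBody R M (hypograph f)) (eps : ℝ) (c y : Euc m) :
    ∫ x, f (x - c) * epsPow eps p ⟪x, y⟫ =
      (1 - eps) * mom p (hypograph f) c y + eps * mom p (hypograph f) c (-y) := by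
  have hi : ∀ z : Euc m, Integrable fun x => f x * ppow p ⟪x + c, z⟫ := fun z => by
    have h1 : Continuous fun x : Euc m => ppow p ⟪x + c, z⟫ :=
      (continuous_ppow hp).comp (by fun_prop)
    exact (hc.mul h1).integrable_of_hasCompactSupport hs.mul_right
  have h1 := integral_sub_right_eq_self (μ := volume) (fun x => f x * epsPow eps p ⟪x + c, y⟫) c
  simp only [sub_add_cancel] at h1
  rw [h1, mom_hypograph hp h0 hW, mom_hypograph hp h0 hW, ← integral_const_mul,
    ← integral_const_mul, ← integral_add ((hi _).const_mul _) ((hi _).const_mul _)]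
  refine integral_congr_ae (ae_of_all _ fun x => ?_)
  simp only [epsPow_eq, inner_neg_right]
  ring

theorem zint_asymmetric_le {A : Euc m → ℝ} (hA : Continuous A) {eps : ℝ} (h0 : 0 ≤ eps)
    (h1 : eps ≤ 1) : zint (fun y => (1 - eps) * A y + eps * A (-y)) ≤ zint A := by
  have hneg : zint (fun y => A (-y)) = zint A :=
    lintegral_neg_eq_self fun y => ENNReal.ofReal (Real.exp (-A y))
  have h2 : zint (fun y => (1 - eps) * A y + eps * A (-y)) ≤
      ENNReal.ofReal (1 - eps) * zint A + ENNReal.ofReal eps * zint (fun y => A (-y)) := by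
    unfold zint
    rw [← lintegral_const_mul' _ _ ENNReal.ofReal_ne_top,
      ← lintegral_const_mul' _ _ ENNReal.ofReal_ne_top, ← lintegral_add_left (by fun_prop)]
    refine lintegral_mono fun y => ?_
    rw [← ENNReal.ofReal_mul (by linarith), ← ENNReal.ofReal_mul h0,
      ← ENNReal.ofReal_add (by have := sub_nonneg.2 h1; positivity) (by positivity)]
    refine ENNReal.ofReal_le_ofReal ?_
    have := convexOn_exp.2 (mem_univ (-A y)) (mem_univ (-A (-y))) (sub_nonneg.2 h1) h0 (by ring)
    simp only [smul_eq_mul] at this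
    refine le_trans (le_of_eq ?_) this
    congr 1; ring
  refine h2.trans (le_of_eq ?_)
  rw [hneg, ← add_mul, ← ENNReal.ofReal_add (by linarith) h0, sub_add_cancel, ENNReal.ofReal_one,
    one_mul]

theorem IsGauge.integral_sphere_le {A : Euc m → ℝ} (hA : IsGauge p A) (hp : 0 < p)
    (hpos : ∀ y, y ≠ 0 → 0 < A y) {a : ℝ} (ha : 0 < a) (hz : zint A ≤ zintBound m p a) :
    0 < ∫ ξ : Metric.sphere (0 : Euc m) 1, A ξ ^ (-(((m + 1 : ℕ) : ℝ) / p))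
        ∂(volume : Measure (Euc m)).toSphere ∧
    ∫ ξ : Metric.sphere (0 : Euc m) 1, A ξ ^ (-(((m + 1 : ℕ) : ℝ) / p))
        ∂(volume : Measure (Euc m)).toSphere ≤
      (volume : Measure (Euc m)).toSphere.real univ * a ^ (-(((m + 1 : ℕ) : ℝ) / p)) := by
  have hξ : ∀ ξ : Metric.sphere (0 : Euc m) 1, 0 < A ξ := fun ξ => hpos _ fun h => by
    have := ξ.2
    simp [h] at this
  have hcont : Continuous fun ξ : Metric.sphere (0 : Euc m) 1 =>
      A ξ ^ (-(((m + 1 : ℕ) : ℝ) / p)) :=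
    (hA.cont.comp continuous_subtype_val).rpow_const fun ξ => Or.inl (hξ ξ).ne'
  have h_int := hcont.integrable_of_hasCompactSupport
    (μ := (volume : Measure (Euc m)).toSphere) (HasCompactSupport.of_compactSpace _)
  have hpos' : ∀ ξ : Metric.sphere (0 : Euc m) 1, 0 < A ξ ^ (-(((m + 1 : ℕ) : ℝ) / p)) :=
    fun ξ => Real.rpow_pos_of_pos (hξ ξ) _
  have hσ := toSphere_real_univ_pos m
  constructor
  · rw [integral_pos_iff_support_of_nonneg (fun ξ => (hpos' ξ).le) h_int,
      show Function.support _ = univ from eq_univ_of_forall fun ξ => (hpos' ξ).ne']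
    exact (ENNReal.toReal_pos_iff.1 hσ).1
  · have hΓ : 0 < Real.Gamma ((m + 1 : ℕ) / p) := Real.Gamma_pos_of_pos (by positivity)
    rw [hA.zint_eq hp hpos, zintBound, mul_assoc,
      ENNReal.mul_le_mul_iff_right (ENNReal.ofReal_pos.2 (by positivity)).ne'
        ENNReal.ofReal_ne_top] at hz
    simp only [ENNReal.ofReal_rpow_of_pos (hξ _), ENNReal.ofReal_rpow_of_pos ha] at hz
    rw [← ofReal_integral_eq_lintegral_ofReal h_int (ae_of_all _ fun ξ => (hpos' ξ).le),
      ← ENNReal.ofReal_toReal (measure_ne_top (volume : Measure (Euc m)).toSphere univ),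
      ← ENNReal.ofReal_mul ENNReal.toReal_nonneg] at hz
    exact (ENNReal.ofReal_le_ofReal_iff (by positivity)).1 hz

theorem functional_BS_asymmetric_succ (hp : 1 ≤ p) {lam : ℝ} (hlam : 1 < lam)
    (hc : Continuous f) (h0 : ∀ x, 0 ≤ f x) (hs : HasCompactSupport f) (hne : f ≠ 0) :
    ∃ c : Euc m, ∀ eps : ℝ, 0 ≤ eps → eps < 1 / 2 →
      (∫ x, f x) ^ (((m + 1 : ℕ) : ℝ) + (lam / (lam - 1)) * p) ≤
        bnpl (m + 1) p lam * ((∫ x, |f x| ^ lam) ^ (1 / lam)) ^ ((lam / (lam - 1)) * p) *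
          (∫ ξ : Metric.sphere (0 : Euc m) 1,
              (∫ x, f (x - c) * epsPow eps p ⟪x, (ξ : Euc m)⟫) ^ (-((m + 1 : ℕ) : ℝ) / p)
            ∂((volume : Measure (Euc m)).toSphere)) ^ (-p) := by
  have hp0 : 0 < p := by linarith
  obtain ⟨R, M, hW⟩ := exists_isBody_hypograph hc hs
  obtain ⟨x₀, hx₀⟩ : ∃ x, f x ≠ 0 := Function.ne_iff.1 hne
  set r := lam - 1 with hr
  have hr0 : 0 < r := by linarith
  have hlr : lam = r + 1 := by rw [hr]; ring
  have hv : 0 < volume.real (hypograph f) := by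
    rw [volume_real_hypograph h0 hW]
    exact hc.integral_pos_of_hasCompactSupport_nonneg_nonzero hs h0 hx₀
  have hL : 0 < ∫ x, f x ^ lam := by
    refine Continuous.integral_pos_of_hasCompactSupport_nonneg_nonzero (x := x₀)
      (hc.rpow_const fun _ => Or.inr (by linarith)) ?_ (fun x => Real.rpow_nonneg (h0 x) _)
      (Real.rpow_pos_of_pos ((h0 x₀).lt_of_ne' hx₀) _).ne'
    exact hs.comp_left (g := fun t : ℝ => t ^ lam) (Real.zero_rpow (by linarith))
  have hNe := setIntegral_rpow_hypograph h0 hW hr0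
  rw [← hlr] at hNe
  have hN : 0 < ∫ w in hypograph f, w.2 ^ r := by
    rw [hNe]; exact div_pos hL (by linarith)
  obtain ⟨c, hpos, hz⟩ := hW.exists_zint_mom_le hp hr0 hv hN
  refine ⟨c, fun eps he0 he1 => ?_⟩
  have hκ := sphereMean_pos (m := m) hp0
  have hm := momentBound_pos (m := m) hp0 (show 0 < 1 / r by positivity) hv hN
  set A := mom p (hypograph f) c with hAd
  have hA : IsGauge p A := hW.isGauge hp0.le c
  have hAe : IsGauge p fun y => (1 - eps) * A y + eps * A (-y) :=
    { cont := by have := hA.cont; fun_prop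
      nonneg := fun y => by
        have h1 := hA.nonneg y
        have h2 := hA.nonneg (-y)
        have : 0 ≤ 1 - eps := by linarith
        positivity
      smul := fun y t ht => by
        rw [← smul_neg, hA.smul _ _ ht, hA.smul _ _ ht]; ring }
  have hAe_pos : ∀ y, y ≠ 0 → 0 < (1 - eps) * A y + eps * A (-y) := fun y hy => by
    have h1 := hpos y hy
    have h2 := hA.nonneg (-y)
    have : 0 < 1 - eps := by linarith
    positivity
  obtain ⟨hI0, hI⟩ := hAe.integral_sphere_le hp0 hAe_pos (mul_pos hκ hm)
    ((zint_asymmetric_le hA.cont he0 (by linarith)).trans hz)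
  simp only [integral_mul_epsPow hp0.le hc h0 hs hW, abs_of_nonneg (h0 _), neg_div, ← hAd]
  have hs0 : 0 < 1 / r := by positivity
  have hlam' : lam / r = 1 + 1 / r := by rw [hlr]; field_simp
  have hx : (0 : ℝ) < (m + 1 : ℕ) / p := by positivity
  have hBt := ProbabilityTheory.beta_pos hx (show 0 < 1 + 1 / r by positivity)
  have hσ := toSphere_real_univ_pos m
  have hconst := rpow_sharp_constants (n := (m + 1 : ℕ)) (p := p) (s := 1 / r) (lam := lam)
    (by positivity) hp0 hs0 hv hL hσ hκ hBt rfl (by rw [hlr]; field_simp) hNe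
  have hb : bnpl (m + 1) p lam = (((m + 1 : ℕ) : ℝ) / ((m + 1 : ℕ) + p)) ^ ((m + 1 : ℕ) : ℝ) *
      ((m + 1 : ℕ) / p * ((m + 1 : ℕ) / ((1 + 1 / r) * p) + 1) ^ (1 / r) *
        ((1 + 1 / r) * p / (m + 1 : ℕ) + 1) ^ ((m + 1 : ℕ) / p : ℝ) *
        ProbabilityTheory.beta ((m + 1 : ℕ) / p) (1 + 1 / r)) ^ p *
      (((volume : Measure (Euc m)).toSphere.real univ / (m + 1 : ℕ)) ^ 2 *
        (((m + 1 : ℕ) + p) / ((m + 1 : ℕ) * sphereMean m p)) ^ (((m + 1 : ℕ) : ℝ) / p)) ^ p *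
      ((m + 1 : ℕ) : ℝ) ^ p := by
    rw [← Rnp_eq hp0, bnpl, anpl, ← hr, hlam', add_sub_cancel_left, ProbabilityTheory.beta]
  have hb0 : 0 ≤ bnpl (m + 1) p lam := by
    rw [hb]
    positivity
  rw [← hb, ← momentConst_eq hp0 hs0] at hconst
  rw [hlam', ← volume_real_hypograph h0 hW, hconst]
  refine mul_le_mul_of_nonneg_left ?_ (mul_nonneg hb0 (by positivity))
  exact Real.rpow_le_rpow_of_nonpos hI0 hI (by linarith)

end AsymmetricBS

/-- Asymmetric functional `L_p` Blaschke–Santaló inequality, case `λ ∈ (1, ∞)`: there is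
a point `c` (an `L_p` analogue of the center of mass of `f`) such that the inequality
holds for every `ε ∈ [0, 1/2)`. -/
theorem functional_BS_asymmetric (n : ℕ) (hn : 2 ≤ n) (p : ℝ) (hp : 1 ≤ p)
    (lam : ℝ) (hlam : 1 < lam)
    (f : EuclideanSpace ℝ (Fin n) → ℝ) (hf_cont : Continuous f)
    (hf_nonneg : ∀ x, 0 ≤ f x) (hf_supp : HasCompactSupport f) (hf_ne : f ≠ 0) :
    ∃ c : EuclideanSpace ℝ (Fin n), ∀ eps : ℝ, 0 ≤ eps → eps < 1 / 2 →
      (∫ x, f x) ^ ((n : ℝ) + (lam / (lam - 1)) * p) ≤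
        bnpl n p lam *
          ((∫ x, |f x| ^ lam) ^ (1 / lam)) ^ ((lam / (lam - 1)) * p) *
          (∫ ξ : Metric.sphere (0 : EuclideanSpace ℝ (Fin n)) 1,
              (∫ x, f (x - c) * epsPow eps p ⟪x, (ξ : EuclideanSpace ℝ (Fin n))⟫) ^ (-(n : ℝ) / p)
            ∂((volume : Measure (EuclideanSpace ℝ (Fin n))).toSphere)) ^ (-p) := by
  obtain ⟨m, rfl⟩ := Nat.exists_eq_succ_of_ne_zero (by lia : n ≠ 0)
  exact AsymmetricBS.functional_BS_asymmetric_succ hp hlam hf_cont hf_nonneg hf_supp hf_ne
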